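/- Let K be a number field and let m ≥ 1 be a natural number. Then the set {(a_{ij})_{1 ≤ i,j ≤ m} ∈ K^{m²} : the quadratic form Σ_{1 ≤ i,j ≤ m} a_{ij} x_i x_j = 0 has no nonzero solution (x₁, …, x_m) ∈ K^m} is diophantine over K. -/

import Mathlib

/-- A subset `S ⊆ K^ι` is diophantine over `K` if there are `m ∈ ℕ` and a polynomial
`f` in the variables `y_i` (`i : ι`) and `x_1, …, x_m` with coefficients in `K` such that
`a ∈ S` iff `f(a, x) = 0` has a solution `x ∈ K^m`. -/
def IsDiophantine {K : Type*} [Field K] {ι : Type*} [Fintype ι] (S : Set (ι → K)) : Prop :=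
  ∃ (m : ℕ) (f : MvPolynomial (ι ⊕ Fin m) K),
    ∀ a : ι → K, a ∈ S ↔ ∃ x : Fin m → K, MvPolynomial.eval (Sum.elim a x) f = 0

namespace ADQ

/-- subgroup of squares -/
abbrev sqr (G : Type*) [CommGroup G] : Subgroup G := (powMonoidHom 2 : G →* G).range

theorem herbrand {U H : Type*} [CommGroup U] [CommGroup H] (N : U →* H) (i : H →* U)
    (σ : U →* U) (hiN : ∀ u, i (N u) = u * σ u) (hNi : ∀ h, N (i h) = h ^ 2)
    (hi : Function.Injective i) (hσ : ∀ u, σ u = u ↔ u ∈ i.range) (hσσ : ∀ u, σ (σ u) = u) :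
    N.range.index * ((N.ker.map (powMonoidHom 2)).relIndex N.ker)
      = ((MonoidHom.id U / σ).range.relIndex N.ker) * (sqr H).index := by
  set d : U →* U := MonoidHom.id U / σ with hd
  have hdu : ∀ u, d u = u / σ u := fun u => rfl
  have hNσ : ∀ u, N (σ u) = N u := by
    intro u; apply hi; rw [hiN, hiN, hσσ, mul_comm]
  have hker : d.ker = i.range := by
    ext u; rw [MonoidHom.mem_ker, hdu, div_eq_one, ← hσ u]; exact eq_comm
  have h1 : N.range = (⊤ : Subgroup U).map N := by rw [MonoidHom.range_eq_map]
  have h2 : sqr H = i.range.map N := by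
    ext x; constructor
    · rintro ⟨h, rfl⟩; exact ⟨i h, ⟨h, rfl⟩, hNi h⟩
    · rintro ⟨_, ⟨h, rfl⟩, rfl⟩; exact ⟨h, (hNi h).symm⟩
  have h3 : (N.ker.map (powMonoidHom 2)) = N.ker.map d := by
    ext x; constructor
    · rintro ⟨u, hu, rfl⟩
      refine ⟨u, hu, ?_⟩
      have : u * σ u = 1 := by rw [← hiN, MonoidHom.mem_ker.1 hu, map_one]
      rw [hdu, ← eq_inv_of_mul_eq_one_right this |>.symm]; simp [pow_two]
    · rintro ⟨u, hu, rfl⟩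
      refine ⟨u, hu, ?_⟩
      have : u * σ u = 1 := by rw [← hiN, MonoidHom.mem_ker.1 hu, map_one]
      rw [hdu, ← eq_inv_of_mul_eq_one_right this |>.symm]; simp [pow_two]
  have h4 : d.range = (⊤ : Subgroup U).map d := by rw [MonoidHom.range_eq_map]
  have h5 : d.range ≤ N.ker := by
    rintro _ ⟨u, rfl⟩; rw [MonoidHom.mem_ker, hdu, map_div, hNσ, div_self']
  have e1 : (sqr H).relIndex N.range = (N.ker ⊔ i.range).index := by
    rw [h1, h2, Subgroup.relIndex_map_map]; simp [sup_comm]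
  have e2 : (N.ker.map (powMonoidHom 2)).relIndex d.range = (N.ker ⊔ i.range).index := by
    rw [h3, h4, Subgroup.relIndex_map_map, hker]; simp
  have e3 := Subgroup.relIndex_mul_relIndex (N.ker.map (powMonoidHom 2)) d.range N.ker
    (by rw [h3, h4]; exact Subgroup.map_mono le_top) h5
  have e4 : (sqr H).relIndex N.range * N.range.index = (sqr H).index :=
    Subgroup.relIndex_mul_index (by rw [h1, h2]; exact Subgroup.map_mono le_top)
  rw [← e3, ← e4, e1, e2]; ring

theorem index_sq_finite (G : Type*) [CommGroup G] [Finite G] :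
    (sqr G).index = Nat.card (powMonoidHom 2 : G →* G).ker := by
  have h1 := Subgroup.index_mul_card (sqr G)
  have h2 := Subgroup.index_mul_card (powMonoidHom 2 : G →* G).ker
  rw [Subgroup.index_ker] at h2
  have : 0 < Nat.card (sqr G) := Nat.card_pos
  rw [mul_comm] at h2
  exact Nat.eq_of_mul_eq_mul_right this (h1.trans h2.symm)

theorem index_sq_fg (G : Type*) [CommGroup G] [Group.FG G] :
    (sqr G).index = 2 ^ (Module.finrank ℤ (Additive G)) *
      Nat.card (powMonoidHom 2 : G →* G).ker := by
  obtain ⟨n, ι, _, p, hp, e, ⟨E⟩⟩ := AddCommGroup.equiv_free_prod_directSum_zmod (Additive G)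
  set T := DirectSum ι fun i => ZMod (p i ^ e i) with hT
  have : ∀ i, NeZero (p i ^ e i) := fun i => ⟨pow_ne_zero _ (hp i).ne_zero⟩
  have : Finite T := Finite.of_equiv _ (DirectSum.addEquivProd (fun i => ZMod (p i ^ e i))).symm.toEquiv
  have hrT : Module.finrank ℤ T = 0 := by
    rw [Module.finrank_eq_zero_iff]
    intro x
    refine ⟨Nat.card T, by exact_mod_cast Nat.card_pos.ne', ?_⟩
    rw [Nat.cast_smul_eq_nsmul]; exact card_nsmul_eq_zero'
  have hr : Module.finrank ℤ (Additive G) = n := by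
    rw [E.toIntLinearEquiv.finrank_eq]
    have := Submodule.finrank_quotient_add_finrank
      (LinearMap.ker (LinearMap.fst ℤ (Fin n →₀ ℤ) T))
    rw [← this, (LinearMap.quotKerEquivOfSurjective _ (LinearMap.fst_surjective)).finrank_eq,
      LinearMap.ker_fst, LinearMap.finrank_range_of_inj LinearMap.inr_injective, hrT]
    simp
  rw [hr]
  -- transfer
  let E' : G ≃* Multiplicative (Fin n →₀ ℤ) × Multiplicative T :=
    (MulEquiv.refl G : G ≃* G).trans ((AddEquiv.toMultiplicativeRight E).trans
      (MulEquiv.prodMultiplicative _ _))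
  have k1 : (sqr G).index = (sqr (Multiplicative (Fin n →₀ ℤ) × Multiplicative T)).index := by
    have : sqr (Multiplicative (Fin n →₀ ℤ) × Multiplicative T) = (sqr G).map E'.toMonoidHom := by
      ext x; constructor
      · rintro ⟨y, rfl⟩; exact ⟨(E'.symm y) ^ 2, ⟨E'.symm y, rfl⟩, by simp⟩
      · rintro ⟨_, ⟨y, rfl⟩, rfl⟩; exact ⟨E' y, by simp⟩
    rw [this, Subgroup.index_map_of_bijective E'.bijective]
  have k2 : sqr (Multiplicative (Fin n →₀ ℤ) × Multiplicative T)
      = (sqr (Multiplicative (Fin n →₀ ℤ))).prod (sqr (Multiplicative T)) := by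
    ext ⟨x, y⟩; constructor
    · rintro ⟨⟨a, b⟩, h⟩
      simp only [powMonoidHom_apply, Prod.pow_mk, Prod.mk.injEq] at h
      exact ⟨⟨a, h.1⟩, ⟨b, h.2⟩⟩
    · rintro ⟨⟨a, ha⟩, ⟨b, hb⟩⟩
      exact ⟨(a, b), by simp only [powMonoidHom_apply, Prod.pow_mk] at *; rw [ha, hb]⟩
  have k3 : Nat.card (powMonoidHom 2 : G →* G).ker
      = Nat.card (powMonoidHom 2 : Multiplicative T →* Multiplicative T).ker := by
    refine Nat.card_congr (Equiv.symm ?_)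
    refine Equiv.ofBijective (fun t => ⟨E'.symm (1, t.1), ?_⟩) ⟨?_, ?_⟩
    · rw [MonoidHom.mem_ker]
      have := t.2
      rw [MonoidHom.mem_ker] at this
      rw [powMonoidHom_apply] at this ⊢
      rw [← map_pow, Prod.pow_mk, this]; simp
    · intro a b h
      have h' := congrArg Subtype.val h
      have h2 := E'.symm.injective h'
      exact Subtype.ext (congrArg Prod.snd h2)
    · rintro ⟨g, hg⟩
      rw [MonoidHom.mem_ker, powMonoidHom_apply] at hg
      have h2 : (E' g) ^ 2 = 1 := by rw [← map_pow, hg, map_one]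
      have h3 : (E' g).1 = 1 := by
        have h31 : ((E' g).1) ^ 2 = 1 := congrArg Prod.fst h2
        have : (2:ℕ) • (Multiplicative.toAdd (E' g).1) = 0 := h31
        have := (smul_eq_zero.1 this).resolve_left (by norm_num)
        exact this
      refine ⟨⟨(E' g).2, ?_⟩, ?_⟩
      · exact congrArg Prod.snd h2
      · apply Subtype.ext; simp only; rw [MulEquiv.symm_apply_eq]; ext1
        · exact h3.symm
        · rfl
  have k4 : (sqr (Multiplicative (Fin n →₀ ℤ))).index = 2 ^ n := by
    let f : Multiplicative (Fin n →₀ ℤ) →* Multiplicative (Fin n → ZMod 2) :=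
      AddMonoidHom.toMultiplicative
        { toFun := fun x i => ((x i : ℤ) : ZMod 2), map_zero' := by ext; simp,
          map_add' := by intros; ext; simp }
    have hf : ∀ x i, Multiplicative.toAdd (f x) i = ((Multiplicative.toAdd x i : ℤ) : ZMod 2) :=
      fun x i => rfl
    have : sqr (Multiplicative (Fin n →₀ ℤ)) = f.ker := by
      ext x; rw [MonoidHom.mem_ker]; constructor
      · rintro ⟨y, rfl⟩
        apply Multiplicative.toAdd.injective
        funext i
        rw [hf]
        have h2 : (2 : ZMod 2) = 0 := rfl
        simp [h2]
      · intro h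
        have h' : ∀ i, (2:ℤ) ∣ Multiplicative.toAdd x i := by
          intro i
          have := hf x i
          rw [h] at this
          exact (ZMod.intCast_zmod_eq_zero_iff_dvd _ 2).1 this.symm
        choose y hy using h'
        refine ⟨Multiplicative.ofAdd (Finsupp.equivFunOnFinite.symm y), ?_⟩
        apply Multiplicative.toAdd.injective
        ext i
        simp [hy i]
    rw [this, Subgroup.index_ker]
    have hs : Function.Surjective f := by
      intro y
      refine ⟨Multiplicative.ofAdd (Finsupp.equivFunOnFinite.symm
        (fun i => ((Multiplicative.toAdd y i).val : ℤ))), ?_⟩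
      apply Multiplicative.toAdd.injective
      funext i; rw [hf]; simp
    rw [MonoidHom.range_eq_top.2 hs]
    simp [Nat.card_eq_fintype_card]
  rw [k1, k2, Subgroup.index_prod, k4, index_sq_finite, k3]

end ADQ

namespace ADQ
open NumberField IsDedekindDomain

section gen
variable {K : Type*} [Field K]

/-- closure of squares -/
def LSq (f : AbsoluteValue K ℝ) (x : K) : Prop := ∀ ε > 0, ∃ y, f (y ^ 2 - x) < ε

/-- squares are open at one -/
def OpenSq (f : AbsoluteValue K ℝ) : Prop := ∃ ε > 0, ∀ x, f (x - 1) < ε → LSq f x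

variable {f : AbsoluteValue K ℝ}

theorem LSq.sq (y : K) : LSq f (y ^ 2) := fun ε hε => ⟨y, by simpa using hε⟩
theorem LSq.zero : LSq f 0 := by simpa using LSq.sq (f := f) 0
theorem LSq.one : LSq f 1 := by simpa using LSq.sq (f := f) 1

theorem LSq.mul {x x' : K} (h : LSq f x) (h' : LSq f x') : LSq f (x * x') := by
  intro ε hε
  obtain ⟨y, hy⟩ := h (min 1 (ε / (2 * (f x' + 1)))) (by have := f.nonneg x'; positivity)
  obtain ⟨z, hz⟩ := h' (ε / (2 * (f x + 1))) (by have := f.nonneg x; positivity)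
  refine ⟨y * z, ?_⟩
  have h1 : (y * z) ^ 2 - x * x' = y ^ 2 * (z ^ 2 - x') + x' * (y ^ 2 - x) := by ring
  have hx := f.nonneg x
  have hx' := f.nonneg x'
  have h2 : f (y ^ 2) ≤ f x + 1 := by
    have : y ^ 2 = x + (y ^ 2 - x) := by ring
    rw [this]
    have := f.add_le x (y ^ 2 - x)
    linarith [lt_of_lt_of_le hy (min_le_left _ _)]
  have h3 := lt_of_lt_of_le hy (min_le_right _ _)
  rw [h1]
  refine lt_of_le_of_lt (f.add_le _ _) ?_
  rw [f.map_mul, f.map_mul]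
  have a1 : f (y ^ 2) * f (z ^ 2 - x') ≤ (f x + 1) * f (z ^ 2 - x') :=
    mul_le_mul_of_nonneg_right h2 (f.nonneg _)
  have a2 : (f x + 1) * f (z ^ 2 - x') < ε / 2 := by
    rw [lt_div_iff₀ (by positivity)] at hz
    linarith
  have a3 : f x' * f (y ^ 2 - x) ≤ (f x' + 1) * f (y ^ 2 - x) :=
    mul_le_mul_of_nonneg_right (by linarith) (f.nonneg _)
  have a4 : (f x' + 1) * f (y ^ 2 - x) < ε / 2 := by
    rw [lt_div_iff₀ (by positivity)] at h3
    linarith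
  linarith

theorem LSq.inv {x : K} (h : LSq f x) : LSq f x⁻¹ := by
  by_cases hx : x = 0
  · subst hx; simpa using LSq.zero
  have : x⁻¹ = x * (x⁻¹) ^ 2 := by field_simp
  rw [this]; exact h.mul (LSq.sq _)

theorem LSq.div {x y : K} (h : LSq f x) (h' : LSq f y) : LSq f (x / y) := by
  rw [div_eq_mul_inv]; exact h.mul h'.inv

theorem LSq.of_mul_left {x y : K} (hx : x ≠ 0) (h : LSq f x) (h' : LSq f (x * y)) : LSq f y := by
  have := h'.div h
  rwa [mul_div_cancel_left₀ _ hx] at this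

theorem LSq.of_mul_right {x y : K} (hx : x ≠ 0) (h : LSq f x) (h' : LSq f (y * x)) : LSq f y := by
  rw [mul_comm] at h'; exact LSq.of_mul_left hx h h'

theorem LSq.mul_sq_iff {x y : K} (hy : y ≠ 0) : LSq f (x * y ^ 2) ↔ LSq f x :=
  ⟨fun h => LSq.of_mul_right (pow_ne_zero 2 hy) (LSq.sq y) h, fun h => h.mul (LSq.sq y)⟩

/-- near elements have the same class -/
theorem OpenSq.near (ho : OpenSq f) {t : K} (ht : t ≠ 0) :
    ∃ ε > 0, ∀ x, f (x - t) < ε → x ≠ 0 ∧ LSq f (x * t) := by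
  obtain ⟨ε, hε, h⟩ := ho
  have hft : 0 < f t := f.pos ht
  refine ⟨min ε 1 * f t, by positivity, fun x hx => ?_⟩
  have h1 : f (x / t - 1) < min ε 1 := by
    have : x / t - 1 = (x - t) / t := by field_simp
    rw [this, map_div₀, div_lt_iff₀ hft]; exact hx
  constructor
  · rintro rfl
    have := lt_of_lt_of_le h1 (min_le_right _ _)
    simp at this
  · have := h _ (lt_of_lt_of_le h1 (min_le_left _ _))
    have h2 : x * t = (x / t) * t ^ 2 := by field_simp
    rw [h2]; exact this.mul (LSq.sq t)

/-- the set of local squares is closed away from zero -/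
theorem OpenSq.approx (ho : OpenSq f) {ι : Type*} [Fintype ι] (c e : ι → K)
    (he : ∀ i, LSq f (e i)) (ht : ∑ i, c i * e i ≠ 0) :
    ∃ x : ι → K, ∑ i, c i * x i ^ 2 ≠ 0 ∧ LSq f ((∑ i, c i * x i ^ 2) * ∑ i, c i * e i) := by
  obtain ⟨ε, hε, h⟩ := ho.near ht
  set C := ∑ i, f (c i) with hC
  have hC0 : 0 ≤ C := Finset.sum_nonneg fun i _ => f.nonneg _
  have : ∀ i, ∃ y, f (y ^ 2 - e i) < ε / (C + 1) := fun i => he i _ (by positivity)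
  choose x hx using this
  refine ⟨x, h _ ?_⟩
  rw [← Finset.sum_sub_distrib]
  calc f (∑ i, (c i * x i ^ 2 - c i * e i)) ≤ ∑ i, f (c i * x i ^ 2 - c i * e i) := f.sum_le _ _
    _ ≤ ∑ i, f (c i) * (ε / (C + 1)) := by
        refine Finset.sum_le_sum fun i _ => ?_
        rw [← mul_sub, f.map_mul]
        exact mul_le_mul_of_nonneg_left (hx i).le (f.nonneg _)
    _ = C * (ε / (C + 1)) := by rw [← Finset.sum_mul]
    _ < ε := by
        rw [mul_div_assoc', div_lt_iff₀ (by positivity)]; nlinarith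

theorem openSq_nonarch (hf : IsNonarchimedean f) (h2 : (2 : K) ≠ 0) {x : K} (hx : f (x - 1) < f 4) :
    LSq f x := by
  have h40 : 0 < f 4 := f.pos (by have : (4:K) = 2 * 2 := by norm_num
                                  rw [this]; exact mul_ne_zero h2 h2)
  have h41 : f 4 ≤ 1 := by
    have : f ((4:ℕ) : K) ≤ 1 := IsNonarchimedean.apply_natCast_le_one hf
    exact_mod_cast this
  set δ := f (x - 1) / f 4 with hδ
  have hδ0 : 0 ≤ δ := div_nonneg (f.nonneg _) h40.le
  have hδ1 : δ < 1 := by rw [hδ, div_lt_one h40]; exact hx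
  have hfx : f x = 1 := by
    have h1 : f (x - 1) < f 1 := by rw [f.map_one]; linarith
    have := IsNonarchimedean.add_eq_max_of_ne (f := f) hf (x := x - 1) (y := 1) h1.ne
    rw [sub_add_cancel, max_eq_right h1.le, f.map_one] at this
    exact this
  have key : ∀ n : ℕ, ∃ y, f (y ^ 2 - x) ≤ f 4 * δ ^ (n + 1) := by
    intro n
    induction n with
    | zero =>
      refine ⟨1, ?_⟩
      rw [zero_add, pow_one, hδ, mul_div_cancel₀ _ h40.ne', one_pow, f.map_sub]
    | succ n ih =>
      obtain ⟨y, hy⟩ := ih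
      have hlt : f (y ^ 2 - x) < 1 := by
        refine lt_of_le_of_lt hy ?_
        have : δ ^ (n + 1) < 1 := pow_lt_one₀ hδ0 hδ1 (by omega)
        nlinarith [pow_nonneg hδ0 (n+1)]
      have hy1 : f (y ^ 2) = 1 := by
        have h1 : f (y ^ 2 - x) < f x := by rw [hfx]; exact hlt
        have := IsNonarchimedean.add_eq_max_of_ne (f := f) hf (x := y ^ 2 - x) (y := x) h1.ne
        rw [sub_add_cancel, max_eq_right h1.le, hfx] at this
        exact this
      have hy0 : y ≠ 0 := by rintro rfl; simp at hy1
      refine ⟨y - (y ^ 2 - x) / (2 * y), ?_⟩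
      have e1 : (y - (y ^ 2 - x) / (2 * y)) ^ 2 - x = (y ^ 2 - x) ^ 2 / (4 * y ^ 2) := by
        have : (4:K) = 2 * 2 := by norm_num
        rw [this]; field_simp; ring
      rw [e1, map_div₀, f.map_pow, f.map_mul, hy1, mul_one, div_le_iff₀ h40]
      calc f (y ^ 2 - x) ^ 2 ≤ (f 4 * δ ^ (n + 1)) ^ 2 := pow_le_pow_left₀ (f.nonneg _) hy 2
        _ = f 4 * δ ^ (n + 1 + 1) * f 4 * δ ^ n := by ring
        _ ≤ f 4 * δ ^ (n + 1 + 1) * f 4 * 1 := by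
            apply mul_le_mul_of_nonneg_left (pow_le_one₀ hδ0 hδ1.le)
            positivity
        _ = _ := by ring
  intro ε hε
  obtain ⟨n, hn⟩ := exists_pow_lt_of_lt_one hε hδ1
  obtain ⟨y, hy⟩ := key n
  refine ⟨y, lt_of_le_of_lt hy (lt_of_le_of_lt ?_ hn)⟩
  rw [pow_succ]
  have := pow_nonneg hδ0 n
  calc f 4 * (δ ^ n * δ) ≤ 1 * (δ ^ n * 1) := by
        apply mul_le_mul h41 _ (by positivity) (by norm_num)
        exact mul_le_mul_of_nonneg_left hδ1.le this
    _ = δ ^ n := by ring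

end gen

section places
variable (K : Type*) [Field K] [NumberField K]

abbrev FP := HeightOneSpectrum (𝓞 K)
abbrev Place := FP K ⊕ InfinitePlace K

variable {K}

noncomputable def av : Place K → AbsoluteValue K ℝ
  | Sum.inl v => NumberField.HeightOneSpectrum.adicAbv K v
  | Sum.inr v => v.1

theorem av_nonarch (v : FP K) : IsNonarchimedean (av (Sum.inl v)) :=
  NumberField.HeightOneSpectrum.isNonarchimedean_adicAbv K v

theorem lsq_real {v : InfinitePlace K} (hv : v.IsReal) (x : K) :
    LSq (av (Sum.inr v)) x ↔ 0 ≤ InfinitePlace.embedding_of_isReal hv x := by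
  set φ := InfinitePlace.embedding_of_isReal hv
  have hf : ∀ z, av (Sum.inr v) z = |φ z| := fun z =>
    (InfinitePlace.norm_embedding_of_isReal hv z).symm
  constructor
  · intro h
    by_contra hx
    push Not at hx
    obtain ⟨y, hy⟩ := h (-(φ x)) (by linarith)
    rw [hf, map_sub, map_pow, abs_lt] at hy
    nlinarith [sq_nonneg (φ y)]
  · intro h ε hε
    have hc : Continuous fun q : ℝ => q ^ 2 - φ x := by fun_prop
    have ho : IsOpen {q : ℝ | |q ^ 2 - φ x| < ε} :=
      isOpen_lt (continuous_abs.comp hc) continuous_const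
    obtain ⟨q, hq⟩ := Rat.isDenseEmbedding_coe_real.dense.exists_mem_open ho
      ⟨Real.sqrt (φ x), by simp [Real.sq_sqrt h, hε]⟩
    refine ⟨(q : K), ?_⟩
    rw [hf, map_sub, map_pow, map_ratCast]
    exact hq

theorem lsq_complex {v : InfinitePlace K} (hv : ¬ v.IsReal) (x : K) :
    LSq (av (Sum.inr v)) x := by
  set φ := v.embedding
  have hf : ∀ z, av (Sum.inr v) z = ‖φ z‖ := fun z =>
    (InfinitePlace.norm_embedding_eq v z).symm
  have hd : DenseRange φ := by
    have hcl : IsClosed ((φ.fieldRange.topologicalClosure : Subfield ℂ) : Set ℂ) :=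
      Subfield.isClosed_topologicalClosure _
    rcases Complex.subfield_eq_of_closed hcl with h | h
    · exfalso
      apply hv
      rw [InfinitePlace.isReal_iff, ComplexEmbedding.isReal_iff]
      ext z
      have : φ z ∈ Complex.ofRealHom.fieldRange := by
        rw [← h]; exact Subfield.le_topologicalClosure _ ⟨z, rfl⟩
      obtain ⟨r, hr⟩ := this
      change (starRingEnd ℂ) (φ z) = φ z
      rw [← hr]; exact Complex.conj_ofReal r
    · intro z
      have : z ∈ φ.fieldRange.topologicalClosure := by rw [h]; trivial
      exact this
  intro ε hε
  have hc : Continuous fun q : ℂ => q ^ 2 - φ x := by fun_prop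
  have ho : IsOpen {q : ℂ | ‖q ^ 2 - φ x‖ < ε} := isOpen_lt (continuous_norm.comp hc) continuous_const
  obtain ⟨s, hs⟩ := IsAlgClosed.exists_pow_nat_eq (φ x) (n := 2) (by norm_num)
  obtain ⟨q, hq⟩ := hd.exists_mem_open ho ⟨s, by simp [hs, hε]⟩
  refine ⟨q, ?_⟩
  rw [hf, map_sub, map_pow]
  exact hq

theorem openSq (v : Place K) : OpenSq (av v) := by
  rcases v with v | v
  · exact ⟨av (Sum.inl v) 4, (av (Sum.inl v)).pos (by norm_num), fun x hx =>
      openSq_nonarch (av_nonarch v) (by norm_num) hx⟩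
  · refine ⟨1, one_pos, fun x hx => ?_⟩
    by_cases hv : v.IsReal
    · rw [lsq_real hv]
      have : av (Sum.inr v) (x - 1) = |InfinitePlace.embedding_of_isReal hv (x - 1)| :=
        (InfinitePlace.norm_embedding_of_isReal hv _).symm
      rw [this, map_sub, map_one, abs_lt] at hx
      linarith
    · exact lsq_complex hv x

end places
end ADQ

namespace ADQ
open NumberField IsDedekindDomain WithZero

section ord
variable {K : Type*} [Field K] [NumberField K]

noncomputable def ord (v : FP K) (x : K) : ℤ := -(v.valuation K x).log

def GE (v : FP K) (n : ℤ) (x : K) : Prop := v.valuation K x ≤ exp (-n)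

theorem val_ne_zero {v : FP K} {x : K} (hx : x ≠ 0) : v.valuation K x ≠ 0 :=
  (Valuation.ne_zero_iff _).2 hx

variable (v : FP K)

theorem val_eq {x : K} (hx : x ≠ 0) : v.valuation K x = exp (-ord v x) := by
  rw [ord, neg_neg, exp_log (val_ne_zero hx)]

theorem ord_mul {x y : K} (hx : x ≠ 0) (hy : y ≠ 0) : ord v (x * y) = ord v x + ord v y := by
  rw [ord, map_mul, log_mul (val_ne_zero hx) (val_ne_zero hy), ord, ord]; ring

@[simp] theorem ord_one : ord v (1 : K) = 0 := by simp [ord]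
@[simp] theorem ord_zero : ord v (0 : K) = 0 := by simp [ord]

theorem ord_inv (x : K) : ord v x⁻¹ = - ord v x := by
  rw [ord, map_inv₀, log_inv, ord]

theorem ord_div {x y : K} (hx : x ≠ 0) (hy : y ≠ 0) : ord v (x / y) = ord v x - ord v y := by
  rw [div_eq_mul_inv, ord_mul v hx (inv_ne_zero hy), ord_inv]; ring

@[simp] theorem ord_neg (x : K) : ord v (-x) = ord v x := by rw [ord, Valuation.map_neg, ord]

theorem ord_pow {x : K} (hx : x ≠ 0) (n : ℕ) : ord v (x ^ n) = n * ord v x := by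
  induction n with
  | zero => simp
  | succ n ih => rw [pow_succ, ord_mul v (pow_ne_zero n hx) hx, ih]; push_cast; ring

theorem ord_zpow {x : K} (hx : x ≠ 0) (n : ℤ) : ord v (x ^ n) = n * ord v x := by
  obtain ⟨m, rfl | rfl⟩ := n.eq_nat_or_neg
  · rw [zpow_natCast, ord_pow v hx]
  · rw [zpow_neg, ord_inv, zpow_natCast, ord_pow v hx]; ring

theorem ord_sq {x : K} (hx : x ≠ 0) : ord v (x ^ 2) = 2 * ord v x := by
  rw [ord_pow v hx]; norm_num

variable {v}

theorem ge_iff {x : K} (hx : x ≠ 0) {n : ℤ} : GE v n x ↔ n ≤ ord v x := by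
  rw [GE, val_eq v hx, exp_le_exp]; omega

theorem GE.zero {n : ℤ} : GE v n (0 : K) := by simp [GE]

theorem ge_iff' {x : K} {n : ℤ} : GE v n x ↔ x = 0 ∨ n ≤ ord v x := by
  by_cases hx : x = 0
  · simp [hx, GE.zero]
  · simp [hx, ge_iff]

theorem ge_ord (x : K) : GE v (ord v x) x := ge_iff'.2 (Or.inr le_rfl)

theorem GE.mono {n m : ℤ} {x : K} (h : GE v n x) (hm : m ≤ n) : GE v m x := by
  rw [ge_iff'] at *; rcases h with h | h
  · exact Or.inl h
  · exact Or.inr (hm.trans h)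

theorem GE.add {n : ℤ} {x y : K} (hx : GE v n x) (hy : GE v n y) : GE v n (x + y) :=
  (Valuation.map_add _ _ _).trans (max_le hx hy)

theorem GE.neg {n : ℤ} {x : K} (hx : GE v n x) : GE v n (-x) := by
  rw [GE, Valuation.map_neg]; exact hx

theorem GE.sub {n : ℤ} {x y : K} (hx : GE v n x) (hy : GE v n y) : GE v n (x - y) := by
  rw [sub_eq_add_neg]; exact hx.add hy.neg

theorem GE.mul {n m : ℤ} {x y : K} (hx : GE v n x) (hy : GE v m y) : GE v (n + m) (x * y) := by
  rw [GE, map_mul, neg_add, exp_add]; exact mul_le_mul' hx hy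

theorem GE.pow2 {n : ℤ} {x : K} (hx : GE v n x) : GE v (2 * n) (x ^ 2) := by
  rw [pow_two, two_mul]; exact hx.mul hx

theorem GE.one : GE v 0 (1 : K) := by simp [GE]

theorem ge_int (r : 𝓞 K) : GE v 0 (r : K) := by
  rw [GE]; simpa using v.valuation_le_one r

theorem ge_nat (n : ℕ) : GE v 0 (n : K) := by
  simpa using ge_int (v := v) (n : 𝓞 K)

theorem GE.two : GE v 0 (2 : K) := by
  have := ge_nat (v := v) 2
  simpa using this
theorem ord_two_nonneg : 0 ≤ ord v (2 : K) := (ge_iff (by norm_num)).1 GE.two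

theorem ge_int_mem {r : 𝓞 K} : GE v 1 (r : K) ↔ r ∈ v.asIdeal := by
  rw [← v.valuation_lt_one_iff_mem (K := K), GE]
  by_cases hr : (r : K) = 0
  · simp [hr]
  · rw [val_eq v hr, exp_le_exp,
      ← exp_zero, exp_lt_exp]; omega

theorem ord_add_eq {x y : K} (hx : x ≠ 0) (hy : GE v (ord v x + 1) y) :
    x + y ≠ 0 ∧ ord v (x + y) = ord v x := by
  have h1 : x + y ≠ 0 := by
    intro h
    have : x = - y := by linear_combination h
    rw [this] at hy hx
    rw [ge_iff (by simpa using hx), ord_neg] at hy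
    omega
  refine ⟨h1, le_antisymm ?_ ?_⟩
  · by_contra hlt
    push Not at hlt
    have : GE v (ord v x + 1) (x + y) := (ge_iff h1).2 (by omega)
    have := this.sub hy
    rw [add_sub_cancel_right, ge_iff hx] at this
    omega
  · rw [← ge_iff h1]
    exact (ge_ord x).add (hy.mono (by omega))

theorem ord_eq_of_sub {x y : K} (hx : x ≠ 0) (hy : GE v (ord v x + 1) (y - x)) :
    y ≠ 0 ∧ ord v y = ord v x := by
  have := ord_add_eq hx hy
  rwa [add_sub_cancel] at this

variable (v) in
theorem exists_ord (n : ℤ) : ∃ x : K, x ≠ 0 ∧ ord v x = n := by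
  obtain ⟨x, hx⟩ := v.valuation_surjective K (exp (-n))
  refine ⟨x, ?_, by rw [ord, hx, log_exp, neg_neg]⟩
  rintro rfl; rw [map_zero] at hx; exact exp_ne_zero hx.symm

noncomputable def qv (v : FP K) : ℝ := (Ideal.absNorm v.asIdeal : ℝ)

theorem one_lt_qv : 1 < qv v := by
  have := NumberField.HeightOneSpectrum.one_lt_absNorm_nnreal v
  rw [qv]; exact_mod_cast this

theorem av_eq {x : K} (hx : x ≠ 0) : av (Sum.inl v) x = qv v ^ (-ord v x) := by
  change NumberField.HeightOneSpectrum.adicAbv K v x = _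
  rw [NumberField.HeightOneSpectrum.adicAbv_def, WithZeroMulInt.toNNReal_neg_apply _ (val_ne_zero hx)]
  push_cast
  rw [qv, ord, neg_neg]
  congr 1
  have := val_ne_zero (v := v) hx
  conv_rhs => rw [← WithZero.coe_unzero this]
  rfl

theorem ge_av {x : K} {n : ℤ} : GE v n x ↔ av (Sum.inl v) x ≤ qv v ^ (-n) := by
  have h0 : 0 < qv v ^ (-n) := zpow_pos (zero_lt_one.trans one_lt_qv) _
  by_cases hx : x = 0
  · subst hx; rw [map_zero]; exact ⟨fun _ => h0.le, fun _ => GE.zero⟩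
  · rw [av_eq hx, ge_iff hx, zpow_le_zpow_iff_right₀ one_lt_qv]; omega

theorem lt_av {x y : K} (hx : x ≠ 0) (hy : y ≠ 0) :
    av (Sum.inl v) x < av (Sum.inl v) y ↔ ord v y < ord v x := by
  rw [av_eq hx, av_eq hy, zpow_lt_zpow_iff_right₀ one_lt_qv]; omega

variable (v) in
theorem av_small (n : ℤ) : ∃ ε > 0, ∀ x : K, av (Sum.inl v) x < ε → GE v n x :=
  ⟨qv v ^ (-n), zpow_pos (zero_lt_one.trans one_lt_qv) _, fun _ hx => ge_av.2 hx.le⟩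

theorem lsq_even {x : K} (hx : x ≠ 0) (h : LSq (av (Sum.inl v)) x) : Even (ord v x) := by
  obtain ⟨ε, hε, h1⟩ := av_small v (ord v x + 1)
  obtain ⟨y, hy⟩ := h ε hε
  have := ord_eq_of_sub hx (h1 _ hy)
  have hy0 : y ≠ 0 := by rintro rfl; simp at this
  rw [ord_sq v hy0] at this
  exact ⟨ord v y, by omega⟩

theorem lsq_of_ge {x : K} (h : GE v (2 * ord v (2:K) + 1) (x - 1)) : LSq (av (Sum.inl v)) x := by
  by_cases hx : x - 1 = 0
  · have : x = 1 := by linear_combination hx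
    rw [this]; exact LSq.one
  apply openSq_nonarch (av_nonarch v) (by norm_num)
  rw [lt_av hx (by norm_num)]
  rw [ge_iff hx] at h
  have : (4 : K) = 2 ^ 2 := by norm_num
  rw [this, ord_sq v (by norm_num)]; omega

/-- square criterion -/
theorem lsq_iff_exists {x : K} (hx : x ≠ 0) : LSq (av (Sum.inl v)) x ↔
    ∃ y, GE v (2 * ord v (2:K) + 1 + ord v x) (y ^ 2 - x) := by
  constructor
  · intro h
    obtain ⟨ε, hε, h1⟩ := av_small v (2 * ord v (2:K) + 1 + ord v x)
    obtain ⟨y, hy⟩ := h ε hε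
    exact ⟨y, h1 _ hy⟩
  · rintro ⟨y, hy⟩
    have h2 := ord_two_nonneg (v := v)
    have := ord_eq_of_sub hx (hy.mono (by omega))
    have hy0 : y ≠ 0 := by rintro rfl; simp at this
    have h3 : GE v (2 * ord v (2:K) + 1) (y ^ 2 / x - 1) := by
      have e : y ^ 2 / x - 1 = (y ^ 2 - x) * x⁻¹ := by field_simp
      rw [e]
      have := hy.mul (ge_ord (v := v) x⁻¹)
      rw [ord_inv] at this
      exact this.mono (by omega)
    have h4 := (LSq.sq (f := av (Sum.inl v)) y).div (lsq_of_ge h3)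
    have e : y ^ 2 / (y ^ 2 / x) = x := by field_simp
    rwa [e] at h4

theorem support_finite {x : K} (hx : x ≠ 0) : {v : FP K | ord v x ≠ 0}.Finite := by
  have h : ∀ r : 𝓞 K, r ≠ 0 → {v : FP K | ord v (r : K) ≠ 0}.Finite := by
    intro r hr
    have hr' : (r : K) ≠ 0 := by simpa using hr
    refine (Ideal.finite_factors (I := Ideal.span {r}) (by simpa using hr)).subset ?_
    intro v hv
    simp only [Set.mem_ofPred_eq] at hv ⊢
    rw [Ideal.dvd_span_singleton, ← ge_int_mem, ge_iff hr']
    have := (ge_iff hr').1 (ge_int (v := v) r)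
    omega
  obtain ⟨a, b, hb, rfl⟩ := IsFractionRing.div_surjective (A := 𝓞 K) x
  have hb0 : b ≠ 0 := nonZeroDivisors.ne_zero hb
  have ha0 : a ≠ 0 := by rintro rfl; simp at hx
  refine ((h a ha0).union (h b hb0)).subset ?_
  intro v hv
  by_contra hc
  simp only [Set.mem_union, Set.mem_ofPred_eq, not_or, not_not] at hc
  apply hv
  have h1 : (algebraMap (𝓞 K) K a) ≠ 0 := by simpa using ha0
  have h2 : (algebraMap (𝓞 K) K b) ≠ 0 := by simpa using hb0
  rw [ord_div v h1 h2, hc.1, hc.2, sub_zero]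

theorem av_nontrivial (v : Place K) : (av v).IsNontrivial := by
  rcases v with v | v
  · obtain ⟨x, hx, h⟩ := exists_ord v 1
    refine ⟨x, hx, ?_⟩
    rw [av_eq hx, h]
    have := one_lt_qv (v := v)
    exact (zpow_lt_one_of_neg₀ this (by norm_num)).ne
  · exact v.isNontrivial

theorem av_inequiv {v w : Place K} (h : v ≠ w) : ¬ (av v).IsEquiv (av w) := by
  have key : ∀ (v : FP K) (w : InfinitePlace K), ¬ (∀ x y, av (Sum.inl v) x ≤ av (Sum.inl v) y ↔
      av (Sum.inr w) x ≤ av (Sum.inr w) y) := by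
    intro v w hh
    have h1 := (hh 2 1).1 (by
      have := (ge_av (v := v)).1 GE.two
      simpa using this)
    have : av (Sum.inr w) 2 = 2 := by
      change w 2 = 2
      rw [← InfinitePlace.norm_embedding_eq, map_ofNat]; exact Complex.norm_two
    rw [this, map_one] at h1
    norm_num at h1
  rcases v with v | v <;> rcases w with w | w
  · intro hh
    apply h
    congr 1
    apply HeightOneSpectrum.eq_of_valuation_isEquiv_valuation (K := K)
    rw [Valuation.isEquiv_iff_val_le_one]
    intro x
    have := hh x 1
    rw [map_one, map_one] at this
    have h1 := ge_av (v := v) (x := x) (n := 0)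
    have h2 := ge_av (v := w) (x := x) (n := 0)
    simp only [GE, neg_zero, exp_zero, zpow_zero] at h1 h2
    rw [h1, h2]; exact this
  · exact key v w
  · intro hh
    exact key w v (fun x y => (hh x y).symm)
  · intro hh
    exact h (congrArg _ (InfinitePlace.eq_iff_isEquiv.2 hh))

/-- weak approximation -/
theorem weak_approx (F : Finset (Place K)) (t : Place K → K) (ε : Place K → ℝ)
    (hε : ∀ v, 0 < ε v) : ∃ x, ∀ v ∈ F, av v (x - t v) < ε v := by
  have := AbsoluteValue.denseRange_algebraMap_pi (F := K) (ι := F) (v := fun i => av i.1)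
    (fun i => av_nontrivial _) (fun i j hij => av_inequiv (fun h => hij (Subtype.ext h)))
  have ho : IsOpen (Set.univ.pi fun i : F => Metric.ball (WithAbs.toAbs (av i.1) (t i.1)) (ε i.1)) :=
    isOpen_set_pi Set.finite_univ fun i _ => Metric.isOpen_ball
  obtain ⟨x, hx⟩ := this.exists_mem_open ho
    ⟨fun i => WithAbs.toAbs (av i.1) (t i.1), fun i _ => Metric.mem_ball_self (hε _)⟩
  refine ⟨x, fun v hv => ?_⟩
  have := hx ⟨v, hv⟩ trivial
  rw [Metric.mem_ball, dist_eq_norm] at this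
  exact this

/-- weak approximation of classes -/
theorem weak_class (F : Finset (Place K)) (t : Place K → K) (ht : ∀ v ∈ F, t v ≠ 0) :
    ∃ x, x ≠ 0 ∧ ∀ v ∈ F, LSq (av v) (x * t v) := by
  classical
  have : ∀ v : Place K, ∃ ε > 0, v ∈ F → ∀ x, av v (x - t v) < ε → x ≠ 0 ∧ LSq (av v) (x * t v) := by
    intro v
    by_cases hv : v ∈ F
    · obtain ⟨ε, hε, h⟩ := (openSq v).near (ht v hv)
      exact ⟨ε, hε, fun _ => h⟩
    · exact ⟨1, one_pos, fun h => absurd h hv⟩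
  choose ε hε h using this
  by_cases hF : F.Nonempty
  · obtain ⟨x, hx⟩ := weak_approx F t ε hε
    obtain ⟨v, hv⟩ := hF
    exact ⟨x, (h v hv x (hx v hv)).1, fun w hw => (h w hw x (hx w hw)).2⟩
  · rw [Finset.not_nonempty_iff_eq_empty] at hF
    subst hF
    exact ⟨1, one_ne_zero, by simp⟩

end ord
end ADQ

namespace ADQ
open NumberField IsDedekindDomain WithZero

section sunits
variable {K : Type*} [Field K] [NumberField K]

/-- S-units -/
def SU (S : Finset (FP K)) : Subgroup Kˣ where
  carrier := {x | ∀ v ∉ S, ord v (x : K) = 0}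
  one_mem' := by intro v _; simp
  mul_mem' := by
    intro a b ha hb v hv
    rw [Units.val_mul, ord_mul v a.ne_zero b.ne_zero, ha v hv, hb v hv, add_zero]
  inv_mem' := by
    intro a ha v hv
    rw [Units.val_inv_eq_inv_val, ord_inv, ha v hv, neg_zero]

theorem mem_SU {S : Finset (FP K)} {x : Kˣ} : x ∈ SU S ↔ ∀ v ∉ S, ord v (x : K) = 0 := Iff.rfl

theorem SU_mono {S S' : Finset (FP K)} (h : S ⊆ S') : SU S ≤ SU S' :=
  fun _ hx v hv => hx v (fun hv' => hv (h hv'))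

theorem card_two_torsion {F : Type*} [Field F] (h2 : (2 : F) ≠ 0) (U : Subgroup Fˣ) (hU : (-1 : Fˣ) ∈ U) :
    Nat.card (powMonoidHom 2 : U →* U).ker = 2 := by
  have hne : (1 : Fˣ) ≠ -1 := by
    intro h
    have := congrArg Units.val h
    simp only [Units.val_one, Units.val_neg] at this
    apply h2; linear_combination this
  rw [Nat.card_eq_two_iff]
  refine ⟨1, ⟨⟨-1, hU⟩, ?_⟩, ?_, ?_⟩
  · rw [MonoidHom.mem_ker]; apply Subtype.ext; simp
  · intro h
    exact hne (congrArg Subtype.val (congrArg Subtype.val h))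
  · ext ⟨⟨x, hx⟩, hx2⟩
    simp only [Set.mem_insert_iff, Set.mem_singleton_iff, Set.mem_univ, iff_true]
    rw [MonoidHom.mem_ker] at hx2
    have h1 : x ^ 2 = 1 := congrArg Subtype.val hx2
    have h3 : (x : F) ^ 2 = 1 := by rw [← Units.val_pow_eq_pow_val, h1]; rfl
    rcases (sq_eq_one_iff.1 h3) with h | h
    · left; apply Subtype.ext; apply Subtype.ext; exact Units.ext h
    · right; apply Subtype.ext; apply Subtype.ext; exact Units.ext h

theorem exists_supp (v : FP K) : ∃ x : K, x ≠ 0 ∧ ord v x ≠ 0 ∧ ∀ w, w ≠ v → ord w x = 0 := by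
  classical
  have hv0 : v.asIdeal ∈ nonZeroDivisors (Ideal (𝓞 K)) := mem_nonZeroDivisors_of_ne_zero v.ne_bot
  have h1 : (ClassGroup.mk0 ⟨v.asIdeal, hv0⟩) ^ (Fintype.card (ClassGroup (𝓞 K))) = 1 := pow_card_eq_one
  set h := Fintype.card (ClassGroup (𝓞 K)) with hh
  have hpos : 0 < h := Fintype.card_pos
  rw [← map_pow, ClassGroup.mk0_eq_one_iff] at h1
  obtain ⟨r, hr⟩ := h1.principal
  have hr' : v.asIdeal ^ h = Ideal.span {r} := by simpa using hr
  have hr0 : r ≠ 0 := by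
    rintro rfl
    rw [Ideal.span_singleton_zero] at hr'
    exact v.ne_bot (pow_eq_zero_iff hpos.ne' |>.1 hr')
  have hrK : (r : K) ≠ 0 := by simpa using hr0
  refine ⟨r, hrK, ?_, ?_⟩
  · have : r ∈ v.asIdeal := by
      have : r ∈ v.asIdeal ^ h := by rw [hr']; exact Ideal.mem_span_singleton_self r
      exact Ideal.pow_le_self hpos.ne' this
    have := (ge_iff hrK).1 (ge_int_mem.2 this)
    omega
  · intro w hw
    by_contra hne
    have h0 := (ge_iff hrK).1 (ge_int (v := w) r)
    have : r ∈ w.asIdeal := ge_int_mem.1 ((ge_iff hrK).2 (by omega))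
    have h3 : v.asIdeal ^ h ≤ w.asIdeal := by
      rw [hr', Ideal.span_singleton_le_iff_mem]; exact this
    have h4 := w.isPrime.le_of_pow_le h3
    exact hw (HeightOneSpectrum.ext (v.isMaximal.eq_of_le w.isPrime.ne_top h4).symm)

/-- principal outside S -/
def PS (S : Finset (FP K)) : Prop :=
  ∀ v ∉ S, ∃ x : K, x ≠ 0 ∧ ord v x = 1 ∧ ∀ w ∉ S, w ≠ v → ord w x = 0

theorem PS.mono {S S' : Finset (FP K)} (h : PS S) (hS : S ⊆ S') : PS S' := by
  intro v hv
  obtain ⟨x, h0, h1, h2⟩ := h v (fun hv' => hv (hS hv'))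
  exact ⟨x, h0, h1, fun w hw => h2 w (fun hw' => hw (hS hw'))⟩

theorem aux_PS (v : FP K) (I : Ideal (𝓞 K)) (hI : I ≠ ⊥) (hvc : ¬ v.asIdeal ∣ I) (r : 𝓞 K)
    (hr' : v.asIdeal * I = Ideal.span {r}) : ∃ x : K, x ≠ 0 ∧ ord v x = 1 ∧
      ∀ w : FP K, ¬ w.asIdeal ∣ I → w ≠ v → ord w x = 0 := by
  have hr0 : r ≠ 0 := by
    rintro rfl
    rw [Ideal.span_singleton_zero] at hr'
    rcases mul_eq_zero.1 hr' with h | h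
    · exact v.ne_bot h
    · exact hI h
  have hrK : (r : K) ≠ 0 := by simpa using hr0
  refine ⟨r, hrK, ?_, ?_⟩
  · have h51 : r ∈ v.asIdeal * I := by rw [hr']; exact Ideal.mem_span_singleton_self r
    have h52 : r ∈ v.asIdeal := (Ideal.mul_le_left (I := v.asIdeal) (J := I)) h51
    have h53 : GE v 1 (r : K) := ge_int_mem.2 h52
    have h5 := (ge_iff hrK).1 h53
    by_contra hne
    have h6 : GE v 2 (r : K) := (ge_iff hrK).2 (by omega)
    have h7 : r ∈ v.asIdeal ^ 2 := by
      rw [← v.intValuation_le_pow_iff_mem, ← v.valuation_of_algebraMap (K := K)]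
      exact h6
    have h8 : v.asIdeal * v.asIdeal ∣ v.asIdeal * I := by
      rw [← pow_two, hr', Ideal.dvd_span_singleton]; exact h7
    exact hvc ((mul_dvd_mul_iff_left v.ne_bot).1 h8)
  · intro w hwS hw
    by_contra hne
    have h0 := (ge_iff hrK).1 (ge_int (v := w) r)
    have h2 : r ∈ w.asIdeal := ge_int_mem.1 ((ge_iff hrK).2 (by omega))
    have h3 : w.asIdeal ∣ v.asIdeal * I := by
      rw [hr', Ideal.dvd_span_singleton]; exact h2
    rcases (w.prime.dvd_mul).1 h3 with h | h
    · exact hw (HeightOneSpectrum.ext (v.isMaximal.eq_of_le w.isPrime.ne_top (Ideal.dvd_iff_le.1 h)).symm)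
    · exact hwS h

theorem exists_PS (S0 : Finset (FP K)) : ∃ S, S0 ⊆ S ∧ PS S := by
  classical
  have hs := ClassGroup.mk0_surjective (R := 𝓞 K)
  choose J hJ using hs
  have hfin : ∀ c, {v : FP K | v.asIdeal ∣ (J c : Ideal (𝓞 K))}.Finite := fun c =>
    Ideal.finite_factors (nonZeroDivisors.ne_zero (J c).2)
  refine ⟨S0 ∪ Finset.univ.biUnion fun c => (hfin c).toFinset, Finset.subset_union_left, ?_⟩
  intro v hv
  simp only [Finset.mem_union, Finset.mem_biUnion, Finset.mem_univ, true_and, Set.Finite.mem_toFinset,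
    Set.mem_ofPred_eq, not_or, not_exists] at hv
  obtain ⟨-, hv⟩ := hv
  have hv0 : v.asIdeal ∈ nonZeroDivisors (Ideal (𝓞 K)) := mem_nonZeroDivisors_of_ne_zero v.ne_bot
  obtain ⟨c, hc⟩ : ∃ c, c = (ClassGroup.mk0 ⟨v.asIdeal, hv0⟩)⁻¹ := ⟨_, rfl⟩
  have h1 : ClassGroup.mk0 (⟨v.asIdeal, hv0⟩ * J c) = 1 := by
    rw [map_mul, hJ, hc, mul_inv_cancel]
  rw [ClassGroup.mk0_eq_one_iff] at h1
  obtain ⟨r, hr⟩ := h1.principal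
  have hr' : v.asIdeal * (J c).1 = Ideal.span {r} := hr
  have hJ0 : (J c).1 ≠ 0 := nonZeroDivisors.ne_zero (J c).2
  have hvc : ¬ v.asIdeal ∣ (J c).1 := hv c
  obtain ⟨x, hx0, hx1, hx⟩ := aux_PS v _ hJ0 hvc r hr'
  refine ⟨x, hx0, hx1, fun w hwS hw => hx w (fun hd => hwS ?_) hw⟩
  simp only [Finset.mem_union, Finset.mem_biUnion, Finset.mem_univ, true_and, Set.Finite.mem_toFinset,
      Set.mem_ofPred_eq]
  exact Or.inr ⟨c, hd⟩

theorem PS.exists_ord {S : Finset (FP K)} (h : PS S) (n : FP K → ℤ)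
    (hn : {v | v ∉ S ∧ n v ≠ 0}.Finite) : ∃ c : K, c ≠ 0 ∧ ∀ v ∉ S, ord v c = n v := by
  classical
  have key : ∀ F : Finset (FP K), (∀ v ∈ F, v ∉ S) →
      ∃ c : K, c ≠ 0 ∧ ∀ v ∉ S, ord v c = if v ∈ F then n v else 0 := by
    intro F
    induction F using Finset.induction_on with
    | empty => intro _; exact ⟨1, one_ne_zero, by simp⟩
    | insert a F ha ih =>
      intro hF
      obtain ⟨c, hc0, hc⟩ := ih (fun v hv => hF v (Finset.mem_insert_of_mem hv))
      obtain ⟨x, hx0, hx1, hx⟩ := h a (hF a (Finset.mem_insert_self _ _))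
      refine ⟨c * x ^ n a, mul_ne_zero hc0 (zpow_ne_zero _ hx0), fun v hv => ?_⟩
      rw [ord_mul v hc0 (zpow_ne_zero _ hx0), ord_zpow v hx0, hc v hv]
      by_cases hva : v = a
      · subst hva; simp [ha, hx1]
      · rw [hx v hv hva]; simp [hva]
  obtain ⟨c, hc0, hc⟩ := key hn.toFinset (by
    intro v hv; rw [Set.Finite.mem_toFinset] at hv; exact hv.1)
  refine ⟨c, hc0, fun v hv => ?_⟩
  rw [hc v hv]
  by_cases h0 : n v = 0
  · simp [h0]
  · rw [if_pos]; rw [Set.Finite.mem_toFinset]; exact ⟨hv, h0⟩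

end sunits
end ADQ

namespace ADQ
open NumberField IsDedekindDomain WithZero

section rank
variable {K : Type*} [Field K] [NumberField K]

theorem neg_one_mem_SU (S : Finset (FP K)) : (-1 : Kˣ) ∈ SU S := by
  intro v _; simp

noncomputable def ordMap (S : Finset (FP K)) : Additive (SU S) →ₗ[ℤ] (S → ℤ) :=
  AddMonoidHom.toIntLinearMap
    { toFun := fun x v => ord v.1 ((Additive.toMul x).1 : K)
      map_zero' := by ext v; exact ord_one _
      map_add' := by
        intro x y; ext v
        exact ord_mul _ (Units.ne_zero _) (Units.ne_zero _) }

theorem ordMap_apply (S : Finset (FP K)) (x : Additive (SU S)) (v : S) :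
    ordMap S x v = ord v.1 ((Additive.toMul x).1 : K) := rfl

noncomputable def unitMap (S : Finset (FP K)) : Additive (𝓞 K)ˣ →ₗ[ℤ] Additive (SU S) :=
  AddMonoidHom.toIntLinearMap (MonoidHom.toAdditive
    ((Units.map (algebraMap (𝓞 K) K).toMonoidHom).codRestrict (SU S) (by
      intro u v _
      have h1 := (ge_iff (v := v) (x := ((u : 𝓞 K) : K)) (by simp)).1 (ge_int _)
      have h2 := (ge_iff (v := v) (x := (((u⁻¹ : (𝓞 K)ˣ) : 𝓞 K) : K)) (by simp)).1 (ge_int _)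
      have h3 : (((u⁻¹ : (𝓞 K)ˣ) : 𝓞 K) : K) = (((u : 𝓞 K) : K))⁻¹ := by
        apply eq_inv_of_mul_eq_one_left
        have := congrArg (fun z : 𝓞 K => (z : K)) (u.inv_mul)
        simpa using this
      rw [h3, ord_inv] at h2
      change ord v ((u : 𝓞 K) : K) = 0
      omega)))

theorem unitMap_apply (S : Finset (FP K)) (u : (𝓞 K)ˣ) :
    ((Additive.toMul (unitMap S (Additive.ofMul u))).1 : K) = ((u : 𝓞 K) : K) := rfl

theorem unitMap_inj (S : Finset (FP K)) : Function.Injective (unitMap S) := by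
  intro a b h
  have h1 : ((((Additive.toMul a : (𝓞 K)ˣ)) : 𝓞 K) : K) = (((Additive.toMul b : (𝓞 K)ˣ) : 𝓞 K) : K) :=
    congrArg (fun z : Additive (SU S) => ((Additive.toMul z).1 : K)) h
  have h2 : ((Additive.toMul a : (𝓞 K)ˣ) : 𝓞 K) = ((Additive.toMul b : (𝓞 K)ˣ) : 𝓞 K) :=
    RingOfIntegers.coe_injective h1
  exact Additive.toMul.injective (Units.ext h2)

theorem exists_int {x : K} (h : ∀ v : FP K, GE v 0 x) : ∃ r : 𝓞 K, (r : K) = x := by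
  have := HeightOneSpectrum.mem_integers_of_valuation_le_one K (R := 𝓞 K) x (by
    intro v; have := h v; simpa [GE] using this)
  exact this

theorem ker_ordMap (S : Finset (FP K)) : LinearMap.ker (ordMap S) = LinearMap.range (unitMap S) := by
  ext x
  constructor
  · intro hx
    set y : Kˣ := (Additive.toMul x).1 with hy
    have h0 : ∀ v : FP K, ord v (y : K) = 0 := by
      intro v
      by_cases hv : v ∈ S
      · have := congrFun (LinearMap.mem_ker.1 hx) ⟨v, hv⟩
        exact this
      · exact (Additive.toMul x).2 v hv
    obtain ⟨r, hr⟩ := exists_int (x := (y : K)) (fun v => (ge_iff y.ne_zero).2 (h0 v).ge)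
    obtain ⟨s, hs⟩ := exists_int (x := (y : K)⁻¹) (fun v => (ge_iff (inv_ne_zero y.ne_zero)).2
      (by rw [ord_inv, h0 v]; simp))
    have h1 : r * s = 1 := by
      apply RingOfIntegers.coe_injective
      rw [map_mul, map_one]
      change (r : K) * (s : K) = 1
      rw [hr, hs, mul_inv_cancel₀ y.ne_zero]
    refine ⟨Additive.ofMul ⟨r, s, h1, by rw [mul_comm]; exact h1⟩, ?_⟩
    apply Additive.toMul.injective
    apply Subtype.ext
    apply Units.ext
    rw [unitMap_apply]
    exact hr
  · rintro ⟨u, rfl⟩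
    rw [LinearMap.mem_ker]
    ext v
    rw [ordMap_apply]
    have := (Additive.toMul (unitMap ∅ u)).2 v.1 (by simp)
    exact this

theorem finite_SU (S : Finset (FP K)) : Module.Finite ℤ (Additive (SU S)) := by
  have h1 : Module.Finite ℤ (LinearMap.ker (ordMap S)) := by
    rw [ker_ordMap]; infer_instance
  have h2 : Module.Finite ℤ (Additive (SU S) ⧸ LinearMap.ker (ordMap S)) :=
    Module.Finite.equiv (ordMap S).quotKerEquivRange.symm
  exact Module.Finite.of_submodule_quotient (LinearMap.ker (ordMap S))

theorem finrank_SU (S : Finset (FP K)) :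
    Module.finrank ℤ (Additive (SU S)) = Units.rank K + S.card := by
  classical
  have := finite_SU S
  have h0 := Submodule.finrank_quotient_add_finrank (LinearMap.ker (ordMap S))
  rw [(ordMap S).quotKerEquivRange.finrank_eq, ker_ordMap, LinearMap.finrank_range_of_inj (unitMap_inj S), Units.finrank_eq] at h0
  rw [← h0, add_comm]
  congr 1
  have h1 := Submodule.finrank_quotient_add_finrank (LinearMap.range (ordMap S))
  have h2 : Module.finrank ℤ ((S → ℤ) ⧸ LinearMap.range (ordMap S)) = 0 := by
    rw [Module.finrank_eq_zero_iff]
    intro x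
    obtain ⟨x, rfl⟩ := Submodule.mkQ_surjective _ x
    choose e he0 he1 he2 using fun v : S => exists_supp v.1
    refine ⟨∏ v : S, ord v.1 (e v), Finset.prod_ne_zero_iff.2 fun v _ => he1 v, ?_⟩
    rw [← map_smul, Submodule.mkQ_apply, Submodule.Quotient.mk_eq_zero]
    set P := ∏ v : S, ord v.1 (e v)
    have hx : P • x = ∑ v : S, (P * x v) • Pi.single (M := fun _ => ℤ) v 1 := by
      ext w
      simp [Finset.sum_apply, Pi.single_apply]
    rw [hx]
    refine Submodule.sum_mem _ fun v _ => ?_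
    have hdiv : ord v.1 (e v) ∣ P := Finset.dvd_prod_of_mem _ (Finset.mem_univ v)
    obtain ⟨k, hk⟩ := hdiv
    have : (P * x v) • Pi.single (M := fun _ => ℤ) v 1
        = (k * x v) • (ord v.1 (e v) • Pi.single (M := fun _ => ℤ) v 1) := by
      rw [smul_smul, hk]; congr 1; ring
    rw [this]
    apply Submodule.smul_mem
    refine ⟨Additive.ofMul ⟨Units.mk0 (e v) (he0 v), ?_⟩, ?_⟩
    · intro w hw
      exact he2 v w (by rintro rfl; exact hw v.2)
    · ext w
      rw [ordMap_apply]
      change ord w.1 (e v) = _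
      by_cases hwv : w = v
      · subst hwv; simp
      · rw [he2 v w.1 (fun h => hwv (Subtype.ext h))]
        simp [Pi.single_apply, hwv]
  rw [h2, zero_add] at h1
  rw [h1]; simp

theorem fg_SU (S : Finset (FP K)) : Group.FG (SU S) := by
  have := finite_SU S
  have h2 := Module.Finite.iff_addGroup_fg.1 this
  rw [Group.fg_iff_monoid_fg, Monoid.fg_iff_add_fg, ← AddGroup.fg_iff_addMonoid_fg]
  exact h2

theorem index_SU (S : Finset (FP K)) :
    (sqr (SU S)).index = 2 ^ (S.card + Fintype.card (InfinitePlace K)) := by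
  have := fg_SU S
  rw [index_sq_fg, finrank_SU, card_two_torsion (by norm_num) _ (neg_one_mem_SU S), ← pow_succ]
  congr 1
  have h : 0 < Fintype.card (InfinitePlace K) := Fintype.card_pos
  rw [Units.rank]; omega

end rank
end ADQ

namespace ADQ
open NumberField IsDedekindDomain WithZero

section sym
variable {K : Type*} [Field K] [NumberField K] (v : Place K)

/-- local square -/
abbrev Sq (x : K) : Prop := LSq (av v) x

/-- `b` is a local norm from `K_v(√a)` -/
def Nm (a b : K) : Prop := ∃ x y : K, x ^ 2 - a * y ^ 2 ≠ 0 ∧ Sq v (b * (x ^ 2 - a * y ^ 2))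

variable {v} {a b c : K}

theorem sq_congr (hb : b ≠ 0) (h : Sq v (b * c)) (hS : Sq v b) : Sq v c :=
  LSq.of_mul_left hb hS h

theorem sq_mul3 (hb : b ≠ 0) (h1 : Sq v (a * b)) (h2 : Sq v (b * c)) : Sq v (a * c) := by
  have := h1.mul h2
  rw [show a * b * (b * c) = a * c * b ^ 2 by ring] at this
  exact (LSq.mul_sq_iff hb).1 this

theorem nm_of_sq (h : Sq v b) : Nm v a b := ⟨1, 0, by simp, by simpa using h⟩

theorem nm_one : Nm v a 1 := nm_of_sq LSq.one

theorem nm_mul (h : Nm v a b) (h' : Nm v a c) : Nm v a (b * c) := by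
  obtain ⟨x, y, h0, h1⟩ := h
  obtain ⟨x', y', h0', h1'⟩ := h'
  refine ⟨x * x' + a * y * y', x * y' + x' * y, ?_, ?_⟩
  · rw [show (x * x' + a * y * y') ^ 2 - a * (x * y' + x' * y) ^ 2 =
      (x ^ 2 - a * y ^ 2) * (x' ^ 2 - a * y' ^ 2) by ring]
    exact mul_ne_zero h0 h0'
  · rw [show b * c * ((x * x' + a * y * y') ^ 2 - a * (x * y' + x' * y) ^ 2) =
      (b * (x ^ 2 - a * y ^ 2)) * (c * (x' ^ 2 - a * y' ^ 2)) by ring]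
    exact h1.mul h1'

theorem nm_congr_right (hc : c ≠ 0) (h : Sq v (b * c)) (hn : Nm v a c) : Nm v a b := by
  obtain ⟨x, y, h0, h1⟩ := hn
  exact ⟨x, y, h0, sq_mul3 hc h h1⟩

theorem nm_of_mul (hb : b ≠ 0) (h : Nm v a b) (h' : Nm v a (b * c)) : Nm v a c := by
  by_cases hc : c = 0
  · subst hc; exact nm_of_sq LSq.zero
  refine nm_congr_right (mul_ne_zero hb (mul_ne_zero hb hc)) ?_ (nm_mul h h')
  rw [show c * (b * (b * c)) = (b * c) ^ 2 by ring]; exact LSq.sq _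

theorem nm_mul_iff (hb : b ≠ 0) (h : Nm v a b) : Nm v a (b * c) ↔ Nm v a c :=
  ⟨nm_of_mul hb h, nm_mul h⟩

theorem nm_inv (h : Nm v a b) : Nm v a b⁻¹ := by
  by_cases hb : b = 0
  · subst hb; simpa using h
  refine nm_congr_right hb ?_ h
  rw [inv_mul_cancel₀ hb]; exact LSq.one

/-- version with local squares -/
theorem nm_of_ef (hb : b ≠ 0) {e f : K} (he : Sq v e) (hf : Sq v f) (h : b = e - a * f) :
    Nm v a b := by
  have := (openSq v).approx (ι := Fin 2) ![1, -a] ![e, f]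
    (by intro i; fin_cases i <;> assumption) (by simp; rw [← sub_eq_add_neg, ← h]; exact hb)
  obtain ⟨x, h0, h1⟩ := this
  simp only [Fin.sum_univ_two, Matrix.cons_val_zero, Matrix.cons_val_one] at h0 h1
  refine ⟨x 0, x 1, ?_, ?_⟩
  · convert h0 using 1; ring
  · convert h1 using 1; rw [h]; ring

theorem nm_to_ef (h : Nm v a b) : ∃ e f, Sq v e ∧ Sq v f ∧ b = e - a * f := by
  obtain ⟨x, y, h0, h1⟩ := h
  refine ⟨b * (x ^ 2 - a * y ^ 2) * (x / (x ^ 2 - a * y ^ 2)) ^ 2,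
    b * (x ^ 2 - a * y ^ 2) * (y / (x ^ 2 - a * y ^ 2)) ^ 2, h1.mul (LSq.sq _), h1.mul (LSq.sq _), ?_⟩
  field_simp

theorem nm_iff (hb : b ≠ 0) : Nm v a b ↔ ∃ e f, Sq v e ∧ Sq v f ∧ b = e - a * f :=
  ⟨nm_to_ef, fun ⟨_, _, he, hf, h⟩ => nm_of_ef hb he hf h⟩

theorem nm_of_sq_left (ha : a ≠ 0) (h : Sq v a) : Nm v a b := by
  by_cases hb : b = 0
  · subst hb; exact nm_of_sq LSq.zero
  refine nm_of_ef hb (e := ((b + 1) / 2) ^ 2) (f := a * ((b - 1) / (2 * a)) ^ 2) (LSq.sq _)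
    (h.mul (LSq.sq _)) ?_
  field_simp; ring

theorem nm_symm (ha : a ≠ 0) (hb : b ≠ 0) (h : Nm v a b) : Nm v b a := by
  obtain ⟨e, f, he, hf, h1⟩ := nm_to_ef h
  by_cases hf0 : f = 0
  · subst hf0
    apply nm_of_sq_left hb
    rw [h1]; simpa using he
  · refine nm_of_ef ha (e := e / f) (f := 1 / f) (he.div hf) (LSq.one.div hf) ?_
    field_simp
    rw [h1]; ring

theorem nm_comm (ha : a ≠ 0) (hb : b ≠ 0) : Nm v a b ↔ Nm v b a :=
  ⟨nm_symm ha hb, nm_symm hb ha⟩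

theorem nm_neg_self (ha : a ≠ 0) : Nm v a (-a) :=
  ⟨0, 1, by simpa using ha, by
    rw [show -a * (0 ^ 2 - a * 1 ^ 2) = a ^ 2 by ring]; exact LSq.sq _⟩

theorem nm_one_sub : Nm v a (1 - a) := by
  by_cases h : 1 - a = 0
  · rw [h]; exact nm_of_sq LSq.zero
  exact ⟨1, 1, by simpa using h, by
    rw [show (1 - a) * (1 ^ 2 - a * 1 ^ 2) = (1 - a) ^ 2 by ring]; exact LSq.sq _⟩

theorem nm_norm {x y : K} : Nm v a (x ^ 2 - a * y ^ 2) := by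
  by_cases h : x ^ 2 - a * y ^ 2 = 0
  · rw [h]; exact nm_of_sq LSq.zero
  · exact ⟨x, y, h, by rw [← pow_two]; exact LSq.sq _⟩

theorem nm_congr_left (ha : a ≠ 0) (hb : b ≠ 0) (hc : c ≠ 0) (h : Sq v (a * b)) (hn : Nm v b c) :
    Nm v a c :=
  nm_symm hc ha (nm_congr_right hb h (nm_symm hb hc hn))

theorem nm_mul_left (ha : a ≠ 0) (hb : b ≠ 0) (hc : c ≠ 0) (h : Nm v a c) (h' : Nm v b c) :
    Nm v (a * b) c :=
  nm_symm hc (mul_ne_zero ha hb) (nm_mul (nm_symm ha hc h) (nm_symm hb hc h'))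

theorem nm_of_mul_left (ha : a ≠ 0) (hb : b ≠ 0) (hc : c ≠ 0) (h : Nm v a c) (h' : Nm v (a * b) c) :
    Nm v b c :=
  nm_symm hc hb (nm_of_mul ha (nm_symm ha hc h) (nm_symm (mul_ne_zero ha hb) hc h'))

/-- subgroup of local squares -/
def sqS (v : Place K) : Subgroup Kˣ where
  carrier := {x | Sq v (x : K)}
  one_mem' := by change Sq v ((1 : Kˣ) : K); simpa using LSq.one
  mul_mem' := by
    intro x y hx hy
    change Sq v ((x * y : Kˣ) : K)
    rw [Units.val_mul]; exact LSq.mul hx hy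
  inv_mem' := by
    intro x hx
    change Sq v ((x⁻¹ : Kˣ) : K)
    rw [Units.val_inv_eq_inv_val]; exact LSq.inv hx

def nmS (v : Place K) (a : K) : Subgroup Kˣ where
  carrier := {x | Nm v a (x : K)}
  one_mem' := by change Nm v a ((1 : Kˣ) : K); simpa using nm_one
  mul_mem' := by
    intro x y hx hy
    change Nm v a ((x * y : Kˣ) : K)
    rw [Units.val_mul]; exact nm_mul hx hy
  inv_mem' := by
    intro x hx
    change Nm v a ((x⁻¹ : Kˣ) : K)
    rw [Units.val_inv_eq_inv_val]; exact nm_inv hx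

theorem mem_sqS {x : Kˣ} : x ∈ sqS v ↔ Sq v (x : K) := Iff.rfl
theorem mem_nmS {x : Kˣ} : x ∈ nmS v a ↔ Nm v a (x : K) := Iff.rfl

theorem sqS_le_nmS : sqS v ≤ nmS v a := fun _ hx => nm_of_sq hx

end sym
end ADQ

namespace ADQ
open NumberField IsDedekindDomain WithZero

section count
variable {K : Type*} [Field K] [NumberField K] {v : FP K}

theorem ge_int_pow {r : 𝓞 K} {n : ℕ} : GE v n (r : K) ↔ r ∈ v.asIdeal ^ n := by
  rw [← v.intValuation_le_pow_iff_mem, GE]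
  have := v.valuation_of_algebraMap (K := K) r
  rw [← this]

theorem mk_eq_iff {r s : 𝓞 K} {n : ℕ} : Ideal.Quotient.mk (v.asIdeal ^ n) r =
    Ideal.Quotient.mk (v.asIdeal ^ n) s ↔ GE v n ((r : K) - s) := by
  rw [Ideal.Quotient.eq, ← ge_int_pow]
  exact Iff.of_eq (by congr 1)

theorem exists_int_near {x : K} (hx : GE v 0 x) (n : ℤ) : ∃ r : 𝓞 K, GE v n ((r : K) - x) := by
  obtain ⟨r, hr⟩ := v.exists_valuation_sub_lt_of_integer (K := K) (x := x) (by simpa [GE] using hx)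
    (Units.mk0 (exp (-n)) exp_ne_zero)
  exact ⟨r, hr.le⟩

theorem exists_unit_lift {u : K} (h0 : u ≠ 0) (hu : ord v u = 0) (n : ℕ) :
    ∃ (r : 𝓞 K) (q : (𝓞 K ⧸ v.asIdeal ^ n)ˣ), GE v n ((r : K) - u) ∧
      Ideal.Quotient.mk (v.asIdeal ^ n) r = q := by
  obtain ⟨r, hr⟩ := exists_int_near ((ge_iff h0).2 hu.ge) n
  obtain ⟨s, hs⟩ := exists_int_near ((ge_iff (v := v) (inv_ne_zero h0)).2 (by rw [ord_inv, hu]; simp)) n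
  have h1 : Ideal.Quotient.mk (v.asIdeal ^ n) r * Ideal.Quotient.mk (v.asIdeal ^ n) s = 1 := by
    rw [← map_mul, ← map_one (Ideal.Quotient.mk (v.asIdeal ^ n)), mk_eq_iff]
    have e : (((r * s : 𝓞 K) : K) - ((1 : 𝓞 K) : K)) = (r : K) * ((s : K) - u⁻¹) + ((r : K) - u) * u⁻¹ := by
      have : ((r * s : 𝓞 K) : K) = (r : K) * s := by simp
      rw [this]
      have : ((1 : 𝓞 K) : K) = 1 := by simp
      rw [this]
      field_simp; ring
    rw [e]
    refine GE.add ?_ ?_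
    · have := (ge_int (v := v) r).mul hs
      simpa using this
    · have := hr.mul (ge_ord (v := v) u⁻¹)
      rw [ord_inv, hu] at this; simpa using this
  exact ⟨r, ⟨_, _, h1, by rw [mul_comm]; exact h1⟩, hr, rfl⟩

/-- exponent of 2 -/
noncomputable def e2 (v : FP K) : ℕ := (ord v (2 : K)).toNat

theorem e2_eq : (e2 v : ℤ) = ord v (2 : K) := Int.toNat_of_nonneg ord_two_nonneg

theorem card_quot_pow (n : ℕ) : Nat.card (𝓞 K ⧸ v.asIdeal ^ n) = (Ideal.absNorm v.asIdeal) ^ n := by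
  rw [← map_pow, Ideal.absNorm_apply, Submodule.cardQuot_apply]

theorem finite_quot_pow (n : ℕ) : Finite (𝓞 K ⧸ v.asIdeal ^ n) := by
  apply Nat.finite_of_card_ne_zero
  rw [card_quot_pow]
  have := NumberField.HeightOneSpectrum.one_lt_absNorm v
  positivity

theorem sq_one_near {r : K} (hr : GE v (2 * ord v (2:K) + 1) (r ^ 2 - 1)) :
    GE v (ord v (2:K) + 1) (r - 1) ∨ GE v (ord v (2:K) + 1) (r + 1) := by
  set e := ord v (2 : K)
  by_cases h1 : r - 1 = 0
  · left; rw [h1]; exact GE.zero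
  by_cases h2 : r + 1 = 0
  · right; rw [h2]; exact GE.zero
  have h3 : 2 * e + 1 ≤ ord v (r - 1) + ord v (r + 1) := by
    rw [← ord_mul v h1 h2, ← ge_iff (mul_ne_zero h1 h2)]
    convert hr using 1; ring
  by_cases h4 : e + 1 ≤ ord v (r - 1)
  · left; exact (ge_iff h1).2 h4
  · right; exact (ge_iff h2).2 (by omega)

theorem card_two_tors_quot :
    Nat.card (powMonoidHom 2 : (𝓞 K ⧸ v.asIdeal ^ (2 * e2 v + 1))ˣ →* _).ker
      ≤ 2 * (Ideal.absNorm v.asIdeal) ^ (e2 v) := by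
  classical
  set e := e2 v with he
  obtain ⟨p, hp0, hp⟩ := exists_ord v (e + 1 : ℤ)
  obtain ⟨p', hp'⟩ := exists_int_near ((ge_iff (v := v) hp0).2 (show (0:ℤ) ≤ _ by rw [hp]; omega)) (e + 2 : ℤ)
  have h1 := ord_eq_of_sub hp0 (hp'.mono (by rw [hp]; omega))
  have f1 := finite_quot_pow (v := v) e
  have f2 := finite_quot_pow (v := v) (2 * e + 1)
  let f : Bool × (𝓞 K ⧸ v.asIdeal ^ e) → 𝓞 K ⧸ v.asIdeal ^ (2 * e + 1) := fun z =>
    Ideal.Quotient.mk _ ((if z.1 then 1 else -1) + p' * (Ideal.Quotient.mk_surjective z.2).choose)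
  have key : ∀ x : (powMonoidHom 2 : (𝓞 K ⧸ v.asIdeal ^ (2 * e + 1))ˣ →* _).ker,
      ∃ z, f z = ((x : (𝓞 K ⧸ v.asIdeal ^ (2 * e + 1))ˣ) : 𝓞 K ⧸ v.asIdeal ^ (2 * e + 1)) := by
    rintro ⟨x, hx⟩
    obtain ⟨r, hr⟩ := Ideal.Quotient.mk_surjective (x : 𝓞 K ⧸ v.asIdeal ^ (2 * e + 1))
    have h2 : Ideal.Quotient.mk (v.asIdeal ^ (2 * e + 1)) (r ^ 2) = Ideal.Quotient.mk _ 1 := by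
      rw [map_pow, hr, map_one]
      have : x ^ 2 = 1 := hx
      rw [← Units.val_pow_eq_pow_val, this, Units.val_one]
    rw [mk_eq_iff] at h2
    have h3 : GE v (2 * ord v (2:K) + 1) ((r : K) ^ 2 - 1) := by
      rw [← e2_eq]
      have e1 : ((r ^ 2 : 𝓞 K) : K) - ((1 : 𝓞 K) : K) = (r : K) ^ 2 - 1 := by simp
      rw [e1] at h2; exact_mod_cast h2
    have main : ∀ (t : 𝓞 K), GE v (e + 1) ((r : K) - t) → ∃ c : 𝓞 K ⧸ v.asIdeal ^ e,
        Ideal.Quotient.mk (v.asIdeal ^ (2 * e + 1)) (t + p' * (Ideal.Quotient.mk_surjective c).choose) = x := by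
      intro t ht
      have h5 : GE v 0 (((r : K) - t) / (p' : K)) := by
        have := ht.mul (ge_ord (v := v) ((p' : K)⁻¹))
        rw [ord_inv, h1.2, hp] at this
        simpa [div_eq_mul_inv] using this
      obtain ⟨c, hc⟩ := exists_int_near h5 e
      refine ⟨Ideal.Quotient.mk _ c, ?_⟩
      have hc2 := (Ideal.Quotient.mk_surjective (Ideal.Quotient.mk (v.asIdeal ^ e) c)).choose_spec
      set d := (Ideal.Quotient.mk_surjective (Ideal.Quotient.mk (v.asIdeal ^ e) c)).choose
      rw [mk_eq_iff] at hc2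
      rw [← hr, mk_eq_iff]
      have e1 : ((t + p' * d : 𝓞 K) : K) - r = (p' : K) * (((d : K) - c) + ((c : K) - ((r : K) - t) / (p' : K))) := by
        have : ((t + p' * d : 𝓞 K) : K) = t + p' * d := by simp
        rw [this]
        have := h1.1
        field_simp; ring
      rw [e1]
      have := (ge_ord (v := v) (p' : K)).mul (hc2.add hc)
      refine this.mono ?_
      rw [h1.2, hp]; push_cast; omega
    have he' : (e : ℤ) = ord v (2 : K) := e2_eq
    rcases sq_one_near h3 with h | h
    · obtain ⟨c, hc⟩ := main 1 (by rw [he']; simpa using h)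
      exact ⟨(true, c), by simpa [f] using hc⟩
    · obtain ⟨c, hc⟩ := main (-1) (by rw [he']; simpa using h)
      exact ⟨(false, c), by simpa [f] using hc⟩
  choose g hg using key
  have hinj : Function.Injective g := by
    intro x y hxy
    have := hg x
    rw [hxy, hg y] at this
    exact Subtype.ext (Units.ext this.symm)
  refine (Nat.card_le_card_of_injective g hinj).trans ?_
  rw [Nat.card_prod, card_quot_pow]; simp

theorem index_sqS_fin (v : FP K) : (sqS (Sum.inl v : Place K)).index ≠ 0 ∧
    (sqS (Sum.inl v : Place K)).index ≤ 4 * (Ideal.absNorm v.asIdeal) ^ (e2 v) := by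
  classical
  set N := 2 * e2 v + 1 with hN
  have hN2 : (N : ℤ) = 2 * ord v (2:K) + 1 := by rw [← e2_eq]; push_cast; rfl
  let Q := (𝓞 K ⧸ v.asIdeal ^ N)ˣ
  have f2 : Finite (𝓞 K ⧸ v.asIdeal ^ N) := finite_quot_pow (v := v) N
  obtain ⟨p, hp0, hp⟩ := exists_ord v (1 : ℤ)
  have hlift : ∀ q : Q, ∃ r : 𝓞 K, Ideal.Quotient.mk (v.asIdeal ^ N) r = q := fun q =>
    Ideal.Quotient.mk_surjective _
  choose lf hlf using hlift
  have key : ∀ x : Kˣ, ∃ (b : Bool) (q : Q ⧸ sqr Q), Sq (Sum.inl v) ((x : K) * ((if b then p else 1) * (lf q.out : K)))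
      ∧ (lf q.out : K) ≠ 0 := by
    intro x
    obtain ⟨n, b, hb⟩ : ∃ (n : ℤ) (b : Bool), ord v (x : K) + ord v (if b then p else (1 : K)) = 2 * n := by
      rcases Int.even_or_odd' (ord v (x : K)) with ⟨n, h | h⟩
      · exact ⟨n, false, by simp [h]⟩
      · exact ⟨n + 1, true, by simp [h, hp]; ring⟩
    set P := if b then p else (1 : K) with hP
    have hP0 : P ≠ 0 := by rw [hP]; split_ifs <;> simp [hp0]
    set u : K := (x : K) * P * (p ^ (-n)) ^ 2 with hu
    have hu0 : u ≠ 0 := mul_ne_zero (mul_ne_zero x.ne_zero hP0) (pow_ne_zero _ (zpow_ne_zero _ hp0))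
    have hou : ord v u = 0 := by
      rw [hu, ord_mul v (mul_ne_zero x.ne_zero hP0) (pow_ne_zero _ (zpow_ne_zero _ hp0)),
        ord_mul v x.ne_zero hP0, ord_sq v (zpow_ne_zero _ hp0), ord_zpow v hp0, hp, hb]; ring
    obtain ⟨r, q, hr, hq⟩ := exists_unit_lift hu0 hou N
    refine ⟨b, (q : Q ⧸ sqr Q), ?_⟩
    obtain ⟨⟨t', t, ht'⟩, ht⟩ := QuotientGroup.mk_out_eq_mul (sqr Q) q
    have ht1 : ((q : Q ⧸ sqr Q).out) = q * t ^ 2 := by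
      rw [ht]; congr 1; exact ht'.symm
    obtain ⟨s, hs⟩ := Ideal.Quotient.mk_surjective (t : 𝓞 K ⧸ v.asIdeal ^ N)
    have h1 := hlf (q : Q ⧸ sqr Q).out
    set r' := lf (q : Q ⧸ sqr Q).out
    have hc1 : Ideal.Quotient.mk (v.asIdeal ^ N) (r * s ^ 2) = Ideal.Quotient.mk (v.asIdeal ^ N) r' := by
      rw [h1, ht1, map_mul, map_pow, hq, hs]; exact (Units.val_mul q (t ^ 2)).symm ▸ rfl
    have hc := mk_eq_iff.1 hc1
    -- units
    have hr1 : GE v N ((r : K) - u) := hr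
    have hru := ord_eq_of_sub hu0 (hr1.mono (by rw [hou, hN]; push_cast; omega))
    obtain ⟨s', hs'⟩ := Ideal.Quotient.mk_surjective ((t⁻¹ : Q) : 𝓞 K ⧸ v.asIdeal ^ N)
    have hss : Ideal.Quotient.mk (v.asIdeal ^ N) (s * s') = Ideal.Quotient.mk (v.asIdeal ^ N) 1 := by
      rw [map_mul, hs, hs', map_one]; exact Units.mul_inv t
    have hss := mk_eq_iff.1 hss
    have hss1 := ord_eq_of_sub (v := v) (x := ((1 : 𝓞 K) : K)) (by simp)
      (hss.mono (by simp [hN]))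
    have hsm : ((s * s' : 𝓞 K) : K) = s * s' := by simp
    have hs0 : (s : K) ≠ 0 := by
      intro h; apply hss1.1; rw [hsm, h, zero_mul]
    have hs0' : (s' : K) ≠ 0 := by
      intro h; apply hss1.1; rw [hsm, h, mul_zero]
    have hos : ord v (s : K) = 0 := by
      have h2 := hss1.2
      rw [hsm, ord_mul v hs0 hs0'] at h2
      have a1 := (ge_iff (v := v) hs0).1 (ge_int s)
      have a2 := (ge_iff (v := v) hs0').1 (ge_int s')
      have a3 : ord v ((1 : 𝓞 K) : K) = 0 := by simp
      omega
    have hrs0 : (r : K) * s ^ 2 ≠ 0 := mul_ne_zero hru.1 (pow_ne_zero _ hs0)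
    have hrs : ord v ((r : K) * s ^ 2) = 0 := by
      rw [ord_mul v hru.1 (pow_ne_zero _ hs0), ord_sq v hs0, hos, hru.2, hou]; ring
    have hc' : GE v N ((r' : K) - (r : K) * s ^ 2) := by
      have := hc.neg
      convert this using 1
      have : ((r * s ^ 2 : 𝓞 K) : K) = r * s ^ 2 := by simp
      rw [this]; ring
    have hr' := ord_eq_of_sub hrs0 (hc'.mono (by rw [hrs, hN]; push_cast; omega))
    refine ⟨?_, hr'.1⟩
    have hsq : Sq (Sum.inl v) (u * (r' : K)) := by
      have hur0 : u * (r' : K) ≠ 0 := mul_ne_zero hu0 hr'.1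
      rw [Sq, lsq_iff_exists hur0]
      refine ⟨r * s, ?_⟩
      rw [ord_mul v hu0 hr'.1, hou, hr'.2, hrs, ← hN2]
      have e1 : ((r : K) * s) ^ 2 - u * r' = (r : K) * s ^ 2 * (r - u) - u * (r' - r * s ^ 2) := by ring
      rw [e1]
      refine GE.sub ?_ ?_
      · have := (ge_ord (v := v) ((r : K) * s ^ 2)).mul hr1
        rw [hrs] at this; simpa using this
      · have := (ge_ord (v := v) u).mul hc'
        rw [hou] at this; simpa using this
    rw [hu] at hsq
    have e2 : (x : K) * P * (p ^ (-n)) ^ 2 * r' = (x : K) * (P * r') * (p ^ (-n)) ^ 2 := by ring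
    rw [e2] at hsq
    exact (LSq.mul_sq_iff (zpow_ne_zero _ hp0)).1 hsq
  let F : Bool × (Q ⧸ sqr Q) → Kˣ ⧸ sqS (Sum.inl v : Place K) := fun z =>
    if h : (if z.1 then p else 1) * (lf z.2.out : K) ≠ 0 then ((Units.mk0 _ h : Kˣ) : Kˣ ⧸ sqS _) else 1
  have hF : Function.Surjective F := by
    intro y
    obtain ⟨x, rfl⟩ := QuotientGroup.mk_surjective y
    obtain ⟨b, q, h1, h2⟩ := key x⁻¹
    have h3 : (if b then p else 1) * (lf q.out : K) ≠ 0 := by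
      refine mul_ne_zero ?_ h2
      split_ifs <;> simp [hp0]
    refine ⟨(b, q), ?_⟩
    simp only [F, dif_pos h3]
    symm
    rw [QuotientGroup.eq]
    exact h1
  have fin : Finite (Kˣ ⧸ sqS (Sum.inl v : Place K)) := Finite.of_surjective F hF
  have hcard := Nat.card_le_card_of_surjective F hF
  rw [Nat.card_prod] at hcard
  have h4 : Nat.card (Q ⧸ sqr Q) = (sqr Q).index := rfl
  have h5 := card_two_tors_quot (v := v)
  rw [h4, index_sq_finite] at hcard
  refine ⟨?_, ?_⟩
  · exact Nat.card_pos.ne'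
  · refine hcard.trans ?_
    rw [Nat.card_eq_fintype_card, Fintype.card_bool]
    calc 2 * _ ≤ 2 * (2 * (Ideal.absNorm v.asIdeal) ^ (e2 v)) := Nat.mul_le_mul_left _ h5
      _ = _ := by ring

end count
end ADQ

namespace ADQ
open NumberField IsDedekindDomain WithZero

section total
variable {K : Type*} [Field K] [NumberField K]

theorem index_sqS_real {v : InfinitePlace K} (hv : v.IsReal) : (sqS (Sum.inr v : Place K)).index = 2 := by
  rw [Subgroup.index_eq_two_iff]
  refine ⟨-1, fun b => ?_⟩
  have h0 : InfinitePlace.embedding_of_isReal hv (b : K) ≠ 0 := by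
    rw [Ne, map_eq_zero]; exact b.ne_zero
  rw [mem_sqS, mem_sqS, Sq, Sq, lsq_real hv, lsq_real hv]
  simp only [mul_neg, mul_one, Units.val_neg, map_neg]
  rcases lt_or_gt_of_ne h0 with h | h
  · left; constructor <;> linarith
  · right; constructor <;> linarith

theorem index_sqS_complex {v : InfinitePlace K} (hv : ¬ v.IsReal) : (sqS (Sum.inr v : Place K)).index = 1 := by
  rw [Subgroup.index_eq_one, eq_top_iff]
  intro x _
  exact lsq_complex hv _

theorem index_sqS_ne (v : Place K) : (sqS v).index ≠ 0 := by
  rcases v with v | v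
  · exact (index_sqS_fin v).1
  · by_cases hv : v.IsReal
    · rw [index_sqS_real hv]; norm_num
    · rw [index_sqS_complex hv]; norm_num

/-- all places over S together with infinite ones -/
noncomputable def Pl (S : Finset (FP K)) : Finset (Place K) := S.disjSum Finset.univ

theorem mem_Pl_inl {S : Finset (FP K)} {v : FP K} : (Sum.inl v : Place K) ∈ Pl S ↔ v ∈ S := by
  simp [Pl]
theorem mem_Pl_inr {S : Finset (FP K)} {v : InfinitePlace K} : (Sum.inr v : Place K) ∈ Pl S := by
  simp [Pl]
theorem card_Pl (S : Finset (FP K)) : (Pl S).card = S.card + Fintype.card (InfinitePlace K) := by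
  simp [Pl, Finset.card_disjSum]
theorem Pl_mono {S S' : Finset (FP K)} (h : S ⊆ S') : Pl S ⊆ Pl S' := by
  intro v hv
  rcases v with v | v
  · exact mem_Pl_inl.2 (h (mem_Pl_inl.1 hv))
  · exact mem_Pl_inr

theorem prod_norm_le (S : Finset (FP K)) :
    ∏ v ∈ S, (Ideal.absNorm v.asIdeal) ^ (e2 v) ≤ 2 ^ (Module.finrank ℚ K) := by
  have h1 : (∏ v ∈ S, v.asIdeal ^ (e2 v)) ∣ Ideal.span {(2 : 𝓞 K)} := by
    apply Finset.prod_dvd_of_coprime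
    · intro v _ w _ hvw
      exact HeightOneSpectrum.isCoprime_pow_of_ne _ _ hvw _ _
    · intro v _
      rw [Ideal.dvd_span_singleton, ← ge_int_pow, e2_eq]
      have : ((2 : 𝓞 K) : K) = 2 := rfl
      rw [this]; exact ge_ord _
  have h2 : Ideal.absNorm (∏ v ∈ S, v.asIdeal ^ (e2 v)) ∣ Ideal.absNorm (Ideal.span {(2 : 𝓞 K)}) :=
    map_dvd _ h1
  rw [map_prod, Ideal.absNorm_span_singleton] at h2
  have h3 : (Algebra.norm ℤ (2 : 𝓞 K)).natAbs = 2 ^ (Module.finrank ℚ K) := by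
    have : (2 : 𝓞 K) = algebraMap ℤ (𝓞 K) 2 := by simp
    rw [this, Algebra.norm_algebraMap, RingOfIntegers.rank, Int.natAbs_pow]; rfl
  rw [h3] at h2
  have := Nat.le_of_dvd (by positivity) h2
  simpa using this

theorem prod_index_le (S : Finset (FP K)) :
    ∏ v ∈ Pl S, (sqS v).index ≤ 2 ^ (2 * (Pl S).card) := by
  classical
  rw [Pl, Finset.prod_disjSum]
  have h1 : ∏ v ∈ S, (sqS (Sum.inl v : Place K)).index ≤ 4 ^ S.card * 2 ^ (Module.finrank ℚ K) := by
    calc ∏ v ∈ S, (sqS (Sum.inl v : Place K)).index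
        ≤ ∏ v ∈ S, 4 * (Ideal.absNorm v.asIdeal) ^ (e2 v) :=
          Finset.prod_le_prod' fun v _ => (index_sqS_fin v).2
      _ = 4 ^ S.card * ∏ v ∈ S, (Ideal.absNorm v.asIdeal) ^ (e2 v) := by
          rw [Finset.prod_mul_distrib, Finset.prod_const]
      _ ≤ _ := Nat.mul_le_mul_left _ (prod_norm_le S)
  have h2 : ∏ v : InfinitePlace K, (sqS (Sum.inr v : Place K)).index = 2 ^ (InfinitePlace.nrRealPlaces K) := by
    have : ∀ v : InfinitePlace K, (sqS (Sum.inr v : Place K)).index = if v.IsReal then 2 else 1 := by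
      intro v; split_ifs with h
      · exact index_sqS_real h
      · exact index_sqS_complex h
    rw [Finset.prod_congr rfl fun v _ => this v, Finset.prod_ite, Finset.prod_const, Finset.prod_const_one,
      mul_one, InfinitePlace.nrRealPlaces, Fintype.card_subtype]
  rw [h2, Finset.card_disjSum, Finset.card_univ]
  refine (Nat.mul_le_mul_right _ h1).trans (le_of_eq ?_)
  have h3 := InfinitePlace.card_add_two_mul_card_eq_rank K
  have h4 := InfinitePlace.card_eq_nrRealPlaces_add_nrComplexPlaces K
  rw [show (4 : ℕ) = 2 ^ 2 by norm_num, ← pow_mul, ← pow_add, ← pow_add]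
  congr 1
  omega

end total
end ADQ

namespace ADQ
open NumberField IsDedekindDomain WithZero

section inert
variable {K : Type*} [Field K] [NumberField K] {v : FP K}

theorem finite_res (v : FP K) : Finite (𝓞 K ⧸ v.asIdeal) := by
  have := finite_quot_pow (v := v) 1
  rwa [pow_one] at this

theorem res_eq_iff {r s : 𝓞 K} : Ideal.Quotient.mk v.asIdeal r = Ideal.Quotient.mk v.asIdeal s ↔
    GE v 1 ((r : K) - s) := by
  rw [Ideal.Quotient.eq, ← ge_int_mem]
  exact Iff.of_eq (by congr 1)

theorem exists_rho (v : FP K) : ∃ ρ : K, GE v 0 ρ ∧ ∀ t : K, GE v 0 t → ¬ GE v 1 (t ^ 2 + t - ρ) := by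
  have := finite_res v
  have hni : ¬ Function.Injective (fun t : 𝓞 K ⧸ v.asIdeal => t ^ 2 + t) := by
    intro h
    have h1 : (0 : 𝓞 K ⧸ v.asIdeal) = -1 := h (by simp)
    have h2 : (1 : 𝓞 K ⧸ v.asIdeal) = 0 := by linear_combination h1
    have : Nontrivial (𝓞 K ⧸ v.asIdeal) := Ideal.Quotient.nontrivial_iff.2 v.isPrime.ne_top
    exact one_ne_zero h2
  have hns := mt Finite.injective_iff_surjective.2 hni
  simp only [Function.Surjective, not_forall, not_exists] at hns
  obtain ⟨q, hq⟩ := hns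
  obtain ⟨r, rfl⟩ := Ideal.Quotient.mk_surjective q
  refine ⟨r, ge_int r, fun t ht h => ?_⟩
  obtain ⟨s, hs⟩ := exists_int_near ht 1
  apply hq (Ideal.Quotient.mk _ s)
  rw [← map_pow, ← map_add, res_eq_iff]
  have e1 : ((s ^ 2 + s : 𝓞 K) : K) - r = (t ^ 2 + t - r) + ((s : K) - t) * ((s : K) + t + 1) := by
    have : ((s ^ 2 + s : 𝓞 K) : K) = s ^ 2 + s := by simp
    rw [this]; ring
  rw [e1]
  refine h.add ?_
  have := hs.mul (((ge_int (v := v) s).add ht).add GE.one)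
  simpa using this

theorem exists_sqrt_mod (hv : 0 < ord v (2 : K)) {c : K} (hc : GE v 0 c) :
    ∃ z : K, GE v 0 z ∧ GE v 1 (z ^ 2 - c) := by
  have := finite_res v
  have h2 : (2 : 𝓞 K ⧸ v.asIdeal) = 0 := by
    have : Ideal.Quotient.mk v.asIdeal 2 = Ideal.Quotient.mk v.asIdeal 0 := by
      rw [res_eq_iff]
      have : ((2 : 𝓞 K) : K) - ((0 : 𝓞 K) : K) = 2 := by simp; rfl
      rw [this]
      exact (ge_iff (by norm_num)).2 (by omega)
    rw [map_zero] at this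
    exact this
  have hinj : Function.Injective (fun t : 𝓞 K ⧸ v.asIdeal => t ^ 2) := by
    intro a b h
    have hd : IsDomain (𝓞 K ⧸ v.asIdeal) := (Ideal.Quotient.isDomain_iff_prime _).2 v.isPrime
    simp only at h
    have : (a - b) ^ 2 = 0 := by linear_combination h + (-a * b + b ^ 2) * h2
    exact sub_eq_zero.1 (pow_eq_zero_iff (two_ne_zero) |>.1 this)
  have hs := Finite.injective_iff_surjective.1 hinj
  obtain ⟨r, hr⟩ := exists_int_near hc 1
  obtain ⟨q, hq⟩ := hs (Ideal.Quotient.mk _ r)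
  obtain ⟨z, rfl⟩ := Ideal.Quotient.mk_surjective q
  refine ⟨z, ge_int z, ?_⟩
  simp only at hq
  rw [← map_pow, res_eq_iff] at hq
  have := hq.add hr
  convert this using 1
  have : ((z ^ 2 : 𝓞 K) : K) = z ^ 2 := by simp
  rw [this]; ring

/-- unramified non-square units -/
def Inert (v : FP K) (a : K) : Prop :=
  a ≠ 0 ∧ ord v a = 0 ∧ ¬ Sq (Sum.inl v) a ∧ ∃ x0, GE v (2 * ord v (2:K)) (x0 ^ 2 - a)

theorem ord_four : ord v (4 : K) = 2 * ord v (2 : K) := by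
  rw [show (4 : K) = 2 ^ 2 by norm_num, ord_sq v (by norm_num)]

theorem inert_of_rho {ρ : K} (h0 : GE v 0 ρ) (h : ∀ t : K, GE v 0 t → ¬ GE v 1 (t ^ 2 + t - ρ)) :
    Inert v (1 + 4 * ρ) := by
  have hge4 : GE v (2 * ord v (2:K)) (4 : K) := by rw [← ord_four]; exact ge_ord _
  have h4ρ : GE v (2 * ord v (2:K)) (4 * ρ) := by simpa using hge4.mul h0
  have key : ∀ y : K, ¬ GE v (2 * ord v (2:K) + 1) (y ^ 2 - (1 + 4 * ρ)) := by
    intro y hy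
    set t := (y - 1) / 2 with ht
    have ht2 : t ^ 2 + t - ρ = (y ^ 2 - (1 + 4 * ρ)) * 4⁻¹ := by rw [ht]; field_simp; ring
    have h1 : GE v 1 (t ^ 2 + t - ρ) := by
      rw [ht2]
      have := hy.mul (ge_ord (v := v) (4 : K)⁻¹)
      rw [ord_inv, ord_four] at this
      exact this.mono (by omega)
    refine h t ?_ h1
    by_contra hneg
    have ht0 : t ≠ 0 := by rintro h; rw [h] at hneg; exact hneg GE.zero
    rw [ge_iff ht0] at hneg
    have h3 : GE v 0 (t ^ 2 + t) := by
      have := (h1.mono (show (0:ℤ) ≤ 1 by norm_num)).add h0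
      simpa using this
    have h4 := ord_add_eq (v := v) (pow_ne_zero 2 ht0) (y := t) (by
      rw [ord_sq v ht0]; exact (ge_ord t).mono (by omega))
    rw [ge_iff h4.1, h4.2, ord_sq v ht0] at h3
    omega
  have hu0 : (1 + 4 * ρ : K) ≠ 0 := by
    intro h1; apply key 0; rw [h1]; simpa using GE.zero
  have hou : ord v (1 + 4 * ρ) = 0 := by
    have hge : 0 ≤ ord v (1 + 4 * ρ) := by
      rw [← ge_iff hu0]
      exact GE.one.add (h4ρ.mono (by have := ord_two_nonneg (v := v); omega))
    by_cases he : ord v (2 : K) = 0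
    · have := key 0
      have h5 : (0 : K) ^ 2 - (1 + 4 * ρ) = - (1 + 4 * ρ) := by ring
      rw [h5, ge_iff (neg_ne_zero.2 hu0), ord_neg, he] at this
      omega
    · have := ord_add_eq (v := v) (x := 1) one_ne_zero (y := 4 * ρ) (h4ρ.mono (by
        have := ord_two_nonneg (v := v); rw [ord_one]; omega))
      rw [this.2, ord_one]
  refine ⟨hu0, hou, ?_, 1, ?_⟩
  · rw [Sq, lsq_iff_exists hu0, hou, add_zero]
    rintro ⟨y, hy⟩; exact key y hy
  · have := h4ρ.neg
    convert this using 1; ring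

theorem exists_inert (v : FP K) : ∃ u : K, Inert v u := by
  obtain ⟨ρ, h0, h⟩ := exists_rho v
  exact ⟨_, inert_of_rho h0 h⟩

theorem inert_ord_even {a : K} (ha : Inert v a) {t : K} : Even (ord v (t ^ 2 - a)) := by
  obtain ⟨ha0, hoa, hns, x0, hx0⟩ := ha
  rw [Sq, lsq_iff_exists ha0, hoa, add_zero] at hns
  simp only [not_exists] at hns
  have he := ord_two_nonneg (v := v)
  have hne : ∀ t : K, t ^ 2 - a ≠ 0 := fun t h => hns t (by rw [h]; exact GE.zero)
  have hlt : ∀ t : K, ord v (t ^ 2 - a) ≤ 2 * ord v (2 : K) := fun t => by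
    have := hns t; rw [ge_iff (hne t)] at this; omega
  by_cases hneg : GE v 0 t
  swap
  · have ht0 : t ≠ 0 := by rintro h; rw [h] at hneg; exact hneg GE.zero
    rw [ge_iff ht0] at hneg
    have := ord_add_eq (v := v) (pow_ne_zero 2 ht0) (y := -a) (by
      rw [ge_iff (neg_ne_zero.2 ha0), ord_neg, ord_sq v ht0]; omega)
    rw [sub_eq_add_neg, this.2, ord_sq v ht0]; exact ⟨_, two_mul _⟩
  by_contra hodd
  have hn : ord v (t ^ 2 - a) < 2 * ord v (2 : K) := by
    refine lt_of_le_of_ne (hlt t) fun h => hodd (h ▸ ⟨_, two_mul _⟩)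
  have hx0i : GE v 0 x0 := by
    by_contra hneg'
    have ht0 : x0 ≠ 0 := by rintro h; rw [h] at hneg'; exact hneg' GE.zero
    rw [ge_iff ht0] at hneg'
    have := ord_add_eq (v := v) (pow_ne_zero 2 ht0) (y := -a) (by
      rw [ge_iff (neg_ne_zero.2 ha0), ord_neg, ord_sq v ht0]; omega)
    rw [sub_eq_add_neg, ge_iff this.1, this.2, ord_sq v ht0] at hx0
    omega
  have h2x : GE v (ord v (2:K)) (2 * x0) := by simpa using (ge_ord (v := v) (2 : K)).mul hx0i
  have h1 := ord_eq_of_sub (v := v) (x := t ^ 2 - a) (y := (t - x0) * (t + x0)) (hne t) (by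
    have : (t - x0) * (t + x0) - (t ^ 2 - a) = -(x0 ^ 2 - a) := by ring
    rw [this]; exact hx0.neg.mono (by omega))
  have hA := left_ne_zero_of_mul h1.1
  have hB := right_ne_zero_of_mul h1.1
  have h3 := h1.2
  rw [ord_mul v hA hB] at h3
  by_cases hi : ord v (t - x0) < ord v (2 : K)
  · have h4 := ord_add_eq (v := v) hA (y := 2 * x0) (h2x.mono (by omega))
    rw [show t - x0 + 2 * x0 = t + x0 by ring] at h4
    apply hodd; rw [← h3, h4.2]; exact ⟨_, rfl⟩
  · have h4 : GE v (ord v (2 : K)) (t + x0) := by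
      have := ((ge_ord (v := v) (t - x0)).mono (not_lt.1 hi)).add h2x
      convert this using 1; ring
    rw [ge_iff hB] at h4
    omega

theorem inert_even {a b : K} (ha : Inert v a) (hb : b ≠ 0) (h : Nm (Sum.inl v) a b) : Even (ord v b) := by
  obtain ⟨x, y, h0, h1⟩ := h
  have h2 := lsq_even (mul_ne_zero hb h0) h1
  rw [ord_mul v hb h0] at h2
  have h3 : Even (ord v (x ^ 2 - a * y ^ 2)) := by
    by_cases hy : y = 0
    · subst hy
      have hx : x ≠ 0 := by rintro rfl; simp at h0
      simp only [ne_eq, OfNat.ofNat_ne_zero, not_false_eq_true, zero_pow, mul_zero, sub_zero]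
      rw [ord_sq v hx]; exact ⟨_, two_mul _⟩
    · have e1 : x ^ 2 - a * y ^ 2 = ((x / y) ^ 2 - a) * y ^ 2 := by field_simp
      have h5 : (x / y) ^ 2 - a ≠ 0 := by intro h; rw [e1, h, zero_mul] at h0; exact h0 rfl
      rw [e1, ord_mul v h5 (pow_ne_zero 2 hy), ord_sq v hy]
      exact (inert_ord_even ha).add ⟨_, two_mul _⟩
  rw [Int.even_add] at h2
  exact h2.2 h3

/-- non-norms exist, finite places -/
theorem exists_nonnorm_fin (v : FP K) {a : K} (ha : a ≠ 0) (hns : ¬ Sq (Sum.inl v) a) :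
    ∃ b : K, b ≠ 0 ∧ ¬ Nm (Sum.inl v) a b := by
  have he := ord_two_nonneg (v := v)
  by_cases hodd : Even (ord v a)
  swap
  · obtain ⟨u, hu⟩ := exists_inert v
    exact ⟨u, hu.1, fun h => hodd (inert_even hu ha (nm_symm ha hu.1 h))⟩
  -- scale
  obtain ⟨k, hk⟩ := hodd
  obtain ⟨p, hp0, hp⟩ := exists_ord v (1 : ℤ)
  wlog hoa : ord v a = 0 generalizing a k
  · have hs0 : p ^ (-k) ≠ 0 := zpow_ne_zero _ hp0
    have ho : ord v (a * (p ^ (-k)) ^ 2) = 0 := by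
      rw [ord_mul v ha (pow_ne_zero 2 hs0), ord_sq v hs0, ord_zpow v hp0, hp, hk]; ring
    obtain ⟨b, hb, h⟩ := this (a := a * (p ^ (-k)) ^ 2) (mul_ne_zero ha (pow_ne_zero 2 hs0))
      (by rw [Sq, LSq.mul_sq_iff hs0]; exact hns) 0 (by rw [ho]; simp) ho
    refine ⟨b, hb, fun h' => h (nm_congr_left (mul_ne_zero ha (pow_ne_zero 2 hs0)) ha hb ?_ h')⟩
    rw [show a * (p ^ (-k)) ^ 2 * a = (a * p ^ (-k)) ^ 2 by ring]; exact LSq.sq _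
  clear hk k
  by_cases hin : Inert v a
  · refine ⟨p, hp0, fun h => ?_⟩
    have := inert_even hin hp0 h
    rw [hp] at this; exact absurd this (by decide)
  have hin' : ∀ x0, ¬ GE v (2 * ord v (2:K)) (x0 ^ 2 - a) := by
    intro x0 h; exact hin ⟨ha, hoa, hns, x0, h⟩
  have hne : ∀ t : K, t ^ 2 - a ≠ 0 := fun t h => hin' t (by rw [h]; exact GE.zero)
  have hlt : ∀ t : K, ord v (t ^ 2 - a) < 2 * ord v (2 : K) := fun t => by
    have := hin' t; rw [ge_iff (hne t)] at this; omega
  have hai : GE v 0 a := by rw [ge_iff ha, hoa]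
  -- maximal
  obtain ⟨n, ⟨x0, hx0i, hx0⟩, hmax⟩ := Int.exists_greatest_of_bdd
    (P := fun n => ∃ x0, GE v 0 x0 ∧ ord v (x0 ^ 2 - a) = n)
    ⟨2 * ord v (2 : K), by rintro z ⟨x, _, rfl⟩; exact (hlt x).le⟩ ⟨_, 1, GE.one, rfl⟩
  have hn0 : 0 ≤ n := by
    rw [← hx0, ← ge_iff (hne x0)]
    have := hx0i.pow2.sub hai
    simpa using this
  have hn2 : n < 2 * ord v (2:K) := hx0 ▸ hlt x0
  have hdy : 0 < ord v (2 : K) := by omega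
  have hnodd : ¬ Even n := by
    rintro ⟨k, hk⟩
    have hpk0 : p ^ k ≠ 0 := zpow_ne_zero _ hp0
    have hpk : ord v (p ^ k) = k := by rw [ord_zpow v hp0, hp, mul_one]
    set c := -(x0 ^ 2 - a) / (p ^ k) ^ 2 with hc
    have hc0 : GE v 0 c := by
      rw [hc, ge_iff (div_ne_zero (neg_ne_zero.2 (hne x0)) (pow_ne_zero 2 hpk0)),
        ord_div v (neg_ne_zero.2 (hne x0)) (pow_ne_zero 2 hpk0), ord_neg, hx0, ord_sq v hpk0, hpk]
      omega
    obtain ⟨z, hz0, hz⟩ := exists_sqrt_mod hdy hc0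
    have h1 : (x0 + p ^ k * z) ^ 2 - a = (p ^ k) ^ 2 * (z ^ 2 - c) + 2 * x0 * p ^ k * z := by
      rw [hc]; field_simp; ring
    have h2 : GE v (n + 1) ((x0 + p ^ k * z) ^ 2 - a) := by
      rw [h1]
      refine GE.add ?_ ?_
      · have := (ge_ord (v := v) (p ^ k)).pow2.mul hz
        rw [hpk] at this; exact this.mono (by omega)
      · have := (((ge_ord (v := v) (2 : K)).mul hx0i).mul (ge_ord (v := v) (p ^ k))).mul hz0
        rw [hpk] at this; exact this.mono (by omega)
    have h3 := hmax _ ⟨x0 + p ^ k * z, hx0i.add (by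
      have := (ge_ord (v := v) (p ^ k)).mul hz0
      rw [hpk] at this; exact this.mono (by omega)), rfl⟩
    rw [ge_iff (hne _)] at h2
    omega
  have hn1 : 1 ≤ n := by
    rcases hn0.lt_or_eq with h | h
    · omega
    · exact absurd (h ▸ ⟨0, by simp⟩ : Even n) hnodd
  have hxa := ord_eq_of_sub (v := v) (x := a) (y := x0 ^ 2) ha (by
    rw [hoa, ge_iff (hne x0), hx0]; omega)
  have hx00 : x0 ≠ 0 := by rintro rfl; simp at hxa
  have hox : ord v x0 = 0 := by
    have := hxa.2; rw [ord_sq v hx00, hoa] at this; omega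
  set α := (a - x0 ^ 2) / x0 ^ 2 with hα
  have hα0 : α ≠ 0 := div_ne_zero (by rw [← neg_ne_zero, neg_sub]; exact hne x0) (pow_ne_zero 2 hx00)
  have hoα : ord v α = n := by
    rw [hα, ord_div v (by rw [← neg_ne_zero, neg_sub]; exact hne x0) (pow_ne_zero 2 hx00),
      ord_sq v hx00, hox, ← neg_sub (x0 ^ 2) a, ord_neg, hx0]; ring
  obtain ⟨ρ, hρi, hρ⟩ := exists_rho v
  have h4ρ : GE v (2 * ord v (2:K)) (4 * ρ) := by
    rw [← ord_four]; simpa using (ge_ord (v := v) (4 : K)).mul hρi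
  have hγ := ord_add_eq (v := v) hα0 (y := 4 * ρ) (h4ρ.mono (by omega))
  set γ := α + 4 * ρ with hγd
  have h1γ := ord_add_eq (v := v) (x := 1) one_ne_zero (y := γ) (by
    rw [ge_iff hγ.1, hγ.2, hoα, ord_one]; omega)
  have h1α := ord_add_eq (v := v) (x := 1) one_ne_zero (y := α) (by
    rw [ge_iff hα0, hoα, ord_one]; omega)
  rw [ord_one] at h1γ h1α
  have hb0 : γ / α ≠ 0 := div_ne_zero hγ.1 hα0
  refine ⟨γ / α, hb0, fun h => ?_⟩
  have h1 : Nm (Sum.inl v) (1 + α) (γ / α) := by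
    refine nm_congr_left h1α.1 ha hb0 ?_ h
    rw [show (1 + α) * a = (a / x0) ^ 2 by rw [hα]; field_simp; ring]
    exact LSq.sq _
  have h2 : Nm (Sum.inl v) (1 + α) (-α) := by
    have := nm_one_sub (v := Sum.inl v) (a := 1 + α)
    rwa [show 1 - (1 + α) = -α by ring] at this
  have h3 : Nm (Sum.inl v) (1 + α) (-γ) := by
    have := nm_mul h1 h2
    rwa [show γ / α * -α = -γ by field_simp] at this
  have h4 : Nm (Sum.inl v) (1 + γ) (-γ) := by
    have := nm_one_sub (v := Sum.inl v) (a := 1 + γ)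
    rwa [show 1 - (1 + γ) = -γ by ring] at this
  have h5 := nm_mul_left h1α.1 h1γ.1 (neg_ne_zero.2 hγ.1) h3 h4
  have hfin : Inert v (1 + 4 * (-ρ / (1 + γ))) := by
    apply inert_of_rho
    · have := hρi.neg.mul (ge_ord (v := v) (1 + γ)⁻¹)
      rw [ord_inv, h1γ.2] at this
      simpa [div_eq_mul_inv] using this
    · intro t ht h'
      apply hρ t ht
      have e1 : t ^ 2 + t - ρ = (t ^ 2 + t - -ρ / (1 + γ)) + (- ρ) * (2 + γ) * (1 + γ)⁻¹ := by
        have := h1γ.1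
        field_simp; ring
      rw [e1]
      refine h'.add ?_
      have h2γ : GE v 1 (2 + γ) := by
        refine GE.add ((ge_iff (by norm_num)).2 (by omega)) ?_
        rw [ge_iff hγ.1, hγ.2, hoα]; omega
      have := (hρi.neg.mul h2γ).mul (ge_ord (v := v) (1 + γ)⁻¹)
      rw [ord_inv, h1γ.2] at this
      exact this.mono (by omega)
  have h6 := nm_congr_left (a := 1 + 4 * (-ρ / (1 + γ))) hfin.1 (mul_ne_zero h1α.1 h1γ.1) (neg_ne_zero.2 hγ.1) (by
    have e1 : (1 + 4 * (-ρ / (1 + γ))) * ((1 + α) * (1 + γ)) = (1 + α) ^ 2 := by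
      have := h1γ.1
      field_simp; rw [hγd]; ring
    rw [e1]; exact LSq.sq _) h5
  have h7 := inert_even hfin (neg_ne_zero.2 hγ.1) h6
  rw [ord_neg, hγ.2, hoα] at h7
  exact hnodd h7

theorem exists_nonnorm (v : Place K) {a : K} (ha : a ≠ 0) (hns : ¬ Sq v a) :
    ∃ b : K, b ≠ 0 ∧ ¬ Nm v a b := by
  rcases v with v | v
  · exact exists_nonnorm_fin v ha hns
  · by_cases hv : v.IsReal
    swap
    · exact absurd (lsq_complex hv a) hns
    refine ⟨-1, by simp, ?_⟩
    rintro ⟨x, y, h0, h1⟩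
    rw [Sq, lsq_real hv] at h1 hns
    set φ := InfinitePlace.embedding_of_isReal hv
    have h2 : φ (x ^ 2 - a * y ^ 2) ≠ 0 := by rwa [Ne, map_eq_zero]
    simp only [map_mul, map_sub, map_pow, map_neg, map_one] at h1 h2
    have h3 : 0 ≤ φ x ^ 2 - φ a * φ y ^ 2 := by nlinarith [sq_nonneg (φ x), sq_nonneg (φ y)]
    apply h2; linarith

end inert
end ADQ

namespace ADQ
open NumberField IsDedekindDomain WithZero

section odd
variable {K : Type*} [Field K] [NumberField K]

theorem mk_sqS_eq {v : Place K} {x y : Kˣ} :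
    (x : Kˣ ⧸ sqS v) = y ↔ Sq v ((x : K) * y) := by
  rw [QuotientGroup.eq, mem_sqS, Units.val_mul, Units.val_inv_eq_inv_val]
  have e1 : (x : K) * y = (x : K)⁻¹ * y * (x : K) ^ 2 := by
    have := x.ne_zero; field_simp
  rw [e1, Sq, Sq, LSq.mul_sq_iff x.ne_zero]

theorem four_classes {v : Place K} (hidx : (sqS v).index ≤ 4) {g h x : K} (hg0 : g ≠ 0) (hh0 : h ≠ 0)
    (hx0 : x ≠ 0) (hg : ¬ Sq v g) (hh : ¬ Sq v h) (hgh : ¬ Sq v (g * h)) :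
    Sq v x ∨ Sq v (g * x) ∨ Sq v (h * x) ∨ Sq v (g * h * x) := by
  classical
  by_contra hcon
  push Not at hcon
  obtain ⟨h1, h2, h3, h4⟩ := hcon
  have fin : Finite (Kˣ ⧸ sqS v) := Nat.finite_of_card_ne_zero (index_sqS_ne v)
  have := Fintype.ofFinite (Kˣ ⧸ sqS v)
  let u := Units.mk0 g hg0
  let w := Units.mk0 h hh0
  let y := Units.mk0 x hx0
  let s : Finset (Kˣ ⧸ sqS v) := {((y : Kˣ) : Kˣ ⧸ sqS v), ((u * w : Kˣ) : Kˣ ⧸ sqS v), (u : Kˣ ⧸ sqS v), (w : Kˣ ⧸ sqS v), ((1 : Kˣ) : Kˣ ⧸ sqS v)}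
  have a1 : ¬ Sq v (g * h * g) := by
    rw [show g * h * g = h * g ^ 2 by ring, Sq, LSq.mul_sq_iff hg0]; exact hh
  have a2 : ¬ Sq v (g * h * h) := by
    rw [show g * h * h = g * h ^ 2 by ring, Sq, LSq.mul_sq_iff hh0]; exact hg
  have hs : s.card = 5 := by
    simp only [s]
    rw [Finset.card_insert_of_notMem, Finset.card_insert_of_notMem, Finset.card_insert_of_notMem,
      Finset.card_insert_of_notMem, Finset.card_singleton]
    all_goals
      simp only [Finset.mem_insert, Finset.mem_singleton, mk_sqS_eq, u, w, y, Units.val_mul, Units.val_mk0,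
        Units.val_one, mul_one, not_or]
    · exact hh
    · exact ⟨hgh, hg⟩
    · exact ⟨a1, a2, hgh⟩
    · refine ⟨?_, ?_, ?_, h1⟩
      · rwa [mul_comm]
      · rwa [mul_comm]
      · rwa [mul_comm]
  have hle := Finset.card_le_univ s
  rw [← Nat.card_eq_fintype_card] at hle
  have : Nat.card (Kˣ ⧸ sqS v) = (sqS v).index := rfl
  omega

variable {v : FP K}

theorem index_odd (hv : ord v (2 : K) = 0) : (sqS (Sum.inl v : Place K)).index ≤ 4 := by
  have := (index_sqS_fin v).2
  rw [e2, hv] at this; simpa using this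

theorem inert_odd (hv : ord v (2 : K) = 0) {a : K} (ha0 : a ≠ 0) (ha : ord v a = 0)
    (hns : ¬ Sq (Sum.inl v) a) : Inert v a :=
  ⟨ha0, ha, hns, 0, by
    rw [hv]; have := (ge_ord (v := v) a).neg; rw [ha] at this; simpa using this⟩

theorem odd_even {a b : K} (hv : ord v (2 : K) = 0) (ha0 : a ≠ 0) (ha : ord v a = 0)
    (hns : ¬ Sq (Sum.inl v) a) (hb : b ≠ 0) (h : Nm (Sum.inl v) a b) : Even (ord v b) :=
  inert_even (inert_odd hv ha0 ha hns) hb h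

/-- product of two nonsquare units is a square -/
theorem odd_mul {a b : K} (hv : ord v (2 : K) = 0) (ha0 : a ≠ 0) (hb0 : b ≠ 0) (ha : ord v a = 0)
    (hb : ord v b = 0) (hna : ¬ Sq (Sum.inl v) a) (hnb : ¬ Sq (Sum.inl v) b) : Sq (Sum.inl v) (a * b) := by
  obtain ⟨p, hp0, hp⟩ := exists_ord v (1 : ℤ)
  have hodd : ∀ x : K, x ≠ 0 → ord v x = 1 → ¬ Sq (Sum.inl v) x := by
    intro x hx h1 h2
    have := lsq_even hx h2
    rw [h1] at this; exact absurd this (by decide)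
  have h := four_classes (index_odd hv) ha0 hp0 hb0 hna (hodd _ hp0 hp)
    (hodd _ (mul_ne_zero ha0 hp0) (by rw [ord_mul v ha0 hp0, ha, hp]; rfl))
  rcases h with h | h | h | h
  · exact absurd h hnb
  · exact h
  · exact absurd h (hodd _ (mul_ne_zero hp0 hb0) (by rw [ord_mul v hp0 hb0, hb, hp]; rfl))
  · exact absurd h (hodd _ (mul_ne_zero (mul_ne_zero ha0 hp0) hb0)
      (by rw [ord_mul v (mul_ne_zero ha0 hp0) hb0, ord_mul v ha0 hp0, ha, hb, hp]; rfl))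

theorem odd_near {x y : K} (hv : ord v (2 : K) = 0) (hx0 : x ≠ 0) (hx : ord v x = 0)
    (h : GE v 1 (y - x)) : Sq (Sum.inl v) (x * y) := by
  have h1 := ord_eq_of_sub hx0 (y := y) (h.mono (by rw [hx]; simp))
  rw [Sq, lsq_iff_exists (mul_ne_zero hx0 h1.1), ord_mul v hx0 h1.1, h1.2, hx, hv]
  refine ⟨x, ?_⟩
  have := (ge_ord (v := v) x).mul h.neg
  rw [hx] at this
  refine GE.mono ?_ (show _ ≤ (0 + 1 : ℤ) by norm_num)
  convert this using 1; ring

/-- unit symbols are trivial at odd places -/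
theorem odd_unit_nm {a b : K} (hv : ord v (2 : K) = 0) (ha0 : a ≠ 0) (hb0 : b ≠ 0) (ha : ord v a = 0)
    (hb : ord v b = 0) : Nm (Sum.inl v) a b := by
  classical
  have hmax : v.asIdeal.IsMaximal := v.isMaximal
  let fF : Field (𝓞 K ⧸ v.asIdeal) := Ideal.Quotient.field v.asIdeal
  have := finite_res v
  have := Fintype.ofFinite (𝓞 K ⧸ v.asIdeal)
  have h2 : (2 : 𝓞 K ⧸ v.asIdeal) ≠ 0 := by
    intro h
    have h' : Ideal.Quotient.mk v.asIdeal 2 = Ideal.Quotient.mk v.asIdeal 0 := by rw [map_zero]; exact h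
    rw [res_eq_iff] at h'
    have e : ((2 : 𝓞 K) : K) - ((0 : 𝓞 K) : K) = 2 := by simp; rfl
    rw [e, ge_iff (by norm_num), hv] at h'
    omega
  have hc : ringChar (𝓞 K ⧸ v.asIdeal) ≠ 2 := by
    intro h
    apply h2
    have := ringChar.Nat.cast_ringChar (R := 𝓞 K ⧸ v.asIdeal)
    rw [h] at this; exact_mod_cast this
  have hcard := FiniteField.odd_card_of_char_ne_two hc
  obtain ⟨r, hr⟩ := exists_int_near ((ge_iff (v := v) ha0).2 ha.ge) 1
  obtain ⟨s, hs⟩ := exists_int_near ((ge_iff (v := v) hb0).2 hb.ge) 1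
  have hr1 := ord_eq_of_sub ha0 (hr.mono (by rw [ha]; simp))
  have hrn : Ideal.Quotient.mk v.asIdeal r ≠ 0 := by
    intro h
    rw [← map_zero (Ideal.Quotient.mk v.asIdeal), res_eq_iff] at h
    have e : (r : K) - ((0 : 𝓞 K) : K) = r := by simp
    rw [e, ge_iff hr1.1, hr1.2, ha] at h
    omega
  obtain ⟨x', y', hxy⟩ := FiniteField.exists_root_sum_quadratic (R := 𝓞 K ⧸ v.asIdeal)
    (f := Polynomial.X ^ 2 - Polynomial.C (Ideal.Quotient.mk v.asIdeal s))
    (g := Polynomial.C (- Ideal.Quotient.mk v.asIdeal r) * Polynomial.X ^ 2)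
    (Polynomial.degree_X_pow_sub_C (by norm_num) _)
    (Polynomial.degree_C_mul_X_pow 2 (neg_ne_zero.2 hrn)) hcard
  obtain ⟨x, rfl⟩ := Ideal.Quotient.mk_surjective x'
  obtain ⟨y, rfl⟩ := Ideal.Quotient.mk_surjective y'
  simp only [Polynomial.eval_sub, Polynomial.eval_pow, Polynomial.eval_X, Polynomial.eval_C,
    Polynomial.eval_mul] at hxy
  have h3 : Ideal.Quotient.mk v.asIdeal (x ^ 2 - r * y ^ 2) = Ideal.Quotient.mk v.asIdeal s := by
    rw [map_sub, map_mul, map_pow, map_pow]; linear_combination hxy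
  rw [res_eq_iff] at h3
  have e1 : ((x ^ 2 - r * y ^ 2 : 𝓞 K) : K) = (x : K) ^ 2 - r * y ^ 2 := by simp
  rw [e1] at h3
  have h4 : GE v 1 (((x : K) ^ 2 - a * y ^ 2) - b) := by
    have := (h3.add hs).add (hr.mul (ge_int (v := v) y).pow2)
    refine GE.mono (n := 1) ?_ (by norm_num)
    have e2 : ((x : K) ^ 2 - a * y ^ 2) - b = ((x : K) ^ 2 - r * y ^ 2 - s) + (s - b) + (r - a) * y ^ 2 := by ring
    rw [e2]
    exact (h3.add hs).add (by simpa using hr.mul (ge_int (v := v) y).pow2)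
  have h5 := ord_eq_of_sub hb0 (h4.mono (by rw [hb]; simp))
  exact ⟨x, y, h5.1, odd_near hv hb0 hb h4⟩

end odd
end ADQ

namespace ADQ
open NumberField IsDedekindDomain WithZero

section below
variable {K L : Type*} [Field K] [NumberField K] [Field L] [NumberField L]

theorem ext_ord {v v' : FP K} (h : ∀ x : K, x ≠ 0 → ord v x ≠ 0 → ord v' x ≠ 0) : v = v' := by
  obtain ⟨x, hx, h1, h2⟩ := exists_supp v
  by_contra hne
  exact h x hx h1 (h2 v' (Ne.symm hne))

theorem ord_liesOver [Algebra K L] (w : FP L) (v : FP K) (h : w.asIdeal.LiesOver v.asIdeal) :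
    ∃ e : ℕ, 1 ≤ e ∧ ∀ x : K, ord w (algebraMap K L x) = e * ord v x := by
  refine ⟨v.asIdeal.ramificationIdx' w.asIdeal, Nat.one_le_iff_ne_zero.2
    (Ideal.IsDedekindDomain.ramificationIdx'_ne_zero_of_liesOver w.asIdeal v.ne_bot), fun x => ?_⟩
  rw [ord, ord, ← HeightOneSpectrum.valuation_liesOver L v w x, log_pow]
  simp

theorem exists_below' [Algebra K L] (w : FP L) : ∃ v : FP K, ∃ e : ℕ, 1 ≤ e ∧
    ∀ x, ord w (algebraMap K L x) = e * ord v x := by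
  exact ⟨w.under (𝓞 K), ord_liesOver w _ ⟨rfl⟩⟩

theorem exists_above' [Algebra K L] (v : FP K) : ∃ w : FP L, ∃ e : ℕ, 1 ≤ e ∧
    ∀ x, ord w (algebraMap K L x) = e * ord v x := by
  obtain ⟨Q, hQ, h⟩ := v.asIdeal.exists_ideal_over_prime_of_isIntegral_of_isDomain (S := 𝓞 L)
    (by rw [(RingHom.injective_iff_ker_eq_bot _).1 (FaithfulSMul.algebraMap_injective (𝓞 K) (𝓞 L))]
        exact bot_le)
  refine ⟨⟨Q, hQ, ?_⟩, ord_liesOver _ _ ⟨h.symm⟩⟩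
  rintro rfl
  refine v.ne_bot ?_
  rw [← h, eq_bot_iff]
  intro x hx
  have : algebraMap (𝓞 K) (𝓞 L) x = 0 := by simpa using hx
  simpa using this

theorem exists_below (f : K →+* L) (w : FP L) : ∃ v : FP K, ∃ e : ℕ, 1 ≤ e ∧
    ∀ x, ord w (f x) = e * ord v x := by
  letI := f.toAlgebra
  exact exists_below' w

theorem exists_above0 (f : K →+* L) (v : FP K) : ∃ w : FP L, ∃ e : ℕ, 1 ≤ e ∧
    ∀ x, ord w (f x) = e * ord v x := by
  letI := f.toAlgebra
  exact exists_above' v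

/-- finite place below -/
noncomputable def below (f : K →+* L) (w : FP L) : FP K := (exists_below f w).choose

theorem ord_below (f : K →+* L) (w : FP L) : ∃ e : ℕ, 1 ≤ e ∧
    ∀ x, ord w (f x) = e * ord (below f w) x := (exists_below f w).choose_spec

theorem below_eq {f : K →+* L} {w : FP L} {v : FP K}
    (h : ∀ x, ord v x ≠ 0 → ord w (f x) ≠ 0) : below f w = v := by
  refine (ext_ord fun x _ h1 h2 => h x h1 ?_).symm
  obtain ⟨e, he, h3⟩ := ord_below f w
  rw [h3, h2, mul_zero]

theorem exists_above (f : K →+* L) (v : FP K) : ∃ w : FP L, below f w = v := by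
  obtain ⟨w, e, he, h⟩ := exists_above0 f v
  refine ⟨w, below_eq fun x hx => ?_⟩
  rw [h]
  exact mul_ne_zero (by positivity) hx

theorem above_finite (f : K →+* L) (S : Finset (FP K)) : {w : FP L | below f w ∈ S}.Finite := by
  have h1 : ∀ v, {w : FP L | below f w = v}.Finite := by
    intro v
    obtain ⟨x, hx, h1⟩ := exists_ord v 1
    refine (support_finite (x := f x) (by simpa using hx)).subset ?_
    rintro w rfl
    obtain ⟨e, he, h2⟩ := ord_below f w
    change ord w (f x) ≠ 0
    rw [h2, h1]
    positivity
  refine (S.finite_toSet.biUnion fun v _ => h1 v).subset ?_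
  intro w hw
  simp only [Set.mem_iUnion]
  exact ⟨_, hw, rfl⟩

/-- finite places above a finite set -/
noncomputable def SL (f : K →+* L) (S : Finset (FP K)) : Finset (FP L) := (above_finite f S).toFinset

theorem mem_SL {f : K →+* L} {S : Finset (FP K)} {w : FP L} : w ∈ SL f S ↔ below f w ∈ S := by
  simp [SL]

theorem SL_mono {f : K →+* L} {S S' : Finset (FP K)} (h : S ⊆ S') : SL f S ⊆ SL f S' := by
  intro w hw
  rw [mem_SL] at *
  exact h hw

/-- place below -/
noncomputable def pb (f : K →+* L) : Place L → Place K
  | Sum.inl w => Sum.inl (below f w)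
  | Sum.inr w => Sum.inr (w.comap f)

theorem mem_Pl_SL {f : K →+* L} {S : Finset (FP K)} {w : Place L} : w ∈ Pl (SL f S) ↔ pb f w ∈ Pl S := by
  rcases w with w | w
  · simp [pb, mem_Pl_inl, mem_SL]
  · simp [pb, mem_Pl_inr]

theorem exists_pabove (f : K →+* L) (v : Place K) : ∃ w : Place L, pb f w = v := by
  rcases v with v | v
  · obtain ⟨w, hw⟩ := exists_above f v
    exact ⟨Sum.inl w, by simp [pb, hw]⟩
  · letI := f.toAlgebra
    haveI : Algebra.IsAlgebraic K L := Algebra.IsAlgebraic.of_finite K L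
    obtain ⟨w, hw⟩ := InfinitePlace.comap_surjective (k := K) (K := L) v
    exact ⟨Sum.inr w, congrArg Sum.inr hw⟩

theorem up_small (f : K →+* L) (w : Place L) {ε : ℝ} (hε : 0 < ε) :
    ∃ δ > 0, ∀ x, av (pb f w) x < δ → av w (f x) < ε := by
  rcases w with w | w
  · obtain ⟨e, he, h⟩ := ord_below f w
    obtain ⟨n, hn⟩ := exists_nat_gt (1 / ε)
    obtain ⟨δ, hδ, h1⟩ := av_small (below f w) (n : ℤ)
    refine ⟨δ, hδ, fun x hx => ?_⟩
    have h2 := h1 x hx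
    by_cases hx0 : x = 0
    · subst hx0; simpa using hε
    rw [ge_iff hx0] at h2
    have h3 : GE w n (f x) := by
      rw [ge_iff (by simpa using hx0), h]
      have : (1 : ℤ) ≤ e := by exact_mod_cast he
      nlinarith
    refine (ge_av.1 h3).trans_lt ?_
    have hq : (2 : ℝ) ≤ qv w := by
      have := one_lt_qv (v := w)
      rw [qv] at *
      exact_mod_cast this
    have : (n : ℝ) < qv w ^ n :=
      (by exact_mod_cast Nat.lt_two_pow_self : (n : ℝ) < 2 ^ n).trans_le (pow_le_pow_left₀ (by norm_num) hq n)
    rw [zpow_neg, zpow_natCast]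
    rw [one_div] at hn
    exact inv_lt_of_inv_lt₀ hε (hn.trans this)
  · exact ⟨ε, hε, fun x hx => hx⟩

theorem sq_up {f : K →+* L} {w : Place L} {x : K} (h : Sq (pb f w) x) : Sq w (f x) := by
  intro ε hε
  obtain ⟨δ, hδ, h1⟩ := up_small f w hε
  obtain ⟨y, hy⟩ := h δ hδ
  exact ⟨f y, by simpa using h1 _ hy⟩

end below

/-- quadratic extension data -/
structure QE (K L : Type*) [Field K] [Field L] [Algebra K L] (a : K) where
  s : L
  hs : s ^ 2 = algebraMap K L a
  span : ∀ z, ∃ x y : K, z = algebraMap K L x + algebraMap K L y * s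
  σ : L ≃+* L
  hσ : ∀ x, σ (algebraMap K L x) = algebraMap K L x
  σs : σ s = - s
  ns : ¬ IsSquare a

theorem exists_QE {K : Type u} [Field K] [NumberField K] {a : K} (ha : ¬ IsSquare a) :
    ∃ (L : Type u) (_ : Field L) (_ : NumberField L) (_ : Algebra K L), Nonempty (QE K L a) := by
  classical
  let p : Polynomial K := Polynomial.X ^ 2 - Polynomial.C a
  have hp : Irreducible p := by
    refine X_pow_sub_C_irreducible_of_prime Nat.prime_two fun b hb => ha ⟨b, by rw [← hb, sq]⟩
  have hm : p.Monic := Polynomial.monic_X_pow_sub_C a two_ne_zero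
  have hd : p.natDegree = 2 := Polynomial.natDegree_X_pow_sub_C
  haveI : Fact (Irreducible p) := ⟨hp⟩
  haveI : FiniteDimensional K (AdjoinRoot p) := hm.finite_adjoinRoot
  haveI : CharZero (AdjoinRoot p) := charZero_of_injective_algebraMap (algebraMap K (AdjoinRoot p)).injective
  haveI : NumberField (AdjoinRoot p) := @NumberField.mk _ _ inferInstance (FiniteDimensional.trans ℚ K (AdjoinRoot p))
  have hs : (AdjoinRoot.root p) ^ 2 = algebraMap K (AdjoinRoot p) a := by
    have := AdjoinRoot.eval₂_root p
    simp only [p, Polynomial.eval₂_sub, Polynomial.eval₂_pow, Polynomial.eval₂_X, Polynomial.eval₂_C] at this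
    exact sub_eq_zero.1 this
  let σ0 : AdjoinRoot p →ₐ[K] AdjoinRoot p := AdjoinRoot.liftAlgHom p (Algebra.ofId K _) (-AdjoinRoot.root p) (by
    simp only [p, Polynomial.eval₂_sub, Polynomial.eval₂_pow, Polynomial.eval₂_X, Polynomial.eval₂_C, neg_sq, hs]
    simp [Algebra.ofId_apply])
  have hσ0 : σ0 (AdjoinRoot.root p) = - AdjoinRoot.root p := by
    simp [σ0]
  let σ : AdjoinRoot p ≃ₐ[K] AdjoinRoot p := AlgEquiv.ofAlgHom σ0 σ0
    (AdjoinRoot.algHom_ext (by simp [hσ0])) (AdjoinRoot.algHom_ext (by simp [hσ0]))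
  refine ⟨AdjoinRoot p, inferInstance, inferInstance, inferInstance, ⟨⟨AdjoinRoot.root p, hs, ?_, σ.toRingEquiv,
    fun x => σ.commutes x, hσ0, ha⟩⟩⟩
  intro z
  obtain ⟨q, rfl⟩ := AdjoinRoot.mk_surjective z
  have h1 : AdjoinRoot.mk p q = AdjoinRoot.mk p (q %ₘ p) := by
    conv_lhs => rw [← Polynomial.modByMonic_add_div q p]
    simp
  have h2 : (q %ₘ p).natDegree < 2 := by
    have := Polynomial.natDegree_modByMonic_lt q hm (by intro h; rw [h] at hd; simp at hd)
    omega
  obtain ⟨c, d, hcd⟩ := Polynomial.exists_eq_X_add_C_of_natDegree_le_one (p := q %ₘ p) (by omega)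
  refine ⟨d, c, ?_⟩
  rw [h1, hcd]
  simp only [map_add, map_mul, AdjoinRoot.mk_X, AdjoinRoot.mk_C]
  rw [add_comm]; rfl

section qe
variable {K L : Type*} [Field K] [NumberField K] [Field L] [NumberField L] [Algebra K L] {a : K}

namespace QE
variable (E : QE K L a)

theorem a_ne (E : QE K L a) : a ≠ 0 := by rintro rfl; exact E.ns ⟨0, by simp⟩

theorem s_ne : E.s ≠ 0 := by
  intro h
  have := E.hs
  rw [h] at this
  exact E.a_ne (by simpa using this.symm)

theorem norm_ne (E : QE K L a) {x y : K} (h : x ^ 2 - a * y ^ 2 = 0) : x = 0 ∧ y = 0 := by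
  by_cases hy : y = 0
  · subst hy; simpa using h
  · exact absurd ⟨x / y, by field_simp; linear_combination - h⟩ E.ns

theorem σ_lin (x y : K) : E.σ (algebraMap K L x + algebraMap K L y * E.s) =
    algebraMap K L x - algebraMap K L y * E.s := by
  rw [map_add, map_mul, E.hσ, E.hσ, E.σs]; ring

theorem σσ (z : L) : E.σ (E.σ z) = z := by
  obtain ⟨x, y, rfl⟩ := E.span z
  rw [E.σ_lin, map_sub, map_mul, E.hσ, E.hσ, E.σs]; ring

theorem mul_lin (x y : K) : (algebraMap K L x + algebraMap K L y * E.s) * (algebraMap K L x - algebraMap K L y * E.s)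
    = algebraMap K L (x ^ 2 - a * y ^ 2) := by
  simp only [map_sub, map_mul, map_pow, ← E.hs]; ring

theorem fixed {z : L} (h : E.σ z = z) : ∃ x, z = algebraMap K L x := by
  obtain ⟨x, y, rfl⟩ := E.span z
  rw [E.σ_lin] at h
  have h1 : 2 * (algebraMap K L y * E.s) = 0 := by linear_combination - h
  have h2 : algebraMap K L y * E.s = 0 := by simpa using h1
  exact ⟨x, by rw [h2, add_zero]⟩

theorem lin_inj {x y : K} (h : algebraMap K L x + algebraMap K L y * E.s = 0) : x = 0 ∧ y = 0 := by
  apply E.norm_ne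
  have := E.mul_lin x y
  rw [h, zero_mul] at this
  apply (algebraMap K L).injective
  rw [← this, map_zero]

theorem exists_norm (z : L) : ∃ n : K, algebraMap K L n = z * E.σ z := by
  obtain ⟨x, y, rfl⟩ := E.span z
  exact ⟨x ^ 2 - a * y ^ 2, by rw [E.σ_lin, E.mul_lin]⟩

/-- norm -/
noncomputable def N : L →* K where
  toFun z := (E.exists_norm z).choose
  map_one' := by
    apply (algebraMap K L).injective
    rw [(E.exists_norm 1).choose_spec]; simp
  map_mul' x y := by
    apply (algebraMap K L).injective
    have h1 := (E.exists_norm (x * y)).choose_spec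
    have h2 := (E.exists_norm x).choose_spec
    have h3 := (E.exists_norm y).choose_spec
    rw [map_mul (algebraMap K L), h1, h2, h3, map_mul]
    ring

theorem N_spec (z : L) : algebraMap K L (E.N z) = z * E.σ z := (E.exists_norm z).choose_spec

theorem N_lin (x y : K) : E.N (algebraMap K L x + algebraMap K L y * E.s) = x ^ 2 - a * y ^ 2 := by
  apply (algebraMap K L).injective
  rw [E.N_spec, E.σ_lin, E.mul_lin]

theorem N_map (x : K) : E.N (algebraMap K L x) = x ^ 2 := by
  have := E.N_lin x 0
  simpa using this

theorem N_ne {z : L} (hz : z ≠ 0) : E.N z ≠ 0 := by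
  intro h
  have := E.N_spec z
  rw [h, map_zero] at this
  have := this.symm
  rw [mul_eq_zero] at this
  rcases this with h | h
  · exact hz h
  · exact hz (by simpa using h)

theorem N_form (z : L) : ∃ x y : K, z = algebraMap K L x + algebraMap K L y * E.s ∧ E.N z = x ^ 2 - a * y ^ 2 := by
  obtain ⟨x, y, rfl⟩ := E.span z
  exact ⟨x, y, rfl, E.N_lin x y⟩

theorem N_nm (z : L) (v : Place K) : Nm v a (E.N z) := by
  obtain ⟨x, y, h, h1⟩ := E.N_form z
  rw [h1]
  exact nm_norm

/-- conjugate place -/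
noncomputable def conj (w : Place L) : Place L := pb (E.σ : L →+* L) w

theorem ord_conj (w : FP L) (z : L) : ord w (E.σ z) = ord (below (E.σ : L →+* L) w) z := by
  obtain ⟨e, he, h⟩ := ord_below (E.σ : L →+* L) w
  obtain ⟨y, hy, h1⟩ := exists_ord w 1
  have h2 := h (E.σ y)
  have h3 : (E.σ : L →+* L) (E.σ y) = y := E.σσ y
  rw [h3, h1] at h2
  have h4 : (e : ℤ) = 1 := by
    have h5 : (e : ℤ) ∣ 1 := ⟨_, h2⟩
    exact Int.eq_one_of_dvd_one (by positivity) h5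
  have := h z
  rw [h4, one_mul] at this
  exact this

theorem below_conj (w : FP L) : below (algebraMap K L) (below (E.σ : L →+* L) w) = below (algebraMap K L) w := by
  obtain ⟨e, he, h⟩ := ord_below (algebraMap K L) w
  apply below_eq
  intro x hx
  rw [← E.ord_conj, E.hσ, h]
  exact mul_ne_zero (by positivity) hx

theorem pb_conj (w : Place L) : pb (algebraMap K L) (E.conj w) = pb (algebraMap K L) w := by
  rcases w with w | w
  · simp only [conj, pb]; rw [E.below_conj]
  · simp only [conj, pb]
    congr 1
    ext x
    simp only [InfinitePlace.comap_apply]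
    have := E.hσ x
    exact congrArg w this

theorem av_conj {w : Place L} (h : E.conj w = w) (z : L) : av w (E.σ z) = av w z := by
  rcases w with w | w
  · by_cases hz : z = 0
    · subst hz; simp
    simp only [conj, pb, Sum.inl.injEq] at h
    rw [av_eq hz, av_eq (by simpa using hz), E.ord_conj, h]
  · simp only [conj, pb, Sum.inr.injEq] at h
    conv_rhs => rw [← h]
    rfl

theorem conj_ne {w : Place L} (h : Sq (pb (algebraMap K L) w) a) : E.conj w ≠ w := by
  intro hc
  have h0 : 0 < av w (2 * E.s) := (av w).pos (mul_ne_zero two_ne_zero E.s_ne)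
  obtain ⟨δ, hδ, h1⟩ := up_small (algebraMap K L) w (ε := (av w (2 * E.s) / 2) ^ 2) (by positivity)
  obtain ⟨x, hx⟩ := h δ hδ
  have h2 := h1 _ hx
  have h3 : algebraMap K L (x ^ 2 - a) = (algebraMap K L x + E.s) * (algebraMap K L x - E.s) := by
    rw [map_sub, map_pow, ← E.hs]; ring
  have h4 : E.σ (algebraMap K L x + E.s) = algebraMap K L x - E.s := by
    rw [map_add, E.hσ, E.σs]; ring
  have h5 := E.av_conj hc (algebraMap K L x + E.s)
  rw [h4] at h5
  rw [h3, map_mul, h5, ← sq] at h2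
  have h6 := lt_of_pow_lt_pow_left₀ 2 (by positivity) h2
  have h7 : av w (2 * E.s) ≤ av w (algebraMap K L x + E.s) + av w (algebraMap K L x - E.s) := by
    have : 2 * E.s = (algebraMap K L x + E.s) + - (algebraMap K L x - E.s) := by ring
    rw [this, ← (av w).map_neg (algebraMap K L x - E.s)]
    exact (av w).add_le _ _
  rw [h5] at h7
  linarith

/-- counting places above -/
theorem card_above (E : QE K L a) (S : Finset (FP K)) [DecidablePred fun v : Place K => Sq v a] :
    (Pl S).card + ((Pl S).filter fun v => Sq v a).card ≤ (Pl (SL (algebraMap K L) S)).card := by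
  classical
  have h1 : (Pl (SL (algebraMap K L) S)).card = ∑ v ∈ Pl S,
      ((Pl (SL (algebraMap K L) S)).filter fun w => pb (algebraMap K L) w = v).card :=
    Finset.card_eq_sum_card_fiberwise fun w hw => mem_Pl_SL.1 hw
  rw [h1, Finset.card_eq_sum_ones (Pl S), Finset.card_filter, ← Finset.sum_add_distrib]
  apply Finset.sum_le_sum
  intro v hv
  obtain ⟨w, rfl⟩ := exists_pabove (algebraMap K L) v
  split_ifs with hsq
  · have := E.conj_ne hsq
    have h2 : ({E.conj w, w} : Finset (Place L)).card = 2 := Finset.card_pair this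
    rw [show 1 + 1 = 2 from rfl, ← h2]
    apply Finset.card_le_card
    intro u hu
    rw [Finset.mem_insert, Finset.mem_singleton] at hu
    rw [Finset.mem_filter, mem_Pl_SL]
    rcases hu with rfl | rfl
    · rw [E.pb_conj]; exact ⟨hv, rfl⟩
    · exact ⟨hv, rfl⟩
  · simp only [add_zero]
    apply Finset.card_pos.2
    exact ⟨w, by rw [Finset.mem_filter, mem_Pl_SL]; exact ⟨hv, rfl⟩⟩

end QE
end qe
end ADQ

namespace ADQ
open NumberField IsDedekindDomain WithZero

theorem index_le_of_inj {G X : Type*} [Group G] [Finite X] (B : Subgroup G) (φ : G → X)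
    (h : ∀ x y, φ x = φ y → x⁻¹ * y ∈ B) : B.index ≠ 0 ∧ B.index ≤ Nat.card X := by
  have hi : Function.Injective (fun q : G ⧸ B => φ q.out) := by
    intro q r hqr
    have := h _ _ hqr
    rw [← QuotientGroup.eq, QuotientGroup.out_eq', QuotientGroup.out_eq'] at this
    exact this
  have hf : Finite (G ⧸ B) := Finite.of_injective _ hi
  exact ⟨Subgroup.index_ne_zero_of_finite, Nat.card_le_card_of_injective _ hi⟩

theorem le_index_of_surj {G X : Type*} [Group G] (B : Subgroup G) (hB : B.index ≠ 0) (φ : G → X)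
    (hs : Function.Surjective φ) (h : ∀ x y, x⁻¹ * y ∈ B → φ x = φ y) : Nat.card X ≤ B.index := by
  have hf : Finite (G ⧸ B) := by
    have : B.FiniteIndex := ⟨hB⟩
    exact Subgroup.finite_quotient_of_finiteIndex
  refine Nat.card_le_card_of_surjective (fun q : G ⧸ B => φ q.out) fun x => ?_
  obtain ⟨g, rfl⟩ := hs x
  refine ⟨(g : G ⧸ B), h _ _ ?_⟩
  rw [← QuotientGroup.eq, QuotientGroup.out_eq']

theorem finrank_ker_ge {G H : Type*} [CommGroup G] [CommGroup H] (f : G →* H)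
    [Module.Finite ℤ (Additive G)] [Module.Finite ℤ (Additive H)] :
    Module.finrank ℤ (Additive G) ≤ Module.finrank ℤ (Additive f.ker) + Module.finrank ℤ (Additive H) := by
  let F : Additive G →ₗ[ℤ] Additive H := (MonoidHom.toAdditive f).toIntLinearMap
  have h0 := Submodule.finrank_quotient_add_finrank (LinearMap.ker F)
  rw [F.quotKerEquivRange.finrank_eq] at h0
  have h1 : Module.finrank ℤ (LinearMap.range F) ≤ Module.finrank ℤ (Additive H) := Submodule.finrank_le _
  let e : LinearMap.ker F ≃ₗ[ℤ] Additive f.ker := AddEquiv.toIntLinearEquiv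
    { toFun := fun x => Additive.ofMul ⟨Additive.toMul x.1, x.2⟩
      invFun := fun x => ⟨Additive.ofMul (Additive.toMul x).1, (Additive.toMul x).2⟩
      left_inv := fun x => rfl
      right_inv := fun x => rfl
      map_add' := fun x y => rfl }
  rw [e.finrank_eq] at h0
  omega

theorem fg_ker {G H : Type*} [CommGroup G] [CommGroup H] (f : G →* H)
    [Module.Finite ℤ (Additive G)] : Group.FG f.ker := by
  let F : Additive f.ker →ₗ[ℤ] Additive G := (MonoidHom.toAdditive f.ker.subtype).toIntLinearMap
  have : Function.Injective F := fun x y h => Subtype.ext h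
  have h1 : Module.Finite ℤ (Additive f.ker) := Module.Finite.of_injective F this
  have h2 := Module.Finite.iff_addGroup_fg.1 h1
  rw [Group.fg_iff_monoid_fg, Monoid.fg_iff_add_fg, ← AddGroup.fg_iff_addMonoid_fg]
  exact h2

section qe
variable {K L : Type*} [Field K] [NumberField K] [Field L] [NumberField L] [Algebra K L] {a : K}

namespace QE
variable (E : QE K L a)

theorem ord_N (w : FP L) {z : L} (hz : z ≠ 0) : ∃ e : ℕ, 1 ≤ e ∧
    (∀ x, ord w (algebraMap K L x) = e * ord (below (algebraMap K L) w) x) ∧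
    e * ord (below (algebraMap K L) w) (E.N z) = ord w z + ord w (E.σ z) := by
  obtain ⟨e, he, h⟩ := ord_below (algebraMap K L) w
  refine ⟨e, he, h, ?_⟩
  rw [← h, E.N_spec, ord_mul w hz (by simpa using hz)]

/-- norms of S-units -/
noncomputable def NSU (S : Finset (FP K)) : Subgroup Kˣ := (SU (SL (algebraMap K L) S)).map (Units.map E.N)

theorem mem_NSU {S : Finset (FP K)} {x : Kˣ} : x ∈ E.NSU S ↔
    ∃ z ∈ SU (SL (algebraMap K L) S), E.N (z : L) = x := by
  rw [NSU, Subgroup.mem_map]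
  constructor
  · rintro ⟨z, hz, rfl⟩; exact ⟨z, hz, rfl⟩
  · rintro ⟨z, hz, h⟩; exact ⟨z, hz, Units.ext h⟩

theorem N_mem {S : Finset (FP K)} {z : Lˣ} (hz : z ∈ SU (SL (algebraMap K L) S)) :
    Units.map E.N z ∈ SU S := by
  intro v hv
  obtain ⟨w, rfl⟩ := exists_above (algebraMap K L) v
  obtain ⟨e, he, h, h1⟩ := E.ord_N w z.ne_zero
  have h2 : ord w (z : L) = 0 := hz w (by rwa [mem_SL])
  have h3 : ord w (E.σ z) = 0 := by
    rw [E.ord_conj]; exact hz _ (by rwa [mem_SL, E.below_conj])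
  rw [h2, h3, add_zero] at h1
  have h4 : (e : ℤ) ≠ 0 := by positivity
  exact (mul_eq_zero.1 h1).resolve_left h4

theorem NSU_le (S : Finset (FP K)) : E.NSU S ≤ SU S := by
  rintro x ⟨z, hz, rfl⟩
  exact E.N_mem hz

theorem map_mem {S : Finset (FP K)} {x : Kˣ} (hx : x ∈ SU S) :
    Units.map (algebraMap K L : K →* L) x ∈ SU (SL (algebraMap K L) S) := by
  intro w hw
  obtain ⟨e, he, h⟩ := ord_below (algebraMap K L) w
  change ord w (algebraMap K L x) = 0
  rw [h, hx _ (by rwa [mem_SL] at hw), mul_zero]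

theorem σ_mem {S : Finset (FP K)} {z : Lˣ} (hz : z ∈ SU (SL (algebraMap K L) S)) :
    Units.map (E.σ : L →* L) z ∈ SU (SL (algebraMap K L) S) := by
  intro w hw
  change ord w (E.σ z) = 0
  rw [E.ord_conj]
  apply hz
  rw [mem_SL] at *
  rwa [E.below_conj]

noncomputable def NU (S : Finset (FP K)) : SU (SL (algebraMap K L) S) →* SU S :=
  ((Units.map E.N).comp (Subgroup.subtype _)).codRestrict (SU S) fun z => E.N_mem z.2

noncomputable def iU (S : Finset (FP K)) : SU S →* SU (SL (algebraMap K L) S) :=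
  ((Units.map (algebraMap K L : K →* L)).comp (Subgroup.subtype _)).codRestrict _ fun z => map_mem z.2

noncomputable def σU (S : Finset (FP K)) : SU (SL (algebraMap K L) S) →* SU (SL (algebraMap K L) S) :=
  ((Units.map (E.σ : L →* L)).comp (Subgroup.subtype _)).codRestrict _ fun z => E.σ_mem z.2

theorem NU_coe {S : Finset (FP K)} (z : SU (SL (algebraMap K L) S)) : (((E.NU S z : Kˣ)) : K) = E.N (z.1 : L) := rfl
theorem iU_coe {S : Finset (FP K)} (z : SU S) : (((iU (L := L) S z : Lˣ)) : L) = algebraMap K L (z.1 : K) := rfl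
theorem σU_coe {S : Finset (FP K)} (z : SU (SL (algebraMap K L) S)) : (((E.σU S z : Lˣ)) : L) = E.σ (z.1 : L) := rfl

theorem herb (S : Finset (FP K)) : (E.NU S).range.index * (((E.NU S).ker.map (powMonoidHom 2)).relIndex (E.NU S).ker)
      = ((MonoidHom.id _ / E.σU S).range.relIndex (E.NU S).ker) * (sqr (SU S)).index := by
  apply herbrand (E.NU S) (iU S) (E.σU S)
  · intro u
    apply Subtype.ext; apply Units.ext
    rw [iU_coe, NU_coe, E.N_spec]; rfl
  · intro h
    apply Subtype.ext; apply Units.ext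
    rw [NU_coe, iU_coe, E.N_map]; rfl
  · intro x y h
    apply Subtype.ext; apply Units.ext
    apply (algebraMap K L).injective
    rw [← iU_coe, ← iU_coe, h]
  · intro u
    constructor
    · intro h
      have h1 : E.σ (u.1 : L) = u.1 := by rw [← σU_coe, h]
      obtain ⟨x, hx⟩ := E.fixed h1
      have hx0 : x ≠ 0 := by rintro rfl; exact u.1.ne_zero (by simpa using hx)
      refine ⟨⟨Units.mk0 x hx0, ?_⟩, ?_⟩
      · intro v hv
        obtain ⟨w, rfl⟩ := exists_above (algebraMap K L) v
        obtain ⟨e, he, h⟩ := ord_below (algebraMap K L) w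
        have h2 := u.2 w (by rwa [mem_SL])
        rw [hx, h] at h2
        have h4 : (e : ℤ) ≠ 0 := by positivity
        exact (mul_eq_zero.1 h2).resolve_left h4
      · apply Subtype.ext; apply Units.ext
        rw [iU_coe]; exact hx.symm
    · rintro ⟨x, rfl⟩
      apply Subtype.ext; apply Units.ext
      rw [σU_coe, iU_coe, E.hσ]
  · intro u
    apply Subtype.ext; apply Units.ext
    rw [σU_coe, σU_coe, E.σσ]

theorem card_ker2 (S : Finset (FP K)) : Nat.card (powMonoidHom 2 : (E.NU S).ker →* (E.NU S).ker).ker = 2 := by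
  have hm : (-1 : Lˣ) ∈ SU (SL (algebraMap K L) S) := neg_one_mem_SU _
  have hk : (⟨-1, hm⟩ : SU (SL (algebraMap K L) S)) ∈ (E.NU S).ker := by
    rw [MonoidHom.mem_ker]
    apply Subtype.ext; apply Units.ext
    rw [NU_coe]
    have := E.N_map (-1)
    simpa using this
  have hne : (1 : Lˣ) ≠ -1 := by
    intro h
    have := congrArg Units.val h
    simp only [Units.val_one, Units.val_neg] at this
    apply (two_ne_zero : (2 : L) ≠ 0); linear_combination this
  rw [Nat.card_eq_two_iff]
  refine ⟨1, ⟨⟨⟨-1, hm⟩, hk⟩, ?_⟩, ?_, ?_⟩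
  · rw [MonoidHom.mem_ker]
    apply Subtype.ext; apply Subtype.ext; apply Units.ext
    change ((-1 : Lˣ) ^ 2 : Lˣ) = (1 : L)
    simp
  · intro h
    exact hne (congrArg Subtype.val (congrArg Subtype.val (congrArg Subtype.val h)))
  · ext ⟨⟨⟨x, hx⟩, hx1⟩, hx2⟩
    simp only [Set.mem_insert_iff, Set.mem_singleton_iff, Set.mem_univ, iff_true]
    rw [MonoidHom.mem_ker] at hx2
    have h1 : x ^ 2 = 1 := congrArg Subtype.val (congrArg Subtype.val hx2)
    have h2 : (x : L) ^ 2 = 1 := by rw [← Units.val_pow_eq_pow_val, h1]; rfl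
    rcases (show (x : L) = 1 ∨ (x : L) = -1 by simpa using h2) with h | h
    · left; apply Subtype.ext; apply Subtype.ext; apply Subtype.ext; apply Units.ext; exact h
    · right; apply Subtype.ext; apply Subtype.ext; apply Subtype.ext; apply Units.ext; simpa using h

theorem range_eq (S : Finset (FP K)) : (E.NU S).range = (E.NSU S).subgroupOf (SU S) := by
  ext x
  rw [Subgroup.mem_subgroupOf, mem_NSU]
  constructor
  · rintro ⟨z, rfl⟩; exact ⟨z.1, z.2, rfl⟩
  · rintro ⟨z, hz, h⟩; exact ⟨⟨z, hz⟩, by apply Subtype.ext; apply Units.ext; exact h⟩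

theorem relIndex_ne (S : Finset (FP K)) : (E.NSU S).relIndex (SU S) ≠ 0 := by
  have h1 : (sqr (SU S)).index ≠ 0 := by rw [index_SU]; positivity
  rw [Subgroup.relIndex, ← range_eq]
  refine fun h => h1 (Nat.eq_zero_of_zero_dvd ?_)
  rw [← h]
  apply Subgroup.index_dvd_of_le
  rintro _ ⟨x, rfl⟩
  refine ⟨iU S x, ?_⟩
  apply Subtype.ext; apply Units.ext
  rw [NU_coe, iU_coe, E.N_map]; rfl

theorem index_ineq (S : Finset (FP K)) [DecidablePred fun v : Place K => Sq v a] :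
    (E.NSU S).relIndex (SU S) * 2 ≤ ((MonoidHom.id _ / E.σU S).range.relIndex (E.NU S).ker) *
      2 ^ ((Pl S).filter fun v => ¬ Sq v a).card := by
  have h := E.herb S
  have hA : ((E.NU S).ker.map (powMonoidHom 2)).relIndex (E.NU S).ker = (sqr (E.NU S).ker).index := by
    rw [Subgroup.relIndex]
    congr 1
    ext x
    rw [Subgroup.mem_subgroupOf, Subgroup.mem_map]
    constructor
    · rintro ⟨y, hy, h⟩; exact ⟨⟨y, hy⟩, Subtype.ext h⟩
    · rintro ⟨y, rfl⟩; exact ⟨y.1, y.2, rfl⟩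
  have i1 := finite_SU S
  have i2 := finite_SU (SL (algebraMap K L) S)
  have i3 := fg_ker (E.NU S)
  have h1 := finrank_ker_ge (E.NU S)
  rw [hA, index_sq_fg, card_ker2, index_SU, range_eq] at h
  rw [finrank_SU, finrank_SU] at h1
  have c1 := card_Pl S
  have c2 := card_Pl (SL (algebraMap K L) S)
  have c3 := E.card_above S
  have c4 := Finset.card_filter_add_card_filter_not (s := Pl S) (fun v : Place K => Sq v a)
  have p1 : 0 < Fintype.card (InfinitePlace K) := Fintype.card_pos
  have p2 : 0 < Fintype.card (InfinitePlace L) := Fintype.card_pos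
  rw [Units.rank, Units.rank] at h1
  set r := Module.finrank ℤ (Additive (E.NU S).ker)
  set h0 := ((MonoidHom.id _ / E.σU S).range.relIndex (E.NU S).ker)
  set k := ((Pl S).filter fun v => ¬ Sq v a).card
  set j := ((Pl S).filter fun v => Sq v a).card
  change (E.NSU S).relIndex (SU S) * _ = _ at h
  set n := (E.NSU S).relIndex (SU S)
  have h2 : j ≤ r := by omega
  have h3 : S.card + Fintype.card (InfinitePlace K) = j + k := by omega
  have h4 : (n * 2) * 2 ^ j ≤ (h0 * 2 ^ k) * 2 ^ j := by
    calc (n * 2) * 2 ^ j ≤ (n * 2) * 2 ^ r := by gcongr; norm_num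
      _ = h0 * 2 ^ (j + k) := by rw [← h3, ← h]; ring
      _ = _ := by rw [pow_add]; ring
  exact Nat.le_of_mul_le_mul_right h4 (by positivity)

theorem hilbert90 {y : L} (h : y * E.σ y = 1) : ∃ z, z ≠ 0 ∧ z = y * E.σ z := by
  by_cases hy : y = -1
  · refine ⟨E.s, E.s_ne, ?_⟩
    rw [hy, E.σs]; ring
  · refine ⟨1 + y, ?_, ?_⟩
    · intro h1; exact hy (by linear_combination h1)
    · rw [map_add, map_one]; linear_combination - h

theorem even_ord {w : FP L} {z : L} (hz : z ≠ 0) (hv : ord (below (algebraMap K L) w) (2 : K) = 0)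
    (ha : Even (ord (below (algebraMap K L) w) a)) (h : ord w z = ord w (E.σ z)) :
    Even (ord (below (algebraMap K L) w) (E.N z)) := by
  obtain ⟨e, he, h1, h2⟩ := E.ord_N w hz
  set v := below (algebraMap K L) w
  have he0 : (e : ℤ) ≠ 0 := by positivity
  obtain ⟨x, t, rfl⟩ := E.span z
  rw [E.σ_lin] at h h2
  rw [← h] at h2
  set z := algebraMap K L x + algebraMap K L t * E.s
  have hw2 : ord w (2 : L) = 0 := by
    have := h1 2
    rw [hv, mul_zero, map_ofNat] at this
    exact this
  have hz' : algebraMap K L x - algebraMap K L t * E.s ≠ 0 := by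
    rw [← E.σ_lin]; exact (map_ne_zero E.σ).2 hz
  have g1 : GE w (ord w z) z := ge_ord _
  have g2 : GE w (ord w z) (algebraMap K L x - algebraMap K L t * E.s) := by rw [h]; exact ge_ord _
  have half : ∀ u : L, GE w (ord w z) (2 * u) → GE w (ord w z) u := by
    intro u hu
    by_cases hu0 : u = 0
    · rw [hu0]; exact GE.zero
    rw [ge_iff (mul_ne_zero two_ne_zero hu0), ord_mul w two_ne_zero hu0, hw2, zero_add] at hu
    rwa [ge_iff hu0]
  have gx := half (algebraMap K L x) (by
    have := g1.add g2
    rwa [show z + (algebraMap K L x - algebraMap K L t * E.s) = 2 * algebraMap K L x by simp only [z]; ring] at this)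
  have gt := half (algebraMap K L t * E.s) (by
    have := g1.sub g2
    rwa [show z - (algebraMap K L x - algebraMap K L t * E.s) = 2 * (algebraMap K L t * E.s) by simp only [z]; ring] at this)
  by_cases c1 : GE w (ord w z + 1) (algebraMap K L x)
  · by_cases c2 : GE w (ord w z + 1) (algebraMap K L t * E.s)
    · have := c1.add c2
      rw [ge_iff hz] at this
      omega
    · have ht0 : algebraMap K L t * E.s ≠ 0 := by intro h; rw [h] at c2; exact c2 GE.zero
      have ht : t ≠ 0 := by rintro rfl; simp at ht0
      rw [ge_iff ht0] at gt c2
      have e1 : ord w (algebraMap K L t * E.s) = ord w z := by omega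
      have e2 : ord w (algebraMap K L (t ^ 2 * a)) = 2 * ord w z := by
        rw [← e1, ← ord_sq w ht0, map_mul, map_pow, ← E.hs, mul_pow]
      rw [h1, ord_mul v (pow_ne_zero _ ht) E.a_ne, ord_sq v ht] at e2
      have e3 : (e : ℤ) * ord v (E.N z) = e * (2 * ord v t + ord v a) := by rw [h2, e2]; ring
      rw [mul_left_cancel₀ he0 e3]
      exact (even_two_mul _).add ha
  · have hx0 : algebraMap K L x ≠ 0 := by intro h; rw [h] at c1; exact c1 GE.zero
    rw [ge_iff hx0] at gx c1
    have e1 : ord w (algebraMap K L x) = ord w z := by omega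
    rw [h1] at e1
    have e3 : (e : ℤ) * ord v (E.N z) = e * (2 * ord v x) := by rw [h2, ← e1]; ring
    rw [mul_left_cancel₀ he0 e3]
    exact even_two_mul _

theorem ker_claim {S : Finset (FP K)} (hS : PS S) {z : L} (hz : z ≠ 0)
    (h : ∀ w ∉ SL (algebraMap K L) S, ord w z = ord w (E.σ z))
    (he : ∀ v ∉ S, Even (ord v (E.N z))) : ∃ u ∈ SU (SL (algebraMap K L) S), ∃ c : K, c ≠ 0 ∧
      z = u * algebraMap K L c := by
  obtain ⟨c, hc, h1⟩ := hS.exists_ord (fun v => ord v (E.N z) / 2) (by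
    refine (support_finite (E.N_ne hz)).subset ?_
    rintro v ⟨_, h2⟩ h3
    exact h2 (by rw [h3]; rfl))
  have hc' : algebraMap K L c ≠ 0 := by simpa using hc
  refine ⟨Units.mk0 (z / algebraMap K L c) (div_ne_zero hz hc'), ?_, c, hc, ?_⟩
  · intro w hw
    obtain ⟨e, he', h2, h3⟩ := E.ord_N w hz
    rw [← h w hw] at h3
    have hb : below (algebraMap K L) w ∉ S := by rwa [mem_SL] at hw
    rw [Units.val_mk0, ord_div w hz hc', h2, h1 _ hb]
    obtain ⟨m, hm⟩ := he _ hb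
    rw [hm] at h3 ⊢
    have : (m + m) / 2 = m := by omega
    rw [this]
    linarith
  · rw [Units.val_mk0]; field_simp

theorem h1_bound {S T : Finset (FP K)} (hS : PS S) (h2 : ∀ v ∉ S, ord v (2 : K) = 0)
    (hT : ∀ v ∉ S, v ∉ T → Even (ord v a)) :
    ((MonoidHom.id _ / E.σU S).range.relIndex (E.NU S).ker) ≤ 2 ^ T.card := by
  have key : ∀ y : (E.NU S).ker, ∃ z : L, z ≠ 0 ∧ z = ((y.1 : Lˣ) : L) * E.σ z := by
    intro y
    apply E.hilbert90
    have := y.2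
    rw [MonoidHom.mem_ker] at this
    rw [← E.N_spec, ← E.NU_coe, this]
    simp
  choose z hz0 hz using key
  have := (index_le_of_inj ((MonoidHom.id _ / E.σU S).range.subgroupOf (E.NU S).ker)
    (fun y => fun v : T => decide (Even (ord v.1 (E.N (z y))))) ?_).2
  · rw [Subgroup.relIndex]
    rw [Nat.card_fun, Nat.card_eq_two_iff.2 ⟨true, false, by simp, by ext b; cases b <;> simp⟩] at this
    simpa using this
  intro x y hxy
  have hev : ∀ v ∈ T, (Even (ord v (E.N (z x))) ↔ Even (ord v (E.N (z y)))) := by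
    intro v hv
    have := congrFun hxy ⟨v, hv⟩
    simpa using this
  have hσ0 : ∀ y, E.σ (z y) ≠ 0 := fun y => by simpa using hz0 y
  have hval : ∀ y w, w ∉ SL (algebraMap K L) S → ord w (z y) = ord w (E.σ (z y)) := by
    intro y w hw
    have h3 : ord w ((y.1 : Lˣ) : L) = 0 := y.1.2 w hw
    conv_lhs => rw [hz y]
    rw [ord_mul w (Units.ne_zero _) (hσ0 y), h3, zero_add]
  obtain ⟨u, hu, c, hc, huc⟩ := E.ker_claim hS (z := z y / z x) (div_ne_zero (hz0 _) (hz0 _)) (by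
      intro w hw
      rw [map_div₀, ord_div w (hz0 y) (hz0 x), ord_div w (hσ0 y) (hσ0 x), hval y w hw, hval x w hw]) (by
      intro v hv
      have e1 : E.N (z y / z x) = E.N (z y) / E.N (z x) := by
        rw [eq_div_iff (E.N_ne (hz0 x)), ← map_mul, div_mul_cancel₀ _ (hz0 x)]
      rw [e1, ord_div v (E.N_ne (hz0 _)) (E.N_ne (hz0 _))]
      by_cases hvT : v ∈ T
      · rw [Int.even_sub]; exact (hev v hvT).symm
      · obtain ⟨w, rfl⟩ := exists_above (algebraMap K L) v
        have hw : w ∉ SL (algebraMap K L) S := by rwa [mem_SL]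
        exact (E.even_ord (hz0 _) (h2 _ hv) (hT _ hv hvT) (hval _ _ hw)).sub
          (E.even_ord (hz0 _) (h2 _ hv) (hT _ hv hvT) (hval _ _ hw)))
  rw [Subgroup.mem_subgroupOf]
  refine ⟨⟨u, hu⟩, ?_⟩
  apply Subtype.ext; apply Units.ext
  have hc' : algebraMap K L c ≠ 0 := by simpa using hc
  have e7 : (((((MonoidHom.id (SU (SL (algebraMap K L) S)) / E.σU S : SU (SL (algebraMap K L) S) →* SU (SL (algebraMap K L) S))) ⟨u, hu⟩ : SU (SL (algebraMap K L) S)) : Lˣ) : L) = (u : L) / E.σ u := by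
    rw [MonoidHom.div_apply, MonoidHom.id_apply, Subgroup.coe_div, Units.val_div_eq_div_val, σU_coe]
  rw [e7]
  change (u : L) / E.σ u = (((x.1 : Lˣ)⁻¹ * (y.1 : Lˣ) : Lˣ) : L)
  have e2 : E.σ (u : L) ≠ 0 := by simp
  have e3 : (((x.1 : Lˣ)⁻¹ * (y.1 : Lˣ) : Lˣ) : L) = ((y.1 : Lˣ) : L) / ((x.1 : Lˣ) : L) := by
    rw [Units.val_mul, Units.val_inv_eq_inv_val]; field_simp
  rw [e3, div_eq_div_iff e2 (Units.ne_zero _)]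
  have e4 := congrArg E.σ huc
  rw [map_div₀, map_mul, E.hσ] at e4
  have e5 : (u : L) = z y / z x / algebraMap K L c := by rw [huc]; field_simp
  have e6 : E.σ (u : L) = E.σ (z y) / E.σ (z x) / algebraMap K L c := by rw [e4]; field_simp
  rw [e6, e5, div_mul_eq_mul_div, mul_div_assoc', div_left_inj' hc', div_mul_eq_mul_div, mul_div_assoc',
    div_eq_div_iff (hz0 _) (hσ0 _)]
  calc _ = z y * (((x.1 : Lˣ) : L) * E.σ (z x)) := by ring
    _ = z y * z x := by rw [← hz x]
    _ = (((y.1 : Lˣ) : L) * E.σ (z y)) * z x := by rw [← hz y]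

theorem norm_index {S T : Finset (FP K)} (hS : PS S) (h2 : ∀ v ∉ S, ord v (2 : K) = 0)
    (hT : ∀ v ∉ S, v ∉ T → Even (ord v a)) [DecidablePred fun v : Place K => Sq v a] :
    (E.NSU S).relIndex (SU S) * 2 ≤ 2 ^ T.card * 2 ^ ((Pl S).filter fun v => ¬ Sq v a).card :=
  (E.index_ineq S).trans (Nat.mul_le_mul_right _ (E.h1_bound hS h2 hT))

end QE
end qe
end ADQ

namespace ADQ
open NumberField IsDedekindDomain WithZero

section
variable {K : Type*} [Field K] [NumberField K]

/-- support of an element -/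
noncomputable def supp (x : K) : Finset (FP K) := by
  classical exact if h : x = 0 then ∅ else (support_finite h).toFinset

theorem ord_of_supp {x : K} {v : FP K} (h : v ∉ supp x) : ord v x = 0 := by
  by_cases hx : x = 0
  · rw [hx, ord]; simp
  · simpa [supp, hx] using h

theorem card_bool_fun {X : Type*} (T : Finset X) : Nat.card (T → Bool) = 2 ^ T.card := by
  rw [Nat.card_fun, Nat.card_eq_two_iff.2 ⟨true, false, by simp, by ext b; cases b <;> simp⟩]
  simp

theorem odd_ram_sq {v : FP K} {a x y : K} (hv : ord v (2 : K) = 0) (ha0 : a ≠ 0) (ha : ¬ Even (ord v a))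
    (hn : x ^ 2 - a * y ^ 2 ≠ 0) (h : ord v (x ^ 2 - a * y ^ 2) = 0) : Sq (Sum.inl v) (x ^ 2 - a * y ^ 2) := by
  by_cases hy : y = 0
  · subst hy; simpa using LSq.sq (f := av (Sum.inl v)) x
  have h1 : ord v (a * y ^ 2) = ord v a + 2 * ord v y := by
    rw [ord_mul v ha0 (pow_ne_zero _ hy), ord_sq v hy]
  have hay : a * y ^ 2 ≠ 0 := mul_ne_zero ha0 (pow_ne_zero _ hy)
  rw [Int.even_iff] at ha
  by_cases hx : x = 0
  · exfalso
    subst hx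
    rw [show (0:K) ^ 2 - a * y ^ 2 = - (a * y ^ 2) by ring, ord_neg, h1] at h
    omega
  have h2 : ord v (x ^ 2) = 2 * ord v x := ord_sq v hx
  have hx2 : x ^ 2 ≠ 0 := pow_ne_zero _ hx
  rcases lt_or_gt_of_ne (show ord v (x ^ 2) ≠ ord v (a * y ^ 2) by omega) with hlt | hlt
  · have h3 := ord_eq_of_sub hx2 (y := x ^ 2 - a * y ^ 2) (v := v) (by
      rw [show x ^ 2 - a * y ^ 2 - x ^ 2 = - (a * y ^ 2) by ring]
      exact ((ge_iff hay).2 (by omega)).neg)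
    rw [h] at h3
    have h4 := odd_near (y := x ^ 2 - a * y ^ 2) hv hx2 h3.2.symm (by
      rw [show x ^ 2 - a * y ^ 2 - x ^ 2 = - (a * y ^ 2) by ring]
      exact ((ge_iff hay).2 (by omega)).neg)
    rw [mul_comm] at h4
    exact (LSq.mul_sq_iff hx).1 h4
  · exfalso
    have h3 := ord_eq_of_sub (neg_ne_zero.2 hay) (y := x ^ 2 - a * y ^ 2) (v := v) (by
      rw [show x ^ 2 - a * y ^ 2 - -(a * y ^ 2) = x ^ 2 by ring, ord_neg]
      exact ((ge_iff hx2).2 (by omega)))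
    rw [h, ord_neg] at h3
    omega

/-- independence of classes of S-units at a finite set -/
def Onto (S T : Finset (FP K)) : Prop := ∀ T' : FP K → Prop, ∃ u ∈ SU S, ∀ v ∈ T, (Sq (Sum.inl v) (u : K) ↔ T' v)

theorem sq_iff_of_mul {v : Place K} {x y : K} (hx : x ≠ 0) (hy : y ≠ 0) (h : Sq v (x⁻¹ * y)) : Sq v x ↔ Sq v y := by
  constructor
  · intro h1
    have := h1.mul h
    rwa [mul_inv_cancel_left₀ hx] at this
  · intro h1
    have h2 : Sq v (x⁻¹) := LSq.of_mul_right (f := av v) hy h1 h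
    simpa using h2.inv
end

theorem claimB {K : Type u} [Field K] [NumberField K] {a : K} {S T : Finset (FP K)} (hS : PS S)
    (h2 : ∀ v ∉ S, ord v (2 : K) = 0) (hsq : ∀ v ∈ Pl S, Sq v a) (ha0 : a ≠ 0)
    (hT : ∀ v ∉ S, v ∉ T → Even (ord v a)) (hT' : ∀ v ∈ T, v ∉ S)
    (hon : Onto S T) : IsSquare a := by
  classical
  by_contra hns
  obtain ⟨L, _, _, _, ⟨E⟩⟩ := exists_QE hns
  let T0 := T.filter fun v => ¬ Even (ord v a)
  have h1 := E.norm_index (T := T0) hS h2 (by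
    intro v hv hvT
    by_contra hc
    apply hvT
    rw [Finset.mem_filter]
    refine ⟨?_, hc⟩
    by_contra h
    exact hc (hT v hv h))
  rw [Finset.filter_false_of_mem (fun v hv => not_not.2 (hsq v hv)), Finset.card_empty, pow_zero, mul_one] at h1
  have h3 := le_index_of_surj ((E.NSU S).subgroupOf (SU S)) (E.relIndex_ne S)
    (fun u => fun v : T0 => decide (Sq (Sum.inl v.1) (u.1 : K))) ?_ ?_
  · rw [card_bool_fun] at h3
    change _ ≤ (E.NSU S).relIndex (SU S) at h3
    have := E.relIndex_ne S
    omega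
  · intro τ
    obtain ⟨u, hu, h⟩ := hon (fun v => ∃ h : v ∈ T0, τ ⟨v, h⟩ = true)
    refine ⟨⟨u, hu⟩, ?_⟩
    funext v
    have := h v.1 (Finset.mem_filter.1 v.2).1
    simp only [this]
    simp
  · intro x y hxy
    funext v
    rw [Subgroup.mem_subgroupOf, E.mem_NSU] at hxy
    obtain ⟨z, hz, hzN⟩ := hxy
    have hv := Finset.mem_filter.1 v.2
    have hvS := hT' _ hv.1
    have h4 : Sq (Sum.inl v.1) ((x.1 : K)⁻¹ * (y.1 : K)) := by
      have e1 : ((x⁻¹ * y : SU S).1 : K) = (x.1 : K)⁻¹ * (y.1 : K) := by simp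
      have h5 : ord v.1 (E.N (z : L)) = 0 := by
        rw [hzN]; exact (x⁻¹ * y).2 _ hvS
      rw [← e1, ← hzN]
      obtain ⟨p, q, _, h6⟩ := E.N_form (z : L)
      have h7 := E.N_ne z.ne_zero
      rw [h6] at h5 h7 ⊢
      exact odd_ram_sq (h2 _ hvS) ha0 hv.2 h7 h5
    simp only [decide_eq_decide]
    exact sq_iff_of_mul (Units.ne_zero _) (Units.ne_zero _) h4

section
variable {K L : Type*} [Field K] [NumberField K] [Field L] [NumberField L] [Algebra K L] {a : K}

theorem QE.adjust (E : QE K L a) {S : Finset (FP K)} (hL : PS (SL (algebraMap K L) S)) {x : K} (hx : x ≠ 0)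
    (h : ∀ v ∉ S, ord v x ≠ 0 → Sq (Sum.inl v) a) : ∃ z : L, z ≠ 0 ∧ ∀ v ∉ S, ord v (x / E.N z) = 0 := by
  classical
  choose w hw using exists_above (K := K) (algebraMap K L)
  obtain ⟨z, hz, h1⟩ := hL.exists_ord (fun u => if u = w (below (algebraMap K L) u) then
      ord (below (algebraMap K L) u) x else 0) (by
    refine (above_finite (algebraMap K L) (supp x)).subset ?_
    rintro u ⟨_, h2⟩
    change below _ u ∈ supp x
    by_contra hc
    apply h2
    rw [ord_of_supp hc]; simp)
  refine ⟨z, hz, fun v hv => ?_⟩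
  rw [ord_div v hx (E.N_ne hz)]
  obtain ⟨e, he, h2, h3⟩ := E.ord_N (w v) hz
  have hwv : w v ∉ SL (algebraMap K L) S := by rwa [mem_SL, hw]
  rw [E.ord_conj, h1 _ hwv, h1 (below (E.σ : L →+* L) (w v)) (by rwa [mem_SL, E.below_conj, hw]), E.below_conj, hw, if_pos rfl] at h3
  rw [hw] at h2
  by_cases h0 : ord v x = 0
  · rw [h0, ite_self, add_zero] at h3
    have h4 : (e : ℤ) ≠ 0 := by positivity
    rw [(mul_eq_zero.1 h3).resolve_left h4, h0, sub_zero]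
  · have hsq := h v hv h0
    have hne : below (E.σ : L →+* L) (w v) ≠ w v := by
      have := E.conj_ne (w := Sum.inl (w v)) (by simpa [pb, hw] using hsq)
      simpa [QE.conj, pb] using this
    rw [if_neg hne, add_zero] at h3
    -- ramification index one
    obtain ⟨y, hy, h5, h6⟩ := hL (w v) hwv
    obtain ⟨e', he', h2', h3'⟩ := E.ord_N (w v) hy
    rw [E.ord_conj, h5, h6 _ (by rwa [mem_SL, E.below_conj, hw]) hne, add_zero] at h3'
    have h7 : (e' : ℤ) = 1 := Int.eq_one_of_dvd_one (by positivity) ⟨_, h3'.symm⟩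
    have h8 : (e : ℤ) = e' := by
      obtain ⟨c, hc, hc1⟩ := exists_ord v 1
      have a1 := h2 c
      have a2 := h2' c
      rw [hw, hc1] at a2
      rw [hc1] at a1
      linarith
    rw [h8, h7, one_mul] at h3
    rw [h3, sub_self]
end

section
variable {K : Type*} [Field K] [NumberField K]

theorem nm_iff_of_mul {v : Place K} {a x y : K} (hx : x ≠ 0) (hy : y ≠ 0) (h : Nm v a (x⁻¹ * y)) : Nm v a x ↔ Nm v a y := by
  let X := Units.mk0 x hx
  let Y := Units.mk0 y hy
  have h1 : X⁻¹ * Y ∈ nmS v a := by rw [mem_nmS]; simpa [X, Y] using h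
  have e1 : Nm v a x ↔ X ∈ nmS v a := by rw [mem_nmS]; rfl
  have e2 : Nm v a y ↔ Y ∈ nmS v a := by rw [mem_nmS]; rfl
  rw [e1, e2]
  constructor
  · intro h2; have := mul_mem h2 h1; rwa [mul_inv_cancel_left] at this
  · intro h2
    have := mul_mem h2 (inv_mem h1)
    rwa [mul_inv_rev, inv_inv, mul_inv_cancel_left] at this

/-- prescribed norm classes -/
theorem exists_nm_class (F : Finset (Place K)) {a : K} (ha : a ≠ 0) (τ : Place K → Prop)
    (hτ : ∀ v ∈ F, Sq v a → τ v) : ∃ x : K, x ≠ 0 ∧ ∀ v ∈ F, (Nm v a x ↔ τ v) := by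
  classical
  have : ∀ v : Place K, ∃ t : K, t ≠ 0 ∧ (v ∈ F → (Nm v a t ↔ τ v)) := by
    intro v
    by_cases h : τ v
    · exact ⟨1, one_ne_zero, fun _ => by simp [h, nm_one]⟩
    · by_cases hF : v ∈ F
      · obtain ⟨b, hb, h1⟩ := exists_nonnorm v ha (fun hs => h (hτ v hF hs))
        exact ⟨b, hb, fun _ => by simp [h, h1]⟩
      · exact ⟨1, one_ne_zero, fun h => absurd h hF⟩
  choose t ht0 ht using this
  obtain ⟨x, hx, h⟩ := weak_class F t (fun v _ => ht0 v)
  refine ⟨x, hx, fun v hv => ?_⟩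
  rw [← ht v hv]
  exact ⟨fun h1 => nm_congr_right hx (by rw [mul_comm]; exact h v hv) h1, fun h1 => nm_congr_right (ht0 v) (h v hv) h1⟩
end

theorem exists_S {K L : Type*} [Field K] [NumberField K] [Field L] [NumberField L] (f : K →+* L)
    (S0 : Finset (FP K)) : ∃ S, S0 ⊆ S ∧ PS S ∧ PS (SL f S) ∧ ∀ v ∉ S, ord v (2 : K) = 0 := by
  classical
  obtain ⟨S', _, hS'⟩ := exists_PS (∅ : Finset (FP L))
  obtain ⟨S, hS, hPS⟩ := exists_PS (S0 ∪ supp (2 : K) ∪ S'.image (below f))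
  refine ⟨S, fun v hv => hS (by simp [hv]), hPS, hS'.mono ?_, ?_⟩
  · intro w hw
    rw [mem_SL]
    exact hS (Finset.mem_union_right _ (Finset.mem_image_of_mem _ hw))
  · intro v hv
    exact ord_of_supp fun h => hv (hS (by simp [h]))

theorem factA {K : Type u} [Field K] [NumberField K] {a : K} (hns : ¬ IsSquare a) (S0 : Finset (FP K)) :
    ∃ v ∉ S0, ¬ Sq (Sum.inl v) a := by
  classical
  by_contra hcon
  push Not at hcon
  obtain ⟨L, _, _, _, ⟨E⟩⟩ := exists_QE hns
  obtain ⟨S, hS0, hS, hL, h2⟩ := exists_S (algebraMap K L) (S0 ∪ supp a)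
  have h1 := E.norm_index (T := ∅) hS h2 (by
    intro v hv _
    rw [ord_of_supp fun h => hv (hS0 (by simp [h]))]
    exact Even.zero)
  simp only [Finset.card_empty, pow_zero, one_mul] at h1
  have h3 := le_index_of_surj ((E.NSU S).subgroupOf (SU S)) (E.relIndex_ne S)
    (fun u => fun v : (Pl S).filter (fun v => ¬ Sq v a) => decide (Nm v.1 a (u.1 : K))) ?_ ?_
  · rw [card_bool_fun] at h3
    change _ ≤ (E.NSU S).relIndex (SU S) at h3
    have := E.relIndex_ne S
    omega
  · intro τ
    obtain ⟨x, hx, h⟩ := exists_nm_class (Pl S) E.a_ne (fun v => ∀ h : v ∈ (Pl S).filter (fun v => ¬ Sq v a), τ ⟨v, h⟩ = true)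
      (fun v _ hsq h => absurd hsq (Finset.mem_filter.1 h).2)
    obtain ⟨z, hz, h4⟩ := E.adjust hL hx (fun v hv _ => hcon v fun h => hv (hS0 (by simp [h])))
    refine ⟨⟨Units.mk0 (x / E.N z) (div_ne_zero hx (E.N_ne hz)), h4⟩, ?_⟩
    funext v
    have h5 := h v.1 (Finset.mem_filter.1 v.2).1
    have h6 : Nm v.1 a x ↔ Nm v.1 a (x / E.N z) := by
      apply nm_iff_of_mul hx (div_ne_zero hx (E.N_ne hz))
      rw [div_eq_mul_inv, inv_mul_cancel_left₀ hx]
      exact nm_inv (E.N_nm z v.1)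
    simp only [Units.val_mk0]
    rw [h6] at h5
    simp only [h5]
    by_cases hτ : τ v = true
    · rw [hτ, decide_eq_true_eq]; exact fun _ => hτ
    · have : τ v = false := by simpa using hτ
      rw [this, decide_eq_false_iff_not]
      exact fun h => hτ (h v.2)
  · intro x y hxy
    funext v
    rw [Subgroup.mem_subgroupOf, E.mem_NSU] at hxy
    obtain ⟨z, hz, hzN⟩ := hxy
    simp only [decide_eq_decide]
    apply nm_iff_of_mul (Units.ne_zero _) (Units.ne_zero _)
    have e1 : ((x⁻¹ * y : SU S).1 : K) = (x.1 : K)⁻¹ * (y.1 : K) := by simp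
    rw [← e1, ← hzN]
    exact E.N_nm _ _

theorem factA2 {K : Type u} [Field K] [NumberField K] {a x : K} (ha : ¬ IsSquare a) (hx : ¬ IsSquare x)
    (hax : ¬ IsSquare (a * x)) (S0 : Finset (FP K)) : ∃ v ∉ S0, Sq (Sum.inl v) a ∧ ¬ Sq (Sum.inl v) x := by
  classical
  obtain ⟨L, _, _, _, ⟨E⟩⟩ := exists_QE ha
  have hx0 : x ≠ 0 := by rintro rfl; exact hx ⟨0, by simp⟩
  have hxL : ¬ IsSquare (algebraMap K L x) := by
    rintro ⟨r, hr⟩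
    obtain ⟨p, q, rfl⟩ := E.span r
    have h1 : algebraMap K L (p ^ 2 + a * q ^ 2 - x) + algebraMap K L (2 * p * q) * E.s = 0 := by
      simp only [map_sub, map_add, map_mul, map_pow, map_ofNat, ← E.hs, hr]; ring
    obtain ⟨h2, h3⟩ := E.lin_inj h1
    have : p = 0 ∨ q = 0 := by simpa using h3
    rcases this with rfl | rfl
    · exact hax ⟨a * q, by linear_combination - a * h2⟩
    · exact hx ⟨p, by linear_combination - h2⟩
  obtain ⟨w, hw, h1⟩ := factA hxL (SL (algebraMap K L) (S0 ∪ supp (2 : K) ∪ supp a ∪ supp x))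
  rw [mem_SL] at hw
  simp only [Finset.mem_union, not_or] at hw
  obtain ⟨⟨⟨hw0, hw2⟩, hwa⟩, hwx⟩ := hw
  set v := below (algebraMap K L) w
  have hnx : ¬ Sq (Sum.inl v) x := fun h => h1 (sq_up (f := algebraMap K L) (w := Sum.inl w) h)
  refine ⟨v, hw0, ?_, hnx⟩
  by_contra hna
  have h2 := odd_mul (ord_of_supp hw2) E.a_ne hx0 (ord_of_supp hwa) (ord_of_supp hwx) hna hnx
  have h3 : Sq (Sum.inl w) (algebraMap K L (a * x)) := sq_up (f := algebraMap K L) (w := Sum.inl w) h2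
  rw [map_mul, ← E.hs, mul_comm] at h3
  exact h1 ((LSq.mul_sq_iff E.s_ne).1 h3)

end ADQ

namespace ADQ
open NumberField IsDedekindDomain WithZero

section
variable {K : Type*} [Field K] [NumberField K]

/-- intersection of local subgroups -/
def infS (F : Finset (Place K)) (H : Place K → Subgroup Kˣ) : Subgroup Kˣ := ⨅ v ∈ F, H v

theorem mem_infS {F : Finset (Place K)} {H : Place K → Subgroup Kˣ} {x : Kˣ} :
    x ∈ infS F H ↔ ∀ v ∈ F, x ∈ H v := by simp [infS, Subgroup.mem_iInf]

theorem index_family {G ι : Type*} [Group G] [Fintype ι] (B : Subgroup G) (H : ι → Subgroup G)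
    (hB : ∀ x, x ∈ B ↔ ∀ i, x ∈ H i) (hs : ∀ t : ι → G, ∃ x, ∀ i, x⁻¹ * t i ∈ H i) :
    B.index = ∏ i, (H i).index := by
  have : B.index = Nat.card ((i : ι) → G ⧸ H i) := by
    refine Nat.card_congr (Equiv.ofBijective (fun q : G ⧸ B => fun i => ((q.out : G) : G ⧸ H i)) ⟨?_, ?_⟩)
    · intro q r hqr
      rw [← QuotientGroup.out_eq' q, ← QuotientGroup.out_eq' r, QuotientGroup.eq, hB]
      intro i
      exact QuotientGroup.eq.1 (congrFun hqr i)
    · intro t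
      obtain ⟨x, hx⟩ := hs fun i => (t i).out
      refine ⟨(x : G ⧸ B), ?_⟩
      funext i
      have h1 : ((x : G ⧸ B).out)⁻¹ * x ∈ B := by rw [← QuotientGroup.eq, QuotientGroup.out_eq']
      have h2 := (H i).mul_mem ((hB _).1 h1 i) (hx i)
      rw [mul_assoc, mul_inv_cancel_left, ← QuotientGroup.eq, QuotientGroup.out_eq'] at h2
      exact h2
  rw [this, Nat.card_pi]
  rfl

theorem index_infS (F : Finset (Place K)) (H : Place K → Subgroup Kˣ) (hH : ∀ v, sqS v ≤ H v) :
    (infS F H).index = ∏ v ∈ F, (H v).index := by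
  classical
  rw [index_family (infS F H) (fun v : F => H v.1) (fun x => by rw [mem_infS]; simp), ← Finset.prod_coe_sort F]
  intro q
  obtain ⟨x, hx, h⟩ := weak_class F (fun v => if h : v ∈ F then ((q ⟨v, h⟩ : Kˣ) : K) else 1) (by
    intro v hv; simp [hv])
  refine ⟨Units.mk0 x hx, fun v => ?_⟩
  have h3 := h v.1 v.2
  simp only [v.2, dif_pos] at h3
  have h4 : ((Units.mk0 x hx : Kˣ) : Kˣ ⧸ sqS v.1) = q v := mk_sqS_eq.2 h3
  rw [QuotientGroup.eq] at h4
  exact hH _ h4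

theorem prod_bound_le (S : Finset (FP K)) :
    (∏ v ∈ S, 4 * (Ideal.absNorm v.asIdeal) ^ (e2 v)) * ∏ v : InfinitePlace K, (sqS (Sum.inr v : Place K)).index
      ≤ 2 ^ (2 * (Pl S).card) := by
  classical
  have h1 : ∏ v ∈ S, 4 * (Ideal.absNorm v.asIdeal) ^ (e2 v) ≤ 4 ^ S.card * 2 ^ (Module.finrank ℚ K) := by
    rw [Finset.prod_mul_distrib, Finset.prod_const]
    exact Nat.mul_le_mul_left _ (prod_norm_le S)
  have h2 : ∏ v : InfinitePlace K, (sqS (Sum.inr v : Place K)).index = 2 ^ (InfinitePlace.nrRealPlaces K) := by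
    have : ∀ v : InfinitePlace K, (sqS (Sum.inr v : Place K)).index = if v.IsReal then 2 else 1 := by
      intro v; split_ifs with h
      · exact index_sqS_real h
      · exact index_sqS_complex h
    rw [Finset.prod_congr rfl fun v _ => this v, Finset.prod_ite, Finset.prod_const, Finset.prod_const_one,
      mul_one, InfinitePlace.nrRealPlaces, Fintype.card_subtype]
  rw [h2, card_Pl]
  refine (Nat.mul_le_mul_right _ h1).trans (le_of_eq ?_)
  have h3 := InfinitePlace.card_add_two_mul_card_eq_rank K
  have h4 := InfinitePlace.card_eq_nrRealPlaces_add_nrComplexPlaces K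
  rw [show (4 : ℕ) = 2 ^ 2 by norm_num, ← pow_mul, ← pow_add, ← pow_add]
  congr 1
  omega

theorem mem_sqr_SU {S : Finset (FP K)} {x : SU S} : x ∈ sqr (SU S) ↔ IsSquare (x.1 : K) := by
  constructor
  · rintro ⟨y, rfl⟩
    exact ⟨(y.1 : K), by simp [pow_two]⟩
  · rintro ⟨y, hy⟩
    have hy0 : y ≠ 0 := by rintro rfl; exact x.1.ne_zero (by simpa using hy)
    have hy1 : Units.mk0 y hy0 ∈ SU S := by
      intro v hv
      have h1 := x.2 v hv
      rw [hy, ord_mul v hy0 hy0] at h1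
      change ord v y = 0
      omega
    refine ⟨⟨_, hy1⟩, ?_⟩
    apply Subtype.ext
    apply Units.ext
    simp [hy, pow_two]

theorem sq_mul_iff {v : Place K} {x y : K} (hy : y ≠ 0) (h : Sq v y) : Sq v (x * y) ↔ Sq v x :=
  ⟨fun h1 => LSq.of_mul_right (f := av v) hy h h1, fun h1 => h1.mul h⟩

theorem isSquare_of_mul {x y : K} (h : IsSquare (x * y ^ 2)) (hy : y ≠ 0) : IsSquare x := by
  obtain ⟨r, hr⟩ := h
  exact ⟨r / y, by field_simp; linear_combination hr⟩

theorem card_Pl_pos (S : Finset (FP K)) : 1 ≤ (Pl S).card := by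
  rw [card_Pl]
  have : 0 < Fintype.card (InfinitePlace K) := Fintype.card_pos
  omega
end

theorem exists_T {K : Type u} [Field K] [NumberField K] {a : K} (ha : ¬ IsSquare a) {S : Finset (FP K)}
    (h2 : ∀ v ∉ S, ord v (2 : K) = 0) (j : ℕ) (hj : j + 1 ≤ (Pl S).card) :
    ∃ T : Finset (FP K), T.card = j ∧ (∀ v ∈ T, v ∉ S) ∧ (∀ v ∈ T, Sq (Sum.inl v) a) ∧ Onto S T := by
  classical
  have ha0 : a ≠ 0 := by rintro rfl; exact ha ⟨0, by simp⟩
  induction j with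
  | zero => exact ⟨∅, rfl, by simp, by simp, fun τ => ⟨1, one_mem _, by simp⟩⟩
  | succ j ih =>
    obtain ⟨T, hc, hTS, hTa, hon⟩ := ih (by omega)
    have key : ∃ x ∈ SU S, (∀ v ∈ T, Sq (Sum.inl v) (x : K)) ∧ ¬ IsSquare (x : K) ∧ ¬ IsSquare (a * x) := by
      by_contra hcon
      push Not at hcon
      let φ1 : SU S → (T → Bool) := fun x v => decide (Sq (Sum.inl v.1) (x.1 : K))
      let r : (T → Bool) → SU S := Function.invFun φ1
      have hr : ∀ x, φ1 (r (φ1 x)) = φ1 x := fun x => Function.invFun_eq ⟨x, rfl⟩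
      have h3 := index_le_of_inj (sqr (SU S)) (fun x => (φ1 x, decide (IsSquare (((r (φ1 x)).1 : K) * (x.1 : K))))) ?_
      · rw [index_SU, ← card_Pl, Nat.card_prod, card_bool_fun, hc] at h3
        have h4 := h3.2
        rw [Nat.card_eq_fintype_card, Fintype.card_bool, ← pow_succ] at h4
        have := (Nat.pow_le_pow_iff_right (by norm_num : 1 < 2)).1 h4
        omega
      · intro x y hxy
        rw [Prod.mk.injEq] at hxy
        obtain ⟨e1, e2⟩ := hxy
        rw [← e1] at e2
        set R := r (φ1 x) with hR
        have hsq : ∀ z : SU S, φ1 z = φ1 x → IsSquare ((R.1 : K) * z.1) ∨ IsSquare (a * ((R.1 : K) * z.1)) := by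
          intro z hz
          by_cases h5 : IsSquare ((R.1 : K) * z.1)
          · exact Or.inl h5
          · right
            have := hcon (R.1 * z.1) (mul_mem R.2 z.2) (fun v hv => by
              have h6 : φ1 R = φ1 z := by rw [hz]; exact hr x
              have h7 := congrFun h6 ⟨v, hv⟩
              simp only [φ1, decide_eq_decide] at h7
              by_cases h8 : Sq (Sum.inl v) (R.1 : K)
              · exact h8.mul (h7.1 h8)
              · exact odd_mul (h2 _ (hTS v hv)) (Units.ne_zero _) (Units.ne_zero _) (R.2 _ (hTS v hv)) (z.2 _ (hTS v hv))
                  h8 (fun h => h8 (h7.2 h))) h5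
            simpa using this
        have h9 : IsSquare ((x.1 : K) * y.1) := by
          rw [decide_eq_decide] at e2
          by_cases h5 : IsSquare ((R.1 : K) * x.1)
          · have := h5.mul (e2.1 h5)
            apply isSquare_of_mul (y := (R.1 : K)) _ (Units.ne_zero _)
            have e : (x.1 : K) * y.1 * (R.1 : K) ^ 2 = (R.1 : K) * x.1 * ((R.1 : K) * y.1) := by ring
            rw [e]; exact this
          · have h6 := (hsq x rfl).resolve_left h5
            have h7 := (hsq y e1.symm).resolve_left (fun h => h5 (e2.2 h))
            apply isSquare_of_mul (y := a * (R.1 : K)) _ (mul_ne_zero ha0 (Units.ne_zero _))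
            have e : (x.1 : K) * y.1 * (a * (R.1 : K)) ^ 2 = a * ((R.1 : K) * x.1) * (a * ((R.1 : K) * y.1)) := by ring
            rw [e]; exact h6.mul h7
        rw [mem_sqr_SU]
        apply isSquare_of_mul (y := (x.1 : K)) _ (Units.ne_zero _)
        convert h9 using 1
        simp only [Subgroup.coe_mul, Subgroup.coe_inv, Units.val_mul, Units.val_inv_eq_inv_val]
        have := x.1.ne_zero
        field_simp
    obtain ⟨x, hx, hxT, hx1, hx2⟩ := key
    obtain ⟨v, hv, hva, hvx⟩ := factA2 ha hx1 hx2 (S ∪ T)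
    rw [Finset.mem_union, not_or] at hv
    refine ⟨insert v T, by rw [Finset.card_insert_of_notMem hv.2, hc], ?_, ?_, ?_⟩
    · intro w hw
      rcases Finset.mem_insert.1 hw with rfl | hw
      · exact hv.1
      · exact hTS w hw
    · intro w hw
      rcases Finset.mem_insert.1 hw with rfl | hw
      · exact hva
      · exact hTa w hw
    · intro τ
      obtain ⟨u, hu, h⟩ := hon τ
      by_cases h4 : Sq (Sum.inl v) (u : K) ↔ τ v
      · refine ⟨u, hu, fun w hw => ?_⟩
        rcases Finset.mem_insert.1 hw with rfl | hw
        · exact h4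
        · exact h w hw
      · refine ⟨u * x, mul_mem hu hx, fun w hw => ?_⟩
        rw [Units.val_mul]
        rcases Finset.mem_insert.1 hw with rfl | hw
        · have h5 : Sq (Sum.inl w) ((u : K) * x) ↔ ¬ Sq (Sum.inl w) (u : K) := by
            constructor
            · intro h6 h7
              exact hvx (LSq.of_mul_left (f := av (Sum.inl w)) (Units.ne_zero _) h7 h6)
            · intro h6
              exact odd_mul (h2 _ hv.1) (Units.ne_zero _) (Units.ne_zero _) (hu _ hv.1) (hx _ hv.1) h6 hvx
          rw [h5]; tauto
        · rw [sq_mul_iff (Units.ne_zero _) (hxT w hw)]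
          exact h w hw

theorem isSquare_ne {K : Type*} [Field K] {a : K} (ha : ¬ IsSquare a) : a ≠ 0 := by
  rintro rfl; exact ha ⟨0, by simp⟩

theorem nm_index_ge {K : Type*} [Field K] [NumberField K] {a : K} {v : Place K} (ha : a ≠ 0) (h : ¬ Sq v a) :
    2 ≤ (nmS v a).index := by
  have h0 : (nmS v a).index ≠ 0 := fun h => index_sqS_ne v (Nat.eq_zero_of_zero_dvd (h ▸ Subgroup.index_dvd_of_le sqS_le_nmS))
  obtain ⟨b, hb, hn⟩ := exists_nonnorm v ha h
  have h1 : (nmS v a).index ≠ 1 := by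
    intro h
    rw [Subgroup.index_eq_one] at h
    exact hn (by
      have : Units.mk0 b hb ∈ nmS v a := by rw [h]; trivial
      exact this)
  omega

theorem nm_index_one {K : Type*} [Field K] [NumberField K] {a : K} {v : Place K} (ha : a ≠ 0) (h : Sq v a) :
    (nmS v a).index = 1 := by
  rw [Subgroup.index_eq_one, eq_top_iff]
  intro x _
  exact nm_of_sq_left ha h

/-- main structure theorem -/
theorem hasse_struct {K : Type u} [Field K] [NumberField K] {a : K} (ha : ¬ IsSquare a) (S0 : Finset (FP K)) :
    ∃ S, S0 ⊆ S ∧ PS S ∧ (∀ v ∉ S, ord v (2 : K) = 0) ∧ (∀ v ∉ S, ord v a = 0) ∧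
      (∀ x : K, x ≠ 0 → (∀ v ∉ S, ord v x = 0) → (∀ v ∈ Pl S, Nm v a x) → ∃ p q, x = p ^ 2 - a * q ^ 2) ∧
      (SU S ⊔ infS (Pl S) (fun v => nmS v a)).index = 2 ∧
      (∀ v ∈ Pl S, ¬ Sq v a → (nmS v a).index = 2) ∧
      ∏ v ∈ Pl S, (sqS v).index = 2 ^ (2 * (Pl S).card) ∧
      (∀ x : Kˣ, (∀ v ∉ S, Nm (Sum.inl v) a (x : K)) → x ∈ SU S ⊔ infS (Pl S) (fun v => nmS v a)) := by
  classical
  have ha0 := isSquare_ne ha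
  obtain ⟨L, _, _, _, ⟨E⟩⟩ := exists_QE ha
  obtain ⟨S, hS0, hS, hL, h2⟩ := exists_S (algebraMap K L) (S0 ∪ supp a)
  have hSa : ∀ v ∉ S, ord v a = 0 := fun v hv => ord_of_supp fun h => hv (hS0 (by simp [h]))
  have hni := E.norm_index (T := ∅) hS h2 (by
    intro v hv _
    rw [hSa v hv]; exact Even.zero)
  simp only [Finset.card_empty, pow_zero, one_mul] at hni
  set s := (Pl S).card with hs
  have hs1 : 1 ≤ s := card_Pl_pos S
  obtain ⟨T, hTc, hTS, hTa, hon⟩ := exists_T ha h2 (s - 1) (by omega)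
  set Q := infS (Pl S) (fun v => sqS v) with hQ
  set R := infS (Pl S) (fun v => nmS v a) with hR
  set U := SU S with hU
  set U' := SU (S ∪ T) with hU'
  have hQR : Q ≤ R := fun x hx => mem_infS.2 fun v hv => sqS_le_nmS (mem_infS.1 hx v hv)
  have hQi : Q.index = ∏ v ∈ Pl S, (sqS v).index := index_infS _ _ fun _ => le_rfl
  have hRi : R.index = ∏ v ∈ Pl S, (nmS v a).index := index_infS _ _ fun _ => sqS_le_nmS
  have hQU : Q.relIndex U' = 2 ^ (2 * s - 1) := by
    have : Q.subgroupOf U' = sqr U' := by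
      ext x
      rw [mem_sqr_SU, Subgroup.mem_subgroupOf, mem_infS]
      constructor
      · intro h
        refine claimB hS h2 (fun v hv => h v hv) (Units.ne_zero _) (fun v hv hvT => ?_) hTS hon
        rw [x.2 v (by simp [hv, hvT])]
        exact Even.zero
      · rintro ⟨y, hy⟩ v _
        rw [mem_sqS, hy, ← pow_two]
        exact LSq.sq y
    rw [Subgroup.relIndex, this, index_SU, Finset.card_union_of_disjoint, hTc]
    · congr 1
      rw [hs, card_Pl] at *
      omega
    · rw [Finset.disjoint_right]; exact hTS
  have hQ2 : 2 ^ (2 * s - 1) * (U' ⊔ Q).index = Q.index := by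
    rw [← hQU, ← Subgroup.relIndex_sup_right, Subgroup.relIndex_mul_index le_sup_right]
  have hQle : Q.index ≤ 2 ^ (2 * s) := by rw [hQi]; exact prod_index_le S
  have hQ0 : Q.index ≠ 0 := by rw [hQi, Finset.prod_ne_zero_iff]; exact fun v _ => index_sqS_ne v
  have hpow : 2 ^ (2 * s) = 2 ^ (2 * s - 1) * 2 := by rw [← pow_succ]; congr 1; omega
  have hW0 : (U' ⊔ Q).index ≠ 0 := by intro h; rw [h, mul_zero] at hQ2; exact hQ0 hQ2.symm
  have hW : (U' ⊔ Q).index ≤ 2 := by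
    rw [← hQ2, hpow] at hQle
    exact Nat.le_of_mul_le_mul_left hQle (by positivity)
  have hWle : U' ⊔ Q ≤ U ⊔ R := by
    refine sup_le ?_ (hQR.trans le_sup_right)
    intro x hx
    obtain ⟨z, hz, h4⟩ := E.adjust hL x.ne_zero (fun v hv h => hTa v (by
      by_contra hvT
      exact h (hx v (by simp [hv, hvT]))))
    have h5 : Units.mk0 _ (E.N_ne hz) ∈ R := mem_infS.2 fun v _ => E.N_nm z v
    have h6 : x * (Units.mk0 _ (E.N_ne hz))⁻¹ ∈ U := by
      intro v hv
      have := h4 v hv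
      rw [div_eq_mul_inv] at this
      simpa using this
    have := Subgroup.mul_mem_sup h6 h5
    rwa [inv_mul_cancel_right] at this
  have hI : (U ⊔ R).index ∣ (U' ⊔ Q).index := Subgroup.index_dvd_of_le hWle
  have hNR : E.NSU S ≤ R := by
    intro x hx
    obtain ⟨z, _, hz⟩ := E.mem_NSU.1 hx
    refine mem_infS.2 fun v _ => ?_
    rw [mem_nmS, ← hz]
    exact E.N_nm _ _
  have hRU : R.relIndex U * (U ⊔ R).index = R.index := by
    rw [← Subgroup.relIndex_sup_right, Subgroup.relIndex_mul_index le_sup_right]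
  set k := ((Pl S).filter fun v => ¬ Sq v a).card with hk
  have hprod : ∏ v ∈ Pl S, (nmS v a).index = ∏ v ∈ (Pl S).filter (fun v => ¬ Sq v a), (nmS v a).index := by
    rw [Finset.prod_filter]
    refine Finset.prod_congr rfl fun v _ => ?_
    split_ifs with h
    · exact nm_index_one ha0 h
    · rfl
  have hge : 2 ^ k ≤ R.index := by
    rw [hRi, hprod, hk, ← Finset.prod_const]
    exact Finset.prod_le_prod' fun v hv => nm_index_ge ha0 (Finset.mem_filter.1 hv).2
  have hd : R.relIndex U ∣ (E.NSU S).relIndex U := Subgroup.relIndex_dvd_of_le_left _ hNR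
  have hNne : (E.NSU S).relIndex U ≠ 0 := E.relIndex_ne S
  have hle := Nat.le_of_dvd (Nat.pos_of_ne_zero hNne) hd
  have hIle := Nat.le_of_dvd (Nat.pos_of_ne_zero hW0) hI
  have hI2 : (U ⊔ R).index = 2 := by
    by_contra hc
    have : (U ⊔ R).index ≤ 1 := by omega
    have h5 : R.relIndex U * (U ⊔ R).index ≤ R.relIndex U * 1 := Nat.mul_le_mul_left _ this
    omega
  rw [hI2] at hRU
  have hReq : R.index = 2 ^ k := by omega
  have hNeq : (E.NSU S).relIndex U = R.relIndex U := by omega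
  have hW2 : (U' ⊔ Q).index = 2 := by omega
  refine ⟨S, fun v hv => hS0 (by simp [hv]), hS, h2, hSa, ?_, hI2, ?_, ?_, ?_⟩
  · intro x hx hxS hxN
    have h5 := Subgroup.relIndex_mul_relIndex (E.NSU S) (R ⊓ U) U (le_inf hNR (E.NSU_le S)) inf_le_right
    rw [Subgroup.inf_relIndex_right, hNeq] at h5
    have h6 : (E.NSU S).relIndex (R ⊓ U) = 1 := by
      have : 0 < R.relIndex U := by omega
      exact Nat.eq_of_mul_eq_mul_right this (by rw [one_mul]; exact h5)
    rw [Subgroup.relIndex_eq_one] at h6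
    have h7 : Units.mk0 x hx ∈ E.NSU S := h6 ⟨mem_infS.2 fun v hv => hxN v hv, hxS⟩
    obtain ⟨z, _, hz⟩ := E.mem_NSU.1 h7
    obtain ⟨p, q, _, h8⟩ := E.N_form (z : L)
    exact ⟨p, q, by rw [← h8, hz]; rfl⟩
  · intro v hv hva
    have h5 : ∏ v ∈ (Pl S).filter (fun v => ¬ Sq v a), 2 = ∏ v ∈ (Pl S).filter (fun v => ¬ Sq v a), (nmS v a).index := by
      rw [← hprod, ← hRi, hReq, Finset.prod_const]
    by_contra hc
    have h6 : 2 < (nmS v a).index := lt_of_le_of_ne (nm_index_ge ha0 hva) (Ne.symm hc)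
    have := Finset.prod_lt_prod (s := (Pl S).filter (fun v => ¬ Sq v a)) (f := fun _ => 2) (g := fun v => (nmS v a).index)
      (fun _ _ => by norm_num) (fun v hv => nm_index_ge ha0 (Finset.mem_filter.1 hv).2) ⟨v, Finset.mem_filter.2 ⟨hv, hva⟩, h6⟩
    exact absurd h5 (ne_of_lt this)
  · rw [← hQi, ← hQ2, hW2, hpow]
  · intro x hx
    obtain ⟨c, hc, h5⟩ := hS.exists_ord (fun v => if Even (ord v (x : K)) then ord v (x : K) / 2 else 0) (by
      refine (supp (x : K)).finite_toSet.subset ?_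
      rintro v ⟨_, h⟩
      by_contra hv
      apply h
      rw [ord_of_supp hv]; simp)
    have hy : (x : K) / c ^ 2 ≠ 0 := div_ne_zero x.ne_zero (pow_ne_zero _ hc)
    obtain ⟨z, hz, h6⟩ := E.adjust hL hy (fun v hv h => by
      by_contra hns
      have h7 := odd_even (h2 v hv) ha0 (hSa v hv) hns x.ne_zero (hx v hv)
      apply h
      rw [ord_div v x.ne_zero (pow_ne_zero _ hc), ord_sq v hc, h5 v hv, if_pos h7]
      obtain ⟨k, hk⟩ := h7
      omega)
    let Z := Units.mk0 _ (E.N_ne hz)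
    let C := Units.mk0 c hc
    have h8 : Z * C ^ 2 ∈ R := by
      refine mul_mem (mem_infS.2 fun v _ => E.N_nm z v) (mem_infS.2 fun v _ => sqS_le_nmS ?_)
      rw [mem_sqS]
      exact LSq.sq c
    have h9 : x * (Z * C ^ 2)⁻¹ ∈ U := by
      intro v hv
      have := h6 v hv
      rw [div_div, mul_comm, div_eq_mul_inv] at this
      simpa [Z, C] using this
    have := Subgroup.mul_mem_sup h9 h8
    rwa [inv_mul_cancel_right] at this
end ADQ

namespace ADQ
open NumberField IsDedekindDomain WithZero

theorem nm_up {K L : Type*} [Field K] [NumberField K] [Field L] [NumberField L] {f : K →+* L} {w : Place L} {a b : K}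
    (h : Nm (pb f w) a b) : Nm w (f a) (f b) := by
  obtain ⟨x, y, h0, h1⟩ := h
  refine ⟨f x, f y, ?_, ?_⟩
  · rw [← map_pow, ← map_pow, ← map_mul, ← map_sub]
    exact (map_ne_zero f).2 h0
  · have := sq_up h1
    simpa using this

theorem nm_index_two {K : Type u} [Field K] [NumberField K] {a : K} {v : Place K} (ha : a ≠ 0) (h : ¬ Sq v a) :
    (nmS v a).index = 2 := by
  have hns : ¬ IsSquare a := by
    rintro ⟨r, rfl⟩; exact h (by rw [← pow_two]; exact LSq.sq r)
  rcases v with v | v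
  · obtain ⟨S, h0, _, _, _, _, _, h1, _⟩ := hasse_struct hns {v}
    exact h1 _ (mem_Pl_inl.2 (h0 (by simp))) h
  · obtain ⟨S, h0, _, _, _, _, _, h1, _⟩ := hasse_struct hns ∅
    exact h1 _ mem_Pl_inr h

theorem nm_xor {K : Type u} [Field K] [NumberField K] {a b c : K} {v : Place K} (ha : a ≠ 0) (hb : b ≠ 0) (hc : c ≠ 0) :
    Nm v a (b * c) ↔ (Nm v a b ↔ Nm v a c) := by
  by_cases h : Sq v a
  · simp [nm_of_sq_left ha h]
  · exact Subgroup.mul_mem_iff_of_index_two (nm_index_two ha h) (a := Units.mk0 b hb) (b := Units.mk0 c hc)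

theorem nm_xor_left {K : Type u} [Field K] [NumberField K] {a b c : K} {v : Place K} (ha : a ≠ 0) (hb : b ≠ 0) (hc : c ≠ 0) :
    Nm v (a * b) c ↔ (Nm v a c ↔ Nm v b c) := by
  rw [nm_comm (mul_ne_zero ha hb) hc, nm_xor hc ha hb, nm_comm ha hc, nm_comm hb hc]

theorem hasse_norm {K : Type u} [Field K] [NumberField K] {a b : K} (ha : a ≠ 0) (hb : b ≠ 0) (h : ∀ v, Nm v a b) :
    ∃ p q, b = p ^ 2 - a * q ^ 2 := by
  by_cases hns : IsSquare a
  · obtain ⟨r, rfl⟩ := hns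
    have hr : r ≠ 0 := by rintro rfl; simp at ha
    exact ⟨(b + 1) / 2, (b - 1) / (2 * r), by field_simp; ring⟩
  · obtain ⟨S, h0, _, _, _, h1, _⟩ := hasse_struct hns (supp b)
    exact h1 b hb (fun v hv => ord_of_supp fun h => hv (h0 h)) (fun v _ => h v)

theorem nondeg {K : Type*} [Field K] [NumberField K] {d : K} {v : Place K} (hd : d ≠ 0) (h : ∀ x, x ≠ 0 → Nm v d x) : Sq v d := by
  by_contra hc
  obtain ⟨b, hb, h1⟩ := exists_nonnorm v hd hc
  exact h1 (h b hb)

theorem local4 {K : Type u} [Field K] [NumberField K] {a b d : K} {v : Place K} (ha : a ≠ 0) (hb : b ≠ 0) (hd0 : d ≠ 0)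
    (hd : ¬ Sq v d) : ∃ t, t ≠ 0 ∧ Nm v a t ∧ Nm v (a * d) (b * t) := by
  by_contra hcon
  push Not at hcon
  have had := mul_ne_zero ha hd0
  have h1 : ¬ Nm v (a * d) b := by simpa using hcon 1 one_ne_zero nm_one
  have h2 : ∀ t, t ≠ 0 → Nm v a t → Nm v (a * d) t := by
    intro t ht h
    have := hcon t ht h
    rw [nm_xor had hb ht] at this
    tauto
  have h3 : ∀ t, t ≠ 0 → Nm v (a * d) t → Nm v a t := by
    intro t ht h
    by_contra hc
    apply h1
    by_cases hab : Nm v a b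
    · exact h2 b hb hab
    · have h4 : Nm v a (t * b) := by rw [nm_xor ha ht hb]; tauto
      have h5 := h2 _ (mul_ne_zero ht hb) h4
      exact nm_of_mul ht h h5
  apply hd
  apply nondeg hd0
  intro x hx
  have h4 := h2 x hx
  have h5 := h3 x hx
  rw [nm_xor_left ha hd0 hx] at h4 h5
  tauto

/-- Hasse principle for quaternary forms -/
theorem hm4 {K : Type u} [Field K] [NumberField K] {a b d : K} (ha : a ≠ 0) (hb : b ≠ 0) (hd : d ≠ 0)
    (h : ∀ v, Sq v d → Nm v a b) : ∃ x y z t, ¬ (x = 0 ∧ y = 0 ∧ z = 0 ∧ t = 0) ∧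
      x ^ 2 - a * y ^ 2 - b * z ^ 2 + a * b * d * t ^ 2 = 0 := by
  by_cases hsq : IsSquare d
  · obtain ⟨p, q, hpq⟩ := hasse_norm ha hb (fun v => h v (by
      obtain ⟨r, rfl⟩ := hsq; rw [← pow_two]; exact LSq.sq r))
    exact ⟨p, q, 1, 0, by simp, by rw [hpq]; ring⟩
  · obtain ⟨L, _, _, _, ⟨E⟩⟩ := exists_QE hsq
    have hinj := (algebraMap K L).injective
    have haL : algebraMap K L a ≠ 0 := (map_ne_zero _).2 ha
    have hbL : algebraMap K L b ≠ 0 := (map_ne_zero _).2 hb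
    have hL : ∀ w : Place L, Nm w (algebraMap K L a) (algebraMap K L b) := by
      intro w
      by_cases hw : Sq (pb (algebraMap K L) w) d
      · exact nm_up (h _ hw)
      · obtain ⟨t, ht, h1, h2⟩ := local4 ha hb hd hw
        have h3 := nm_up h1
        have h4 := nm_up h2
        rw [map_mul, map_mul] at h4
        have htL : algebraMap K L t ≠ 0 := (map_ne_zero _).2 ht
        have hdL : algebraMap K L d ≠ 0 := (map_ne_zero _).2 hd
        have h5 : Nm w (algebraMap K L a) (algebraMap K L b * algebraMap K L t) :=
          nm_congr_left haL (mul_ne_zero haL hdL) (mul_ne_zero hbL htL) (by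
            rw [← E.hs, show algebraMap K L a * (algebraMap K L a * E.s ^ 2) = (algebraMap K L a * E.s) ^ 2 by ring]
            exact LSq.sq _) h4
        rw [mul_comm] at h5
        exact nm_of_mul htL h3 h5
    obtain ⟨P, Q, hPQ⟩ := hasse_norm haL hbL hL
    obtain ⟨p1, p2, rfl⟩ := E.span P
    obtain ⟨q1, q2, rfl⟩ := E.span Q
    have h1 : algebraMap K L (p1 ^ 2 + d * p2 ^ 2 - a * (q1 ^ 2 + d * q2 ^ 2) - b) +
        algebraMap K L (2 * (p1 * p2 - a * q1 * q2)) * E.s = 0 := by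
      simp only [map_sub, map_add, map_mul, map_pow, map_ofNat, ← E.hs, hPQ]; ring
    obtain ⟨h2, h3⟩ := E.lin_inj h1
    have h3' : p1 * p2 - a * q1 * q2 = 0 := by simpa using h3
    by_cases h4 : p2 = 0 ∧ q2 = 0
    · obtain ⟨rfl, rfl⟩ := h4
      exact ⟨p1, q1, 1, 0, by simp, by linear_combination h2⟩
    · refine ⟨-q2, -p2 / a, -(p1 * q2 - q1 * p2) / b, (p2 ^ 2 - a * q2 ^ 2) / (a * b), ?_, ?_⟩
      · rintro ⟨h5, h6, _⟩
        apply h4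
        refine ⟨?_, by simpa using h5⟩
        simpa [ha] using h6
      · field_simp
        linear_combination (p2 ^ 2 - a * q2 ^ 2) * h2 - (p1 * p2 - a * q1 * q2) * h3'

theorem nm_of_iso4 {K : Type*} [Field K] [NumberField K] {a b : K} {v : Place K} (ha : a ≠ 0) (hb : b ≠ 0)
    {e0 e1 e2 e3 : K} (s0 : Sq v e0) (s1 : Sq v e1) (s2 : Sq v e2) (s3 : Sq v e3)
    (hne : ¬ (e0 = 0 ∧ e1 = 0 ∧ e2 = 0 ∧ e3 = 0)) (h : e0 - a * e1 = b * (e2 - a * e3)) : Nm v a b := by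
  have key : ∀ e f : K, Sq v e → Sq v f → e - a * f = 0 → ¬ (e = 0 ∧ f = 0) → Nm v a b := by
    intro e f se sf h0 h1
    have hf : f ≠ 0 := by
      rintro rfl
      exact h1 ⟨by simpa using h0, rfl⟩
    apply nm_of_sq_left ha
    have : Sq v (a * f) := by rw [← sub_eq_zero.1 h0]; exact se
    exact LSq.of_mul_right (f := av v) hf sf this
  by_cases h0 : e0 - a * e1 = 0
  · by_cases h1 : e0 = 0 ∧ e1 = 0
    · refine key e2 e3 s2 s3 ?_ (fun h2 => hne ⟨h1.1, h1.2, h2.1, h2.2⟩)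
      rw [h0] at h
      exact (mul_eq_zero.1 h.symm).resolve_left hb
    · exact key e0 e1 s0 s1 h0 h1
  · have h1 : e2 - a * e3 ≠ 0 := by intro hc; rw [hc, mul_zero] at h; exact h0 h
    have h2 : Nm v a (e2 - a * e3) := nm_of_ef h1 s2 s3 rfl
    have h3 : Nm v a (e0 - a * e1) := nm_of_ef h0 s0 s1 rfl
    rw [h, mul_comm] at h3
    exact nm_of_mul h1 h2 h3

theorem hm4_conv {K : Type u} [Field K] [NumberField K] {a b d : K} (ha : a ≠ 0) (hb : b ≠ 0) (hd : d ≠ 0)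
    {x y z t : K} (hne : ¬ (x = 0 ∧ y = 0 ∧ z = 0 ∧ t = 0))
    (h : x ^ 2 - a * y ^ 2 - b * z ^ 2 + a * b * d * t ^ 2 = 0) (v : Place K) (hv : Sq v d) : Nm v a b := by
  refine nm_of_iso4 ha hb (LSq.sq x) (LSq.sq y) (LSq.sq z) (hv.mul (LSq.sq t)) ?_ (by linear_combination h)
  simpa [hd] using hne

theorem nm_sum {K : Type u} [Field K] [NumberField K] {X B c : K} {v : Place K} (hX : X ≠ 0) (hB : B ≠ 0) (hc : c ≠ 0)
    (h : c = X + B) : Nm v X B ↔ Nm v c (-X * B) := by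
  have h1 : Nm v (X * c) (B * c) := by
    have := nm_norm (v := v) (a := X * c) (x := c) (y := 1)
    rwa [show c ^ 2 - X * c * 1 ^ 2 = B * c by rw [h]; ring] at this
  rw [nm_xor_left hX hc (mul_ne_zero hB hc), nm_xor hX hB hc, nm_xor hc hB hc] at h1
  have h2 : Nm v c (-c) := nm_neg_self hc
  have e : (-X * B) * c = (-c) * (X * B) := by ring
  have h3 := nm_xor (v := v) hc (mul_ne_zero (neg_ne_zero.2 hX) hB) hc
  rw [e, nm_xor hc (neg_ne_zero.2 hc) (mul_ne_zero hX hB), nm_xor hc hX hB, nm_comm hc hX] at h3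
  tauto

/-- elementary change of slot -/
def SlotRel {K : Type*} [Field K] (a b c e : K) : Prop :=
  (∃ p q r, c = a * p ^ 2 + b * q ^ 2 - a * b * r ^ 2 ∧ p ^ 2 - b * r ^ 2 ≠ 0 ∧ e = - (a * (p ^ 2 - b * r ^ 2)) * b) ∨
    (∃ q, c = b * q ^ 2 ∧ e = a) ∨ ((∃ p q, b = p ^ 2 - a * q ^ 2) ∧ e = 1)

theorem nm_mul_sq_right {K : Type*} [Field K] [NumberField K] {a b y : K} {v : Place K} (hy : y ≠ 0) :
    Nm v a (b * y ^ 2) ↔ Nm v a b := by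
  rw [mul_comm]
  exact nm_mul_iff (pow_ne_zero _ hy) (nm_of_sq (LSq.sq y))

theorem SlotRel.nm {K : Type u} [Field K] [NumberField K] {a b c e : K} (ha : a ≠ 0) (hb : b ≠ 0) (hc : c ≠ 0)
    (h : SlotRel a b c e) : e ≠ 0 ∧ ∀ v, Nm v a b ↔ Nm v c e := by
  rcases h with ⟨p, q, r, h1, h2, rfl⟩ | ⟨q, rfl, rfl⟩ | ⟨⟨p, q, rfl⟩, rfl⟩
  · set m := p ^ 2 - b * r ^ 2 with hm
    have hX : a * m ≠ 0 := mul_ne_zero ha h2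
    refine ⟨mul_ne_zero (neg_ne_zero.2 hX) hb, fun v => ?_⟩
    have h3 : Nm v m b := nm_symm hb h2 nm_norm
    have h4 : Nm v a b ↔ Nm v (a * m) b := by rw [nm_xor_left ha h2 hb]; tauto
    rw [h4]
    by_cases hq : q = 0
    · have : c = a * m := by rw [h1, hq, hm]; ring
      rw [this]
      exact (nm_mul_iff (neg_ne_zero.2 hX) (nm_neg_self hX)).symm
    · rw [← nm_mul_sq_right (b := b) hq, nm_sum (c := c) hX (mul_ne_zero hb (pow_ne_zero _ hq)) hc (by rw [h1, hm]; ring),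
        ← mul_assoc, nm_mul_sq_right hq]
  · have hq : q ≠ 0 := by rintro rfl; simp at hc
    refine ⟨ha, fun v => ?_⟩
    rw [nm_comm hc ha, nm_mul_sq_right hq]
  · exact ⟨one_ne_zero, fun v => iff_of_true nm_norm nm_one⟩

theorem slot {K : Type u} [Field K] [NumberField K] {a b c : K} (ha : a ≠ 0) (hb : b ≠ 0) (hc : c ≠ 0)
    (h : ∀ v, ¬ Nm v a b → ¬ Sq v c) : ∃ e, SlotRel a b c e := by
  obtain ⟨x, y, z, t, h1, h2⟩ := hm4 ha hb hc (fun v hv => by by_contra hn; exact h v hn hv)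
  by_cases ht : t = 0
  · subst ht
    refine ⟨1, Or.inr (Or.inr ⟨hasse_norm ha hb fun v => ?_, rfl⟩)⟩
    exact hm4_conv ha hb one_ne_zero (t := 0) h1 (by simpa using h2) v LSq.one
  · have h3 : c = a * (z / (a * t)) ^ 2 + b * (y / (b * t)) ^ 2 - a * b * (x / (a * b * t)) ^ 2 := by
      field_simp
      linear_combination h2
    generalize z / (a * t) = P at h3
    generalize y / (b * t) = Q at h3
    generalize x / (a * b * t) = R at h3
    by_cases hm : P ^ 2 - b * R ^ 2 = 0
    · by_cases hR : R = 0
      · subst hR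
        have hP : P = 0 := by simpa using hm
        exact ⟨a, Or.inr (Or.inl ⟨Q, by rw [h3, hP]; ring, rfl⟩)⟩
      · exact ⟨1, Or.inr (Or.inr ⟨⟨P / R, 0, by field_simp; linear_combination - hm⟩, rfl⟩)⟩
    · exact ⟨_, Or.inl ⟨P, Q, R, h3, hm, rfl⟩⟩

theorem exists_nonsq (K : Type*) [Field K] [NumberField K] : ∃ a : K, ¬ IsSquare a := by
  by_contra hcon
  push Not at hcon
  have h1 := index_SU (K := K) ∅
  have h2 : sqr (SU (∅ : Finset (FP K))) = ⊤ := by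
    rw [eq_top_iff]; intro x _; exact mem_sqr_SU.2 (hcon _)
  rw [h2, Subgroup.index_top, ← card_Pl] at h1
  have := card_Pl_pos (K := K) ∅
  have := Nat.one_lt_two_pow (n := (Pl (∅ : Finset (FP K))).card) (by omega)
  omega

theorem prod_index {K : Type u} [Field K] [NumberField K] {S : Finset (FP K)} (h2 : ∀ v ∉ S, ord v (2 : K) = 0) :
    ∏ v ∈ Pl S, (sqS v).index = 2 ^ (2 * (Pl S).card) := by
  classical
  obtain ⟨a, ha⟩ := exists_nonsq K
  obtain ⟨S', h0, _, _, _, _, _, _, h1, _⟩ := hasse_struct ha S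
  have h3 := Finset.prod_sdiff (f := fun v : Place K => (sqS v).index) (Pl_mono h0)
  rw [h1] at h3
  have h4 : ∏ v ∈ Pl S' \ Pl S, (sqS v).index ≤ ∏ v ∈ Pl S' \ Pl S, 4 := by
    refine Finset.prod_le_prod' fun v hv => ?_
    rw [Finset.mem_sdiff] at hv
    rcases v with v | v
    · exact index_odd (h2 v fun h => hv.2 (mem_Pl_inl.2 h))
    · exact absurd mem_Pl_inr hv.2
  have h5 := prod_index_le (K := K) S
  refine le_antisymm h5 ?_
  rw [Finset.prod_const, Finset.card_sdiff_of_subset (Pl_mono h0), show (4 : ℕ) = 2 ^ 2 by norm_num, ← pow_mul] at h4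
  have h6 := Finset.card_le_card (Pl_mono h0)
  have h7 : 2 ^ (2 * (Pl S').card) = 2 ^ (2 * ((Pl S').card - (Pl S).card)) * 2 ^ (2 * (Pl S).card) := by
    rw [← pow_add]; congr 1; omega
  rw [h7] at h3
  have h8 : 2 ^ (2 * ((Pl S').card - (Pl S).card)) * 2 ^ (2 * (Pl S).card) ≤
    2 ^ (2 * ((Pl S').card - (Pl S).card)) * ∏ v ∈ Pl S, (sqS v).index := by
    rw [← h3]; exact Nat.mul_le_mul_right _ h4
  exact Nat.le_of_mul_le_mul_left h8 (by positivity)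

theorem index_fin {K : Type u} [Field K] [NumberField K] (v : FP K) :
    (sqS (Sum.inl v : Place K)).index = 4 * (Ideal.absNorm v.asIdeal) ^ (e2 v) := by
  classical
  have h1 := prod_index (S := insert v (supp (2 : K))) (fun w hw => ord_of_supp fun h => hw (by simp [h]))
  have h2 := prod_bound_le (insert v (supp (2 : K)))
  rw [← h1, Pl, Finset.prod_disjSum] at h2
  by_contra hc
  have h3 := Finset.prod_lt_prod (s := insert v (supp (2 : K))) (f := fun w => (sqS (Sum.inl w : Place K)).index)
    (g := fun w => 4 * (Ideal.absNorm w.asIdeal) ^ (e2 w)) (fun w _ => Nat.pos_of_ne_zero (index_sqS_ne _))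
    (fun w _ => (index_sqS_fin w).2) ⟨v, by simp, lt_of_le_of_ne (index_sqS_fin v).2 hc⟩
  have h4 : 0 < ∏ v : InfinitePlace K, (sqS (Sum.inr v : Place K)).index :=
    Finset.prod_pos fun w _ => Nat.pos_of_ne_zero (index_sqS_ne _)
  exact absurd h2 (not_le.2 (Nat.mul_lt_mul_of_pos_right h3 h4))

theorem absNorm_ge {K : Type*} [Field K] [NumberField K] (v : FP K) : 2 ≤ Ideal.absNorm v.asIdeal := by
  have h0 : Ideal.absNorm v.asIdeal ≠ 0 := by
    rw [Ne, Ideal.absNorm_eq_zero_iff]; exact v.ne_bot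
  have h1 : Ideal.absNorm v.asIdeal ≠ 1 := by
    rw [Ne, Ideal.absNorm_eq_one_iff]; exact v.isPrime.ne_top
  omega

theorem index_fin_ge {K : Type u} [Field K] [NumberField K] (v : FP K) : 4 ≤ (sqS (Sum.inl v : Place K)).index := by
  rw [index_fin]
  have := Nat.one_le_pow (e2 v) (Ideal.absNorm v.asIdeal) (by have := absNorm_ge v; omega)
  omega

theorem index_dyadic {K : Type u} [Field K] [NumberField K] {v : FP K} (h : ord v (2 : K) ≠ 0) :
    8 ≤ (sqS (Sum.inl v : Place K)).index := by
  rw [index_fin]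
  have h1 := absNorm_ge v
  have h2 : e2 v ≠ 0 := by
    intro h3; apply h; rw [← e2_eq, h3]; rfl
  have := Nat.le_self_pow h2 (Ideal.absNorm v.asIdeal)
  omega
end ADQ

namespace ADQ
open NumberField IsDedekindDomain WithZero

/-- ramification sets of quaternion algebras -/
def RealSet {K : Type*} [Field K] [NumberField K] (δ : Finset (Place K)) : Prop :=
  ∃ a b : K, a ≠ 0 ∧ b ≠ 0 ∧ ∀ v, ¬ Nm v a b ↔ v ∈ δ

/-- non-complex place -/
def NC {K : Type*} [Field K] [NumberField K] (v : Place K) : Prop := ∃ x : K, x ≠ 0 ∧ ¬ Sq v x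

theorem RealSet.nc {K : Type u} [Field K] [NumberField K] {δ : Finset (Place K)} (h : RealSet δ) {v : Place K} (hv : v ∈ δ) : NC v := by
  obtain ⟨a, b, ha, hb, h⟩ := h
  exact ⟨a, ha, fun hs => (h v).2 hv (nm_of_sq_left ha hs)⟩

theorem RealSet.empty {K : Type u} [Field K] [NumberField K] : RealSet (∅ : Finset (Place K)) :=
  ⟨1, 1, one_ne_zero, one_ne_zero, fun v => by simp [nm_one]⟩

theorem slotSet {K : Type u} [Field K] [NumberField K] {δ : Finset (Place K)} (h : RealSet δ) {x : K} (hx : x ≠ 0)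
    (hs : ∀ v ∈ δ, ¬ Sq v x) : ∃ b, b ≠ 0 ∧ ∀ v, ¬ Nm v x b ↔ v ∈ δ := by
  obtain ⟨a, b, ha, hb, h⟩ := h
  obtain ⟨e, he⟩ := slot ha hb hx (fun v hv => hs v ((h v).1 hv))
  obtain ⟨he0, h1⟩ := he.nm ha hb hx
  exact ⟨e, he0, fun v => by rw [← h1, h]⟩

theorem exists_nonsq_at {K : Type u} [Field K] [NumberField K] {δ : Finset (Place K)} (h : ∀ v ∈ δ, NC v) :
    ∃ x : K, x ≠ 0 ∧ ∀ v ∈ δ, ¬ Sq v x := by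
  classical
  have : ∀ v : Place K, ∃ t : K, t ≠ 0 ∧ (v ∈ δ → ¬ Sq v t) := by
    intro v
    by_cases hv : v ∈ δ
    · obtain ⟨x, hx, h1⟩ := h v hv
      exact ⟨x, hx, fun _ => h1⟩
    · exact ⟨1, one_ne_zero, fun h => absurd h hv⟩
  choose t ht0 ht using this
  obtain ⟨x, hx, h1⟩ := weak_class δ t (fun v _ => ht0 v)
  exact ⟨x, hx, fun v hv hs => ht v hv (sq_congr hx (h1 v hv) hs)⟩

open Classical in
theorem RealSet.symm_diff {K : Type u} [Field K] [NumberField K] {δ δ' : Finset (Place K)} (h : RealSet δ) (h' : RealSet δ') :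
    RealSet (symmDiff δ δ') := by
  obtain ⟨x, hx, hs⟩ := exists_nonsq_at (δ := δ ∪ δ') (fun v hv => by
    rcases Finset.mem_union.1 hv with h1 | h1
    · exact h.nc h1
    · exact h'.nc h1)
  obtain ⟨b, hb, h1⟩ := slotSet h hx (fun v hv => hs v (Finset.mem_union_left _ hv))
  obtain ⟨b', hb', h1'⟩ := slotSet h' hx (fun v hv => hs v (Finset.mem_union_right _ hv))
  refine ⟨x, b * b', hx, mul_ne_zero hb hb', fun v => ?_⟩
  rw [nm_xor hx hb hb', Finset.mem_symmDiff, ← h1, ← h1']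
  tauto

theorem real_of_mem {K : Type u} [Field K] [NumberField K] {x : K} (hx : x ≠ 0) {S : Finset (FP K)}
    (h2 : ∀ v ∉ S, ord v (2 : K) = 0) (h3 : ∀ v ∉ S, ord v x = 0) {y : Kˣ}
    (hy : y ∈ SU S ⊔ infS (Pl S) (fun v => nmS v x)) {δ : Finset (Place K)} (hδ : δ ⊆ Pl S)
    (h : ∀ v ∈ Pl S, ¬ Nm v x y ↔ v ∈ δ) : RealSet δ := by
  obtain ⟨u, hu, r, hr, rfl⟩ := Subgroup.mem_sup.1 hy
  refine ⟨x, u, hx, u.ne_zero, fun v => ?_⟩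
  by_cases hv : v ∈ Pl S
  · rw [← h v hv, Units.val_mul, nm_xor hx u.ne_zero r.ne_zero]
    have : Nm v x r := mem_infS.1 hr v hv
    tauto
  · constructor
    · intro h1
      rcases v with v | v
      · have hv' : v ∉ S := fun h => hv (mem_Pl_inl.2 h)
        exact absurd (odd_unit_nm (h2 v hv') hx u.ne_zero (h3 v hv') (hu v hv')) h1
      · exact absurd mem_Pl_inr hv
    · intro h1
      exact absurd (hδ h1) hv

theorem mem_Pl_toLeft {K : Type u} [Field K] [NumberField K] {S : Finset (FP K)} {δ : Finset (Place K)} (h : δ.toLeft ⊆ S) : δ ⊆ Pl S := by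
  intro v hv
  rcases v with v | v
  · exact mem_Pl_inl.2 (h (Finset.mem_toLeft.2 hv))
  · exact mem_Pl_inr

open Classical in
theorem real_R1 {K : Type u} [Field K] [NumberField K] {δ δ' : Finset (Place K)} (hn : ∀ v ∈ δ, NC v) (hn' : ∀ v ∈ δ', NC v)
    (h : ¬ RealSet δ) (h' : ¬ RealSet δ') : RealSet (symmDiff δ δ') := by
  obtain ⟨x, hx, hs⟩ := exists_nonsq_at (δ := δ ∪ δ') (fun v hv => by
    rcases Finset.mem_union.1 hv with h1 | h1
    · exact hn v h1
    · exact hn' v h1)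
  have hne : δ.Nonempty := by
    rw [Finset.nonempty_iff_ne_empty]; rintro rfl; exact h RealSet.empty
  have hxs : ¬ IsSquare x := by
    obtain ⟨v, hv⟩ := hne
    rintro ⟨r, rfl⟩
    exact hs v (Finset.mem_union_left _ hv) (by rw [← sq]; exact LSq.sq r)
  obtain ⟨S, hS, -, h2, h3, -, hi, -, -, -⟩ := hasse_struct hxs (δ ∪ δ').toLeft
  have hsub := mem_Pl_toLeft hS
  have hδ : δ ⊆ Pl S := Finset.subset_union_left.trans hsub
  have hδ' : δ' ⊆ Pl S := Finset.subset_union_right.trans hsub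
  obtain ⟨y, hy, h4⟩ := exists_nm_class (Pl S) hx (fun v => v ∉ δ) (fun v _ h1 h5 => hs v (Finset.mem_union_left _ h5) h1)
  obtain ⟨y', hy', h4'⟩ := exists_nm_class (Pl S) hx (fun v => v ∉ δ') (fun v _ h1 h5 => hs v (Finset.mem_union_right _ h5) h1)
  have m1 : Units.mk0 y hy ∉ SU S ⊔ infS (Pl S) (fun v => nmS v x) := fun hm =>
    h (real_of_mem hx h2 h3 hm hδ (fun v hv => by rw [Units.val_mk0, h4 v hv, not_not]))
  have m2 : Units.mk0 y' hy' ∉ SU S ⊔ infS (Pl S) (fun v => nmS v x) := fun hm =>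
    h' (real_of_mem hx h2 h3 hm hδ' (fun v hv => by rw [Units.val_mk0, h4' v hv, not_not]))
  have m3 : Units.mk0 y hy * Units.mk0 y' hy' ∈ SU S ⊔ infS (Pl S) (fun v => nmS v x) := by
    rw [Subgroup.mul_mem_iff_of_index_two hi]; tauto
  refine real_of_mem hx h2 h3 m3 ?_ ?_
  · intro v hv
    rw [Finset.mem_symmDiff] at hv
    rcases hv with hv | hv
    · exact hδ hv.1
    · exact hδ' hv.1
  · intro v hv
    rw [Units.val_mul, Units.val_mk0, Units.val_mk0, nm_xor hx hy hy', h4 v hv, h4' v hv, Finset.mem_symmDiff]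
    tauto

open Classical in
theorem real_symmDiff_iff {K : Type u} [Field K] [NumberField K] {δ δ' : Finset (Place K)} (hn : ∀ v ∈ δ, NC v) (hn' : ∀ v ∈ δ', NC v) :
    RealSet (symmDiff δ δ') ↔ (RealSet δ ↔ RealSet δ') := by
  constructor
  · intro h
    constructor
    · intro h1
      have := h1.symm_diff h
      rwa [symmDiff_symmDiff_cancel_left] at this
    · intro h1
      have := h.symm_diff h1
      rwa [symmDiff_symmDiff_cancel_right] at this
  · intro h
    by_cases h1 : RealSet δ
    · exact h1.symm_diff (h.1 h1)
    · exact real_R1 hn hn' h1 (fun h2 => h1 (h.2 h2))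

theorem insert_eq_symmDiff {X : Type*} [DecidableEq X] {w : X} {δ : Finset X} (h : w ∉ δ) : insert w δ = symmDiff {w} δ := by
  ext v
  rw [Finset.mem_symmDiff, Finset.mem_insert, Finset.mem_singleton]
  by_cases hv : v = w
  · subst hv; simp [h]
  · simp [hv]

open Classical in
theorem parity {K : Type u} [Field K] [NumberField K] (δ : Finset (Place K)) (hn : ∀ v ∈ δ, NC v) :
    RealSet δ ↔ Even (δ.filter (fun w => ¬ RealSet {w})).card := by
  induction δ using Finset.induction_on with
  | empty => simp [RealSet.empty]
  | insert w δ hw ih =>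
    have ih := ih (fun v hv => hn v (Finset.mem_insert_of_mem hv))
    rw [insert_eq_symmDiff hw, real_symmDiff_iff (by intro v hv; rw [Finset.mem_singleton] at hv; subst hv; exact hn _ (Finset.mem_insert_self _ _))
      (fun v hv => hn v (Finset.mem_insert_of_mem hv)), ih, ← insert_eq_symmDiff hw, Finset.filter_insert]
    split_ifs with h
    · tauto
    · rw [Finset.card_insert_of_notMem (by simp [hw]), Nat.even_add_one]
      tauto

theorem real_R2 {K : Type u} [Field K] [NumberField K] {x : K} (hx : ¬ IsSquare x) : ∃ w, ¬ Sq w x ∧ ¬ RealSet {w} := by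
  classical
  by_contra hcon
  push Not at hcon
  have hx0 := isSquare_ne hx
  obtain ⟨S, -, -, h2, h3, -, hi, -, -, hl⟩ := hasse_struct hx ∅
  set M := SU S ⊔ infS (Pl S) (fun v => nmS v x) with hM
  have : ∃ y : Kˣ, y ∉ M := by
    by_contra hc
    push Not at hc
    have : M = ⊤ := by ext y; simp [hc]
    rw [this] at hi; simp at hi
  obtain ⟨y, hy⟩ := this
  set δ := (Pl S).filter (fun v => ¬ Nm v x y)
  have hδ : ∀ v ∈ δ, ¬ Sq v x := fun v hv hs => (Finset.mem_filter.1 hv).2 (nm_of_sq_left hx0 hs)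
  have hr : ∀ δ : Finset (Place K), (∀ v ∈ δ, ¬ Sq v x) → RealSet δ := by
    intro δ hδ
    rw [parity δ (fun v hv => ⟨x, hx0, hδ v hv⟩)]
    rw [Finset.filter_false_of_mem]
    · simp
    · intro v hv; rw [not_not]; exact hcon v (hδ v hv)
  obtain ⟨b, hb, h4⟩ := slotSet (hr δ hδ) hx0 hδ
  have hbM : Units.mk0 b hb ∈ M := by
    refine hl _ (fun v hv => ?_)
    by_contra h5
    exact hv (mem_Pl_inl.1 (Finset.mem_filter.1 ((h4 _).1 h5)).1)
  have hyb : y * Units.mk0 b hb ∈ M := by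
    refine Subgroup.mem_sup_right (mem_infS.2 fun v hv => ?_)
    rw [mem_nmS, Units.val_mul, Units.val_mk0, nm_xor hx0 y.ne_zero hb]
    have := h4 v
    rw [Finset.mem_filter] at this
    tauto
  exact hy ((Subgroup.mul_mem_cancel_right _ hbM).1 hyb)

open Classical in
/-- local symbol with values in `ℂˣ` -/
noncomputable def sg {K : Type u} [Field K] [NumberField K] (w : Place K) (u : Kˣ) : Kˣ →* ℂˣ :=
  MonoidHom.mk' (fun y => if Nm w (u : K) y then 1 else -1) (by
    intro y z
    rw [Units.val_mul, show Nm w (u : K) (y * z) ↔ _ from nm_xor u.ne_zero y.ne_zero z.ne_zero]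
    by_cases h1 : Nm w (u : K) y <;> by_cases h2 : Nm w (u : K) z <;> simp [h1, h2])

open Classical in
theorem sg_apply {K : Type u} [Field K] [NumberField K] (w : Place K) (u y : Kˣ) : sg w u y = if Nm w (u : K) y then 1 else -1 := rfl

theorem neg_one_ne {F : Type*} : ((-1 : ℂˣ)) ≠ 1 := by
  intro h
  have := congrArg Units.val h
  norm_num at this

theorem sg_eq_one {K : Type u} [Field K] [NumberField K] {w : Place K} {u y : Kˣ} : sg w u y = 1 ↔ Nm w (u : K) y := by
  rw [sg_apply]
  split_ifs with h
  · simp [h]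
  · simp [h, neg_one_ne (F := ℂ)]

theorem sg_mul_left {K : Type u} [Field K] [NumberField K] {w : Place K} {u u' y : Kˣ} : sg w (u * u') y = sg w u y * sg w u' y := by
  simp only [sg_apply]
  rw [Units.val_mul, nm_xor_left u.ne_zero u'.ne_zero y.ne_zero]
  by_cases h1 : Nm w (u : K) y <;> by_cases h2 : Nm w (u' : K) y <;> simp [h1, h2]

theorem sg_sq {K : Type u} [Field K] [NumberField K] {w : Place K} {u y : Kˣ} : sg w u y * sg w u y = 1 := by
  rw [sg_apply]; split_ifs <;> simp

/-- character attached to `u` -/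
noncomputable def chi {K : Type u} [Field K] [NumberField K] (F : Finset (Place K)) (u : Kˣ) : Kˣ →* ℂˣ := ∏ w ∈ F, sg w u

theorem chi_apply {K : Type u} [Field K] [NumberField K] (F : Finset (Place K)) (u y : Kˣ) : chi F u y = ∏ w ∈ F, sg w u y := by
  simp [chi, MonoidHom.finset_prod_apply]

open Classical in
theorem chi_even {K : Type u} [Field K] [NumberField K] (F : Finset (Place K)) (u y : Kˣ)
    (h : Even (F.filter (fun w => ¬ Nm w (u : K) y)).card) : chi F u y = 1 := by
  rw [chi_apply]
  simp only [sg_apply]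
  rw [Finset.prod_ite]
  simp [h.neg_one_pow]

theorem finite_W {K : Type u} [Field K] [NumberField K] (S0 : Finset (FP K)) : ∃ W : Finset (Place K), (∀ w ∈ W, ¬ RealSet {w}) ∧
    ∀ x ∈ SU S0, ¬ IsSquare (x : K) → ∃ w ∈ W, ¬ Sq w (x : K) := by
  classical
  have hfi : (sqr (SU S0)).index ≠ 0 := by rw [index_SU]; positivity
  have hfin : Finite (SU S0 ⧸ sqr (SU S0)) := by
    have : (sqr (SU S0)).FiniteIndex := ⟨hfi⟩
    infer_instance
  have := Fintype.ofFinite (SU S0 ⧸ sqr (SU S0))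
  have key : ∀ q : SU S0 ⧸ sqr (SU S0), ∃ W : Finset (Place K), (∀ w ∈ W, ¬ RealSet {w}) ∧
      (¬ IsSquare (q.out.1 : K) → ∃ w ∈ W, ¬ Sq w (q.out.1 : K)) := by
    intro q
    by_cases h : IsSquare (q.out.1 : K)
    · exact ⟨∅, by simp, fun h' => absurd h h'⟩
    · obtain ⟨w, h1, h2⟩ := real_R2 h
      refine ⟨{w}, by simpa using h2, fun _ => ⟨w, by simp, h1⟩⟩
  choose W hW1 hW2 using key
  refine ⟨Finset.univ.biUnion W, ?_, ?_⟩
  · intro w hw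
    obtain ⟨q, _, hq⟩ := Finset.mem_biUnion.1 hw
    exact hW1 q w hq
  · intro x hx hns
    set q : SU S0 ⧸ sqr (SU S0) := QuotientGroup.mk (⟨x, hx⟩ : SU S0) with hq
    have h1 : (⟨x, hx⟩ : SU S0)⁻¹ * q.out ∈ sqr (SU S0) := by
      rw [← QuotientGroup.eq]; exact (QuotientGroup.out_eq' q).symm
    rw [mem_sqr_SU] at h1
    obtain ⟨r, hr⟩ := h1
    have hr' : (q.out.1 : K) = x * r ^ 2 := by
      rw [sq, ← hr]
      simp
    have hr0 : r ≠ 0 := by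
      rintro rfl
      rw [zero_pow two_ne_zero, mul_zero] at hr'
      exact Units.ne_zero _ hr'
    obtain ⟨w, hw, h2⟩ := hW2 q (by
      rw [hr']; exact fun h => hns (isSquare_of_mul h hr0))
    refine ⟨w, Finset.mem_biUnion.2 ⟨q, Finset.mem_univ _, hw⟩, ?_⟩
    rw [hr'] at h2
    exact fun h => h2 ((LSq.mul_sq_iff hr0).2 h)

theorem no_real_single {K : Type u} [Field K] [NumberField K] (v : Place K) : ¬ RealSet {v} := by
  classical
  intro hv
  have hvn : NC v := hv.nc (by simp)
  obtain ⟨S0, hS0, hP⟩ := exists_PS ((({v} : Finset (Place K)).toLeft) ∪ supp (2 : K))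
  obtain ⟨W, hW1, hW2⟩ := finite_W S0
  set S := S0 ∪ W.toLeft with hS
  set F := (Pl S).filter (fun w => ¬ RealSet {w}) with hF
  have h2 : ∀ v ∉ S, ord v (2 : K) = 0 := fun v hv => ord_of_supp fun h =>
    hv (Finset.mem_union_left _ (hS0 (Finset.mem_union_right _ h)))
  have hWF : W ⊆ F := fun w hw => Finset.mem_filter.2
    ⟨mem_Pl_toLeft (Finset.subset_union_right) hw, hW1 w hw⟩
  have hvS : v ∈ Pl S := mem_Pl_toLeft (S := S) (δ := {v}) (fun w hw =>
    Finset.mem_union_left _ (hS0 (Finset.mem_union_left _ hw))) (by simp)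
  -- squares
  have hQ : ∀ u ∈ SU S, (∀ w ∈ F, Sq w (u : K)) → IsSquare (u : K) := by
    intro u hu hsq
    obtain ⟨c, hc, hc1⟩ := hP.exists_ord (fun v => -(ord v (u : K) / 2)) (by
      refine (Finset.finite_toSet S).subset ?_
      rintro w ⟨_, hw⟩
      by_contra hwS
      rw [hu w hwS] at hw
      simp at hw)
    have hev : ∀ w ∉ S0, Even (ord w (u : K)) := by
      intro w hw
      by_cases hwS : w ∈ S
      · have : w ∈ W.toLeft := by
          rcases Finset.mem_union.1 hwS with h | h
          · exact absurd h hw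
          · exact h
        exact lsq_even u.ne_zero (hsq _ (hWF (Finset.mem_toLeft.1 this)))
      · rw [hu w hwS]; exact Even.zero
    have hmem : u * (Units.mk0 c hc) ^ 2 ∈ SU S0 := by
      intro w hw
      rw [Units.val_mul, Units.val_pow_eq_pow_val, Units.val_mk0, ord_mul w u.ne_zero (pow_ne_zero 2 hc), ord_sq w hc, hc1 w hw]
      obtain ⟨k, hk⟩ := hev w hw
      omega
    refine isSquare_of_mul (y := c) ?_ hc
    by_contra hns
    obtain ⟨w, hw, h3⟩ := hW2 _ hmem (by simpa using hns)
    apply h3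
    rw [Units.val_mul, Units.val_pow_eq_pow_val, Units.val_mk0]
    exact (LSq.mul_sq_iff hc).2 (hsq w (hWF hw))
  set Q := infS F (fun w => sqS w) with hQd
  set W' := SU S ⊔ Q with hW'
  have hsub : Q.subgroupOf (SU S) = sqr (SU S) := by
    ext x
    rw [Subgroup.mem_subgroupOf, mem_sqr_SU]
    constructor
    · intro h
      exact hQ x.1 x.2 (fun w hw => mem_infS.1 h w hw)
    · rintro ⟨r, hr⟩
      refine mem_infS.2 fun w hw => ?_
      rw [mem_sqS, hr, ← sq]
      exact LSq.sq r
  have e1 : 2 ^ (Pl S).card * W'.index = Q.index := by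
    have h3 := Subgroup.relIndex_mul_index (H := Q) (K := W') le_sup_right
    rw [hW', Subgroup.relIndex_sup_right, Subgroup.relIndex, hsub, index_SU, ← card_Pl] at h3
    exact h3
  have e2 : Q.index = ∏ w ∈ F, (sqS w).index := index_infS F _ (fun _ => le_rfl)
  have e3 : (∏ w ∈ F, (sqS w).index) * 2 ≤ 2 ^ (2 * (Pl S).card) := by
    rw [← prod_index h2, ← Finset.prod_filter_mul_prod_filter_not (Pl S) (fun w => ¬ RealSet {w})]
    refine Nat.mul_le_mul_left _ ?_
    have hvm : v ∈ (Pl S).filter (fun w => ¬ ¬ RealSet {w}) := Finset.mem_filter.2 ⟨hvS, not_not.2 hv⟩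
    have h4 : 2 ≤ (sqS v).index := by
      have h5 := index_sqS_ne v
      have h6 : (sqS v).index ≠ 1 := by
        intro h
        rw [Subgroup.index_eq_one] at h
        obtain ⟨x, hx, hxs⟩ := hvn
        have : Units.mk0 x hx ∈ sqS v := by rw [h]; trivial
        exact hxs this
      omega
    exact h4.trans (Finset.single_le_prod' (f := fun w => (sqS w).index) (fun w _ => Nat.one_le_iff_ne_zero.2 (index_sqS_ne w)) hvm)
  have hQne : Q.index ≠ 0 := by rw [e2]; exact Finset.prod_ne_zero_iff.2 fun w _ => index_sqS_ne w
  have hW'ne : W'.index ≠ 0 := by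
    intro h; rw [h, mul_zero] at e1; exact hQne e1.symm
  have : W'.FiniteIndex := ⟨hW'ne⟩
  have hker : ∀ u ∈ SU S, W' ≤ (chi F u).ker := by
    intro u hu
    refine sup_le ?_ ?_
    · intro y hy
      rw [MonoidHom.mem_ker]
      apply chi_even
      have hr : RealSet ((Pl S).filter (fun w => ¬ Nm w (u : K) y)) := by
        refine ⟨u, y, u.ne_zero, y.ne_zero, fun w => ?_⟩
        rw [Finset.mem_filter]
        refine ⟨fun h => ⟨?_, h⟩, fun h => h.2⟩
        rcases w with w | w
        · by_contra hw
          have hw' : w ∉ S := fun h => hw (mem_Pl_inl.2 h)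
          exact h (odd_unit_nm (h2 w hw') u.ne_zero y.ne_zero (hu w hw') (hy w hw'))
        · exact mem_Pl_inr
      have := (parity _ (fun w hw => hr.nc hw)).1 hr
      convert this using 2
      ext w
      simp only [hF, Finset.mem_filter]
      tauto
    · intro y hy
      rw [MonoidHom.mem_ker, chi_apply]
      exact Finset.prod_eq_one fun w hw => sg_eq_one.2 (nm_of_sq (mem_infS.1 hy w hw))
  have hexp : NeZero (Monoid.exponent (Kˣ ⧸ W')) := ⟨by
    have := Monoid.exponent_ne_zero_of_finite (G := Kˣ ⧸ W')
    exact this⟩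
  have hcard := CommGroup.card_monoidHom_of_hasEnoughRootsOfUnity (Kˣ ⧸ W') ℂ
  have hfinX : Finite ((Kˣ ⧸ W') →* ℂˣ) := by
    apply Nat.finite_of_card_ne_zero
    rw [hcard]
    exact Nat.card_pos.ne'
  have h7 := (index_le_of_inj (sqr (SU S)) (X := (Kˣ ⧸ W') →* ℂˣ)
    (fun u => QuotientGroup.lift W' (chi F u.1) (hker u.1 u.2)) (by
    intro x y hxy
    have hc : ∀ t, chi F x.1 t = chi F y.1 t := fun t => by
      have := DFunLike.congr_fun hxy (QuotientGroup.mk t)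
      simpa using this
    have hc1 : ∀ t, chi F (x.1 * y.1) t = 1 := by
      intro t
      have : chi F (x.1 * y.1) t = chi F x.1 t * chi F y.1 t := by
        simp only [chi_apply, sg_mul_left, Finset.prod_mul_distrib]
      rw [this, hc, chi_apply, ← Finset.prod_mul_distrib]
      exact Finset.prod_eq_one fun w hw => sg_sq
    have hsq : ∀ w ∈ F, Sq w ((x.1 * y.1 : Kˣ) : K) := by
      intro w hw
      refine nondeg (Units.ne_zero _) fun t ht => ?_
      obtain ⟨z, hz, hz1⟩ := weak_class F (fun w' => if w' = w then t else 1) (by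
        intro w' _; split_ifs; exacts [ht, one_ne_zero])
      have h8 := hc1 (Units.mk0 z hz)
      rw [chi_apply, Finset.prod_eq_single_of_mem w hw] at h8
      · have h9 := sg_eq_one.1 h8
        refine nm_congr_right hz ?_ h9
        have := hz1 w hw
        rw [if_pos rfl] at this
        rw [mul_comm]; exact this
      · intro w' hw' hne
        refine sg_eq_one.2 (nm_of_sq ?_)
        have := hz1 w' hw'
        rw [if_neg hne, mul_one] at this
        exact this
    have h10 := hQ _ (mul_mem x.2 y.2) hsq
    rw [mem_sqr_SU]
    obtain ⟨r, hr⟩ := h10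
    refine ⟨r / x.1, ?_⟩
    have hx0 := x.1.ne_zero
    have : (((x⁻¹ * y : SU S) : Kˣ) : K) = (x.1 : K)⁻¹ * y.1 := by simp
    rw [this]
    rw [Units.val_mul] at hr
    field_simp
    rw [sq, ← hr])).2
  rw [hcard, index_SU, ← card_Pl] at h7
  have h8 : Nat.card (Kˣ ⧸ W') = W'.index := rfl
  rw [h8] at h7
  have h9 : 0 < 2 ^ (Pl S).card := by positivity
  rw [← e2, ← e1, two_mul, pow_add] at e3
  nlinarith

theorem real_iff {K : Type u} [Field K] [NumberField K] (δ : Finset (Place K)) (hn : ∀ v ∈ δ, NC v) :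
    RealSet δ ↔ Even δ.card := by
  classical
  rw [parity δ hn, Finset.filter_true_of_mem (fun v _ => no_real_single v)]

/-- (C1) -/
theorem exists_ram_pair {K : Type u} [Field K] [NumberField K] {v w : Place K} (hv : NC v) (hw : NC w) (h : v ≠ w) :
    ∃ a b : K, a ≠ 0 ∧ b ≠ 0 ∧ ∀ u, ¬ Nm u a b ↔ (u = v ∨ u = w) := by
  classical
  have := (real_iff {v, w} (by intro u hu; simp at hu; rcases hu with rfl | rfl <;> assumption)).2
    (by rw [Finset.card_pair h]; exact even_two)
  obtain ⟨a, b, ha, hb, h1⟩ := this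
  exact ⟨a, b, ha, hb, fun u => by rw [h1]; simp⟩

/-- (C2) -/
theorem exists_other_ram {K : Type u} [Field K] [NumberField K] {a b : K} (ha : a ≠ 0) (hb : b ≠ 0) {v : Place K} (h : ¬ Nm v a b) :
    ∃ w, w ≠ v ∧ ¬ Nm w a b := by
  by_contra hc
  push Not at hc
  refine no_real_single v ⟨a, b, ha, hb, fun w => ?_⟩
  rw [Finset.mem_singleton]
  constructor
  · intro h1; by_contra h2; exact h1 (hc w h2)
  · rintro rfl; exact h

end ADQ

namespace ADQ
open NumberField IsDedekindDomain WithZero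

/-- isotropy of a diagonal form -/
def Iso {K : Type*} [Field K] {n : ℕ} (c : Fin n → K) : Prop := ∃ x : Fin n → K, x ≠ 0 ∧ ∑ i, c i * x i ^ 2 = 0

theorem bin_cont {K : Type*} [Field K] (f : AbsoluteValue K ℝ) (a b X Y : K) {ε : ℝ} (hε : 0 < ε) :
    ∃ δ > 0, ∀ x y, f (x - X) < δ → f (y - Y) < δ → f (a * x ^ 2 + b * y ^ 2 - (a * X ^ 2 + b * Y ^ 2)) < ε := by
  set M := f a * (2 * f X + 1) + f b * (2 * f Y + 1) + 1 with hM
  have h1 := f.nonneg a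
  have h2 := f.nonneg b
  have h3 := f.nonneg X
  have h4 := f.nonneg Y
  have hM0 : 0 < M := by positivity
  have key : ∀ x X : K, ∀ δ, 0 < δ → δ ≤ 1 → f (x - X) < δ → f (x ^ 2 - X ^ 2) ≤ δ * (2 * f X + 1) := by
    intro x X δ h0 hδ h
    have e : x ^ 2 - X ^ 2 = (x - X) * ((x - X) + (X + X)) := by ring
    rw [e, map_mul]
    have := f.add_le (x - X) (X + X)
    have := f.add_le X X
    have := f.nonneg X
    exact mul_le_mul h.le (by linarith) (f.nonneg _) h0.le
  refine ⟨min 1 (ε / M), by positivity, fun x y hx hy => ?_⟩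
  have hp : 0 < min 1 (ε / M) := by positivity
  have k1 := key x X _ hp (min_le_left _ _) hx
  have k2 := key y Y _ hp (min_le_left _ _) hy
  have e : a * x ^ 2 + b * y ^ 2 - (a * X ^ 2 + b * Y ^ 2) = a * (x ^ 2 - X ^ 2) + b * (y ^ 2 - Y ^ 2) := by ring
  rw [e]
  calc f (a * (x ^ 2 - X ^ 2) + b * (y ^ 2 - Y ^ 2)) ≤ f (a * (x ^ 2 - X ^ 2)) + f (b * (y ^ 2 - Y ^ 2)) := f.add_le _ _
    _ = f a * f (x ^ 2 - X ^ 2) + f b * f (y ^ 2 - Y ^ 2) := by rw [map_mul, map_mul]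
    _ ≤ f a * (min 1 (ε / M) * (2 * f X + 1)) + f b * (min 1 (ε / M) * (2 * f Y + 1)) := by gcongr
    _ = min 1 (ε / M) * (M - 1) := by rw [hM]; ring
    _ < min 1 (ε / M) * M := by apply mul_lt_mul_of_pos_left _ hp; linarith
    _ ≤ ε / M * M := by gcongr; exact min_le_right _ _
    _ = ε := by field_simp

theorem bin_approx {K : Type u} [Field K] [NumberField K] {a b : K} (ha : a ≠ 0) (F : Finset (Place K)) (t : Place K → K)
    (ht : ∀ v ∈ F, t v ≠ 0 ∧ Nm v (-(a * b)) (a * t v)) :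
    ∃ x y, a * x ^ 2 + b * y ^ 2 ≠ 0 ∧ ∀ v ∈ F, Sq v ((a * x ^ 2 + b * y ^ 2) * t v) := by
  classical
  have key : ∀ v : Place K, ∃ X Y : K, ∃ δ > 0, v ∈ F → ∀ x y, av v (x - X) < δ → av v (y - Y) < δ →
      a * x ^ 2 + b * y ^ 2 ≠ 0 ∧ Sq v ((a * x ^ 2 + b * y ^ 2) * t v) := by
    intro v
    by_cases hv : v ∈ F
    · obtain ⟨h0, X, Y, h1, h2⟩ := ht v hv
      have e : a * (X / a) ^ 2 + b * Y ^ 2 = (X ^ 2 - -(a * b) * Y ^ 2) / a := by field_simp; ring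
      have hne : a * (X / a) ^ 2 + b * Y ^ 2 ≠ 0 := by rw [e]; exact div_ne_zero h1 ha
      obtain ⟨ε, hε, h3⟩ := (openSq v).near hne
      obtain ⟨δ, hδ, h4⟩ := bin_cont (av v) a b (X / a) Y hε
      refine ⟨X / a, Y, δ, hδ, fun _ x y hx hy => ?_⟩
      obtain ⟨h5, h6⟩ := h3 _ (h4 x y hx hy)
      refine ⟨h5, sq_mul3 hne h6 ?_⟩
      rw [e, show (X ^ 2 - -(a * b) * Y ^ 2) / a * t v = a * t v * (X ^ 2 - -(a * b) * Y ^ 2) * (1 / a) ^ 2 by field_simp]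
      exact h2.mul (LSq.sq _)
    · exact ⟨0, 0, 1, one_pos, fun h => absurd h hv⟩
  choose X Y δ hδ h using key
  obtain ⟨x, hx⟩ := weak_approx F X δ hδ
  obtain ⟨y, hy⟩ := weak_approx F Y δ hδ
  by_cases hF : F.Nonempty
  · obtain ⟨v, hv⟩ := hF
    exact ⟨x, y, (h v hv x y (hx v hv) (hy v hv)).1, fun v hv => (h v hv x y (hx v hv) (hy v hv)).2⟩
  · rw [Finset.not_nonempty_iff_eq_empty] at hF
    subst hF
    exact ⟨1, 0, by simpa using ha, by simp⟩

theorem iso4_iff {K : Type u} [Field K] [NumberField K] {c : Fin 4 → K} (hc : ∀ i, c i ≠ 0) :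
    Iso c ↔ ∀ v, Sq v (c 0 * c 1 * c 2 * c 3) → Nm v (-(c 1 * c 2)) (-(c 1 * c 3)) := by
  have h0 := hc 0
  have h1 := hc 1
  have h2 := hc 2
  have h3 := hc 3
  have ha : -(c 1 * c 2) ≠ 0 := neg_ne_zero.2 (mul_ne_zero h1 h2)
  have hb : -(c 1 * c 3) ≠ 0 := neg_ne_zero.2 (mul_ne_zero h1 h3)
  have hd : c 0 * c 1 * c 2 * c 3 ≠ 0 := by simp [hc]
  constructor
  · rintro ⟨x, hx, h⟩ v hv
    rw [Fin.sum_univ_four] at h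
    refine hm4_conv ha hb hd (x := c 1 * x 1) (y := x 2) (z := x 3) (t := x 0 / (c 1 * c 2 * c 3)) ?_ ?_ v hv
    · rintro ⟨e1, e2, e3, e0⟩
      apply hx
      have e1' : x 1 = 0 := by simpa [h1] using e1
      have e0' : x 0 = 0 := by simpa [h1, h2, h3] using e0
      ext i
      fin_cases i <;> simpa
    · field_simp
      linear_combination c 1 * h
  · intro h
    obtain ⟨x, y, z, t, hne, h4⟩ := hm4 ha hb hd h
    refine ⟨![t * (c 1 * c 2 * c 3), x / c 1, y, z], ?_, ?_⟩
    · intro h5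
      have e0 := congrFun h5 0
      have e1 := congrFun h5 1
      have e2 := congrFun h5 2
      have e3 := congrFun h5 3
      simp [h1, h2, h3] at e0 e1 e2 e3
      exact hne ⟨e1, e2, e3, e0⟩
    · rw [Fin.sum_univ_four]
      simp
      field_simp
      linear_combination h4

theorem glue {K : Type*} [Field K] {n : ℕ} {c : Fin (n + 2) → K} {x y : K} (ht : c 0 * x ^ 2 + c 1 * y ^ 2 ≠ 0)
    (h : Iso (Fin.cons (c 0 * x ^ 2 + c 1 * y ^ 2) (fun i => c i.succ.succ) : Fin (n + 1) → K)) : Iso c := by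
  obtain ⟨z, hz, h⟩ := h
  refine ⟨Fin.cons (x * z 0) (Fin.cons (y * z 0) (fun i => z i.succ)), ?_, ?_⟩
  · intro h1
    apply hz
    have e0 := congrFun h1 0
    have e1 := congrFun h1 1
    rw [show (1 : Fin (n + 2)) = Fin.succ 0 from rfl] at e1
    simp only [Fin.cons_zero, Fin.cons_succ, Pi.zero_apply] at e0 e1
    have hz0 : z 0 = 0 := by
      by_contra hz0
      simp [hz0] at e0 e1
      simp [e0, e1] at ht
    ext i
    refine Fin.cases hz0 (fun j => ?_) i
    have := congrFun h1 j.succ.succ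
    simpa only [Fin.cons_succ, Pi.zero_apply] using this
  · rw [Fin.sum_univ_succ] at h
    rw [Fin.sum_univ_succ, Fin.sum_univ_succ]
    simp only [Fin.cons_zero, Fin.cons_succ] at h ⊢
    rw [← h, show Fin.succ 0 = (1 : Fin (n + 2)) from rfl]
    ring

/-- indefinite at `v` -/
def Ind {K : Type*} [Field K] [NumberField K] (v : Place K) {n : ℕ} (c : Fin n → K) : Prop := ∃ i j, ¬ Sq v (c i * c j)

theorem Ind.exists_right {K : Type*} [Field K] [NumberField K] {v : Place K} {n : ℕ} {c : Fin n → K} (h : Ind v c) {k : K}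
    (hk : k ≠ 0) : ∃ i, ¬ Sq v (c i * k) := by
  obtain ⟨i, j, h⟩ := h
  by_contra hc
  push Not at hc
  exact h (sq_mul3 hk (hc i) (by rw [mul_comm]; exact hc j))

theorem real_neg {K : Type*} [Field K] [NumberField K] {v : InfinitePlace K} (hv : v.IsReal) {x : K} (h : ¬ Sq (Sum.inr v) x) : Sq (Sum.inr v) (-x) := by
  unfold Sq at h ⊢
  rw [lsq_real hv] at h ⊢
  rw [map_neg]; linarith

theorem real_tau {K : Type u} [Field K] [NumberField K] {v : Place K} {n : ℕ} {c : Fin (n + 2) → K} (hc : ∀ i, c i ≠ 0)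
    (hi : Ind v c) (hn : ¬ Ind v (fun i : Fin n => c i.succ.succ)) (j : Fin n) :
    ∃ t, t ≠ 0 ∧ Nm v (-(c 0 * c 1)) (c 0 * t) ∧ ¬ Sq v (t * c j.succ.succ) := by
  obtain ⟨i, hi⟩ := hi.exists_right (hc j.succ.succ)
  revert hi
  refine Fin.cases (fun h => ?_) (fun i => Fin.cases (fun h => ?_) (fun i h => ?_) i) i
  · exact ⟨c 0, hc 0, nm_of_sq (by rw [← sq]; exact LSq.sq _), h⟩
  · refine ⟨c 1, hc 1, ?_, h⟩
    have := nm_neg_self (v := v) (a := -(c 0 * c 1)) (by simp [hc])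
    rwa [neg_neg] at this
  · exact absurd ⟨i, j, h⟩ hn

theorem fin_tau {K : Type u} [Field K] [NumberField K] {v : FP K} {a b e : K} (ha : a ≠ 0) (hb : b ≠ 0) (he : e ≠ 0) :
    ∃ t, t ≠ 0 ∧ Nm (Sum.inl v) (-(a * b)) (a * t) ∧ ¬ Sq (Sum.inl v) (t * e) := by
  by_contra hc
  push Not at hc
  have hab : -(a * b) ≠ 0 := neg_ne_zero.2 (mul_ne_zero ha hb)
  have hae : Sq (Sum.inl v) (a * e) := hc a ha (nm_of_sq (by rw [← sq]; exact LSq.sq _))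
  have hle : nmS (Sum.inl v : Place K) (-(a * b)) ≤ sqS (Sum.inl v) := by
    intro y hy
    have := hc (a * y) (mul_ne_zero ha y.ne_zero) (by
      rw [show a * (a * (y : K)) = y * a ^ 2 by ring]
      exact (nm_mul_sq_right ha).2 hy)
    rw [mul_right_comm] at this
    exact LSq.of_mul_left (mul_ne_zero ha he) hae this
  have h1 := Subgroup.index_dvd_of_le hle
  have h2 := index_fin_ge v
  have h3 : (nmS (Sum.inl v : Place K) (-(a * b))).index ≤ 2 ∧ (nmS (Sum.inl v : Place K) (-(a * b))).index ≠ 0 := by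
    by_cases hs : Sq (Sum.inl v) (-(a * b))
    · rw [nm_index_one hab hs]; omega
    · rw [nm_index_two hab hs]; omega
  have := Nat.le_of_dvd (Nat.pos_of_ne_zero h3.2) h1
  omega

theorem iso5 {K : Type u} [Field K] [NumberField K] {c : Fin 5 → K} (hc : ∀ i, c i ≠ 0)
    (hi : ∀ w : InfinitePlace K, w.IsReal → Ind (Sum.inr w) c) : Iso c := by
  classical
  set S : Finset (FP K) := supp (2 : K) ∪ Finset.univ.biUnion (fun i => supp (c i)) with hS
  have hS2 : ∀ v ∉ S, ord v (2 : K) = 0 := fun v hv => ord_of_supp fun h => hv (Finset.mem_union_left _ h)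
  have hSc : ∀ v ∉ S, ∀ i, ord v (c i) = 0 := fun v hv i => ord_of_supp fun h => hv
    (Finset.mem_union_right _ (Finset.mem_biUnion.2 ⟨i, Finset.mem_univ _, h⟩))
  have ha : -(c 2 * c 3) ≠ 0 := by simp [hc]
  have hb : -(c 2 * c 4) ≠ 0 := by simp [hc]
  have hcc : c 2 * c 3 * c 4 ≠ 0 := by simp [hc]
  have key : ∀ v : Place K, ∃ t, t ≠ 0 ∧ Nm v (-(c 0 * c 1)) (c 0 * t) ∧
      (Nm v (-(c 2 * c 3)) (-(c 2 * c 4)) ∨ ¬ Sq v (t * (c 2 * c 3 * c 4))) := by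
    intro v
    by_cases hN : Nm v (-(c 2 * c 3)) (-(c 2 * c 4))
    · exact ⟨c 0, hc 0, nm_of_sq (by rw [← sq]; exact LSq.sq _), Or.inl hN⟩
    rcases v with v | v
    · obtain ⟨t, h0, h1, h2⟩ := fin_tau (v := v) (hc 0) (hc 1) hcc
      exact ⟨t, h0, h1, Or.inr h2⟩
    · have hv : v.IsReal := by
        by_contra hv
        exact hN (nm_of_sq (lsq_complex hv _))
      have s1 : Sq (Sum.inr v) (c 2 * c 3) := by
        have := real_neg hv (fun h => hN (nm_of_sq_left ha h)); rwa [neg_neg] at this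
      have s2 : Sq (Sum.inr v) (c 2 * c 4) := by
        have := real_neg hv (fun h => hN (nm_of_sq h)); rwa [neg_neg] at this
      have s3 : Sq (Sum.inr v) (c 3 * c 4) := sq_mul3 (hc 2) (by rwa [mul_comm]) s2
      have sq' : ∀ x : K, Sq (Sum.inr v) (x * x) := fun x => by rw [← sq]; exact LSq.sq _
      obtain ⟨t, h0, h1, h2⟩ := real_tau (n := 3) hc (hi v hv) (by
        rintro ⟨i, j, h⟩
        apply h
        fin_cases i <;> fin_cases j
        · exact sq' (c 2)
        · exact s1
        · exact s2
        · change Sq _ (c 3 * c 2); rwa [mul_comm]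
        · exact sq' (c 3)
        · exact s3
        · change Sq _ (c 4 * c 2); rwa [mul_comm]
        · change Sq _ (c 4 * c 3); rwa [mul_comm]
        · exact sq' (c 4)) 0
      refine ⟨t, h0, h1, Or.inr fun h => h2 ?_⟩
      change Sq _ (t * c 2)
      rw [show t * (c 2 * c 3 * c 4) = (t * c 2) * (c 3 * c 4) by ring] at h
      exact LSq.of_mul_right (mul_ne_zero (hc 3) (hc 4)) s3 h
  choose τ h0 h1 h2 using key
  obtain ⟨x, y, ht, h3⟩ := bin_approx (hc 0) (b := c 1) (Pl S) τ (fun v _ => ⟨h0 v, h1 v⟩)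
  refine glue (n := 3) ht ((iso4_iff (c := Fin.cons (c 0 * x ^ 2 + c 1 * y ^ 2) (fun i => c i.succ.succ)) ?_).2 ?_)
  · intro i
    refine Fin.cases ht (fun j => ?_) i
    exact hc _
  · intro v hv
    change Sq v ((c 0 * x ^ 2 + c 1 * y ^ 2) * c 2 * c 3 * c 4) at hv
    change Nm v (-(c 2 * c 3)) (-(c 2 * c 4))
    by_cases hvS : v ∈ Pl S
    · refine (h2 v).resolve_right (not_not.2 ?_)
      refine sq_mul3 ht (a := τ v) (by rw [mul_comm]; exact h3 v hvS) ?_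
      rw [← mul_assoc, ← mul_assoc]; exact hv
    · rcases v with v | v
      · have hv' : v ∉ S := fun h => hvS (mem_Pl_inl.2 h)
        refine odd_unit_nm (hS2 v hv') ha hb ?_ ?_
        · rw [ord_neg, ord_mul v (hc 2) (hc 3), hSc v hv', hSc v hv', add_zero]
        · rw [ord_neg, ord_mul v (hc 2) (hc 4), hSc v hv', hSc v hv', add_zero]
      · exact absurd mem_Pl_inr hvS

/-- Hasse-Minkowski in dimension at least five -/
theorem iso_ge5 {K : Type u} [Field K] [NumberField K] (n : ℕ) : ∀ (c : Fin (n + 5) → K), (∀ i, c i ≠ 0) →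
    (∀ w : InfinitePlace K, w.IsReal → Ind (Sum.inr w) c) → Iso c := by
  induction n with
  | zero => intro c hc hi; exact iso5 hc hi
  | succ n ih =>
    intro c hc hi
    have key : ∀ v : Place K, ∃ t, t ≠ 0 ∧ Nm v (-(c 0 * c 1)) (c 0 * t) ∧
        ((∃ w : InfinitePlace K, w.IsReal ∧ v = Sum.inr w) → Ind v (Fin.cons t (fun i => c i.succ.succ) : Fin (n + 5) → K)) := by
      intro v
      by_cases hv : ∃ w : InfinitePlace K, w.IsReal ∧ v = Sum.inr w
      · obtain ⟨w, hw, rfl⟩ := hv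
        by_cases hI : Ind (Sum.inr w) (fun i : Fin (n + 4) => c i.succ.succ)
        · refine ⟨c 0, hc 0, nm_of_sq (by rw [← sq]; exact LSq.sq _), fun _ => ?_⟩
          obtain ⟨i, j, h⟩ := hI
          exact ⟨i.succ, j.succ, by simpa only [Fin.cons_succ] using h⟩
        · obtain ⟨t, h0, h1, h2⟩ := real_tau (n := n + 4) hc (hi w hw) hI 0
          exact ⟨t, h0, h1, fun _ => ⟨0, Fin.succ 0, by simpa only [Fin.cons_succ, Fin.cons_zero] using h2⟩⟩
      · exact ⟨c 0, hc 0, nm_of_sq (by rw [← sq]; exact LSq.sq _), fun h => absurd h hv⟩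
    choose τ h0 h1 h2 using key
    obtain ⟨x, y, ht, h3⟩ := bin_approx (hc 0) (b := c 1) (Pl ∅) τ (fun v _ => ⟨h0 v, h1 v⟩)
    refine glue (n := n + 4) ht (ih _ ?_ ?_)
    · intro i
      refine Fin.cases ht (fun j => ?_) i
      exact hc _
    · intro w hw
      have h4 := h2 (Sum.inr w) ⟨w, hw, rfl⟩
      have h5 := h3 (Sum.inr w) mem_Pl_inr
      by_contra hN
      unfold Ind at hN
      push Not at hN
      obtain ⟨i, j, h⟩ := h4
      apply h
      have hN0 : ∀ i : Fin (n + 4), Sq (Sum.inr w) ((c 0 * x ^ 2 + c 1 * y ^ 2) * c i.succ.succ) := fun i => by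
        simpa only [Fin.cons_succ, Fin.cons_zero] using hN 0 i.succ
      have hN1 : ∀ i j : Fin (n + 4), Sq (Sum.inr w) (c i.succ.succ * c j.succ.succ) := fun i j => by
        simpa only [Fin.cons_succ, Fin.cons_zero] using hN i.succ j.succ
      have hN2 : ∀ i : Fin (n + 4), Sq (Sum.inr w) (τ (Sum.inr w) * c i.succ.succ) := fun i =>
        sq_mul3 ht (by rw [mul_comm]; exact h5) (hN0 i)
      refine Fin.cases ?_ (fun i => ?_) i <;> refine Fin.cases ?_ (fun j => ?_) j <;>
        simp only [Fin.cons_succ, Fin.cons_zero]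
      · rw [← sq]; exact LSq.sq _
      · exact hN2 j
      · rw [mul_comm]; exact hN2 i
      · exact hN1 i j

/-- definite forms are anisotropic -/
theorem not_iso_of_def {K : Type u} [Field K] [NumberField K] {n : ℕ} {c : Fin n → K} (hc : ∀ i, c i ≠ 0)
    {w : InfinitePlace K} (hw : w.IsReal) (h : ¬ Ind (Sum.inr w) c) : ¬ Iso c := by
  rintro ⟨x, hx, h1⟩
  unfold Ind at h
  push Not at h
  obtain ⟨k, hk⟩ := Function.ne_iff.1 hx
  set φ := InfinitePlace.embedding_of_isReal hw
  have hpos : ∀ i, 0 ≤ φ (c k * c i * x i ^ 2) := fun i => by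
    rw [map_mul, map_pow]
    exact mul_nonneg ((lsq_real hw _).1 (h k i)) (sq_nonneg _)
  have hs : ∑ i, φ (c k * c i * x i ^ 2) = 0 := by
    rw [← map_sum, show ∑ i, c k * c i * x i ^ 2 = c k * ∑ i, c i * x i ^ 2 by rw [Finset.mul_sum]; simp only [mul_assoc], h1]
    simp
  have := (Finset.sum_eq_zero_iff_of_nonneg (fun i _ => hpos i)).1 hs k (Finset.mem_univ _)
  rw [map_eq_zero] at this
  simp [hc] at this
  exact hk this

end ADQ

namespace ADQ
open NumberField IsDedekindDomain WithZero

/-- polynomial functions -/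
class PF {K : Type*} [Field K] {ι : Type*} (g : (ι → K) → K) : Prop where
  out : ∃ p : MvPolynomial ι K, ∀ a, g a = MvPolynomial.eval a p

section PF
variable {K : Type*} [Field K] {ι : Type*}

instance PF.const (c : K) : PF (fun _ : ι → K => c) := ⟨⟨MvPolynomial.C c, by simp⟩⟩
instance PF.coord (i : ι) : PF (fun a : ι → K => a i) := ⟨⟨MvPolynomial.X i, by simp⟩⟩
instance PF.add (f g : (ι → K) → K) [hf : PF f] [hg : PF g] : PF (fun a => f a + g a) := by
  obtain ⟨p, hp⟩ := hf.out
  obtain ⟨q, hq⟩ := hg.out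
  exact ⟨⟨p + q, fun a => by rw [map_add, hp, hq]⟩⟩
instance PF.mul (f g : (ι → K) → K) [hf : PF f] [hg : PF g] : PF (fun a => f a * g a) := by
  obtain ⟨p, hp⟩ := hf.out
  obtain ⟨q, hq⟩ := hg.out
  exact ⟨⟨p * q, fun a => by rw [map_mul, hp, hq]⟩⟩
instance PF.sub (f g : (ι → K) → K) [hf : PF f] [hg : PF g] : PF (fun a => f a - g a) := by
  obtain ⟨p, hp⟩ := hf.out
  obtain ⟨q, hq⟩ := hg.out
  exact ⟨⟨p - q, fun a => by rw [map_sub, hp, hq]⟩⟩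
instance PF.neg (f : (ι → K) → K) [hf : PF f] : PF (fun a => - f a) := by
  obtain ⟨p, hp⟩ := hf.out
  exact ⟨⟨-p, fun a => by rw [map_neg, hp]⟩⟩
instance PF.pow (f : (ι → K) → K) (n : ℕ) [hf : PF f] : PF (fun a => f a ^ n) := by
  obtain ⟨p, hp⟩ := hf.out
  exact ⟨⟨p ^ n, fun a => by rw [map_pow, hp]⟩⟩
instance PF.sum {κ : Type*} (s : Finset κ) (f : κ → (ι → K) → K) [hf : ∀ k, PF (f k)] : PF (fun a => ∑ k ∈ s, f k a) := by
  choose p hp using fun k => (hf k).out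
  exact ⟨⟨∑ k ∈ s, p k, fun a => by rw [map_sum]; exact Finset.sum_congr rfl fun k _ => hp k a⟩⟩
instance PF.ren {κ : Type*} (f : (ι → K) → K) (e : ι → κ) [hf : PF f] : PF (fun b : κ → K => f (fun i => b (e i))) := by
  obtain ⟨p, hp⟩ := hf.out
  exact ⟨⟨MvPolynomial.rename e p, fun a => by rw [hp, MvPolynomial.eval_rename]; rfl⟩⟩
end PF

/-- diophantine predicates -/
class D {K : Type*} [Field K] {ι : Type*} (P : (ι → K) → Prop) : Prop where
  out : ∃ (m : ℕ) (f : MvPolynomial (ι ⊕ Fin m) K),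
    ∀ a : ι → K, P a ↔ ∃ x : Fin m → K, MvPolynomial.eval (Sum.elim a x) f = 0

section Dio
variable {K : Type*} [Field K] {ι : Type*}

theorem D.of_finite {P : (ι → K) → Prop} {κ : Type*} [Finite κ] (f : MvPolynomial (ι ⊕ κ) K)
    (h : ∀ a, P a ↔ ∃ x : κ → K, MvPolynomial.eval (Sum.elim a x) f = 0) : D P := by
  obtain ⟨m, ⟨e⟩⟩ := Finite.exists_equiv_fin κ
  refine ⟨⟨m, MvPolynomial.rename (Sum.map id e) f, fun a => ?_⟩⟩
  rw [h]
  constructor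
  · rintro ⟨x, hx⟩
    refine ⟨x ∘ e.symm, ?_⟩
    rw [MvPolynomial.eval_rename, ← hx]
    congr 2
    ext i
    rcases i with i | i <;> simp
  · rintro ⟨x, hx⟩
    refine ⟨x ∘ e, ?_⟩
    rw [MvPolynomial.eval_rename] at hx
    rw [← hx]
    congr 2
    ext i
    rcases i with i | i <;> simp

theorem D.congr {P Q : (ι → K) → Prop} (h : D P) (hPQ : ∀ a, Q a ↔ P a) : D Q := by
  have : Q = P := by ext a; exact hPQ a
  rw [this]; exact h

instance D.eq (f g : (ι → K) → K) [hf : PF f] [hg : PF g] : D (fun a => f a = g a) := by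
  obtain ⟨p, hp⟩ := hf.out
  obtain ⟨q, hq⟩ := hg.out
  refine D.of_finite (κ := Empty) (MvPolynomial.rename Sum.inl (p - q)) fun a => ?_
  simp only [MvPolynomial.eval_rename, Sum.elim_comp_inl, map_sub, sub_eq_zero, hp, hq]
  simp

instance D.exF {κ : Type*} [Finite κ] (P : (ι → K) → (κ → K) → Prop)
    [h : D (fun b : ι ⊕ κ → K => P (fun i => b (Sum.inl i)) (fun k => b (Sum.inr k)))] :
    D (fun a => ∃ x : κ → K, P a x) := by
  obtain ⟨m, f, hf⟩ := h.out
  refine D.of_finite (κ := κ ⊕ Fin m) (MvPolynomial.rename (Equiv.sumAssoc ι κ (Fin m)) f) fun a => ?_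
  have key : ∀ (x : κ → K) (y : Fin m → K), (Sum.elim a (Sum.elim x y)) ∘ (Equiv.sumAssoc ι κ (Fin m)) =
      Sum.elim (Sum.elim a x) y := by
    intro x y
    ext i
    rcases i with (i | i) | i <;> simp
  constructor
  · rintro ⟨x, hx⟩
    obtain ⟨y, hy⟩ := (hf (Sum.elim a x)).1 (by simpa using hx)
    exact ⟨Sum.elim x y, by rw [MvPolynomial.eval_rename, key]; exact hy⟩
  · rintro ⟨z, hz⟩
    refine ⟨fun k => z (Sum.inl k), ?_⟩
    have := (hf (Sum.elim a (fun k => z (Sum.inl k)))).2 ⟨fun k => z (Sum.inr k), by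
      rw [← key, ← MvPolynomial.eval_rename]
      convert hz using 3
      ext i; rcases i with i | i | i <;> rfl⟩
    simpa using this

instance D.ex (P : (ι → K) → K → Prop)
    [h : D (fun b : ι ⊕ Unit → K => P (fun i => b (Sum.inl i)) (b (Sum.inr ())))] :
    D (fun a => ∃ x : K, P a x) := by
  refine D.congr (D.exF (κ := Unit) (fun a x => P a (x ()))) fun a => ?_
  constructor
  · rintro ⟨x, hx⟩; exact ⟨fun _ => x, hx⟩
  · rintro ⟨x, hx⟩; exact ⟨_, hx⟩

instance D.ne_zero (f : (ι → K) → K) [hf : PF f] : D (fun a => f a ≠ 0) := by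
  have : D (fun a => ∃ x : K, f a * x = 1) := inferInstance
  refine this.congr fun a => ?_
  constructor
  · intro h; exact ⟨(f a)⁻¹, mul_inv_cancel₀ h⟩
  · rintro ⟨x, hx⟩ h; rw [h] at hx; simp at hx

instance D.or (P Q : (ι → K) → Prop) [hP : D P] [hQ : D Q] : D (fun a => P a ∨ Q a) := by
  obtain ⟨m, f, hf⟩ := hP.out
  obtain ⟨n, g, hg⟩ := hQ.out
  refine D.of_finite (κ := Fin m ⊕ Fin n) (MvPolynomial.rename (Sum.map id Sum.inl) f *
    MvPolynomial.rename (Sum.map id Sum.inr) g) fun a => ?_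
  simp only [map_mul, mul_eq_zero, MvPolynomial.eval_rename, Sum.elim_comp_map, Function.comp_id]
  rw [hf, hg]
  constructor
  · rintro (⟨x, hx⟩ | ⟨x, hx⟩)
    · exact ⟨Sum.elim x 0, Or.inl (by simpa using hx)⟩
    · exact ⟨Sum.elim 0 x, Or.inr (by simpa using hx)⟩
  · rintro ⟨x, hx | hx⟩
    · exact Or.inl ⟨_, hx⟩
    · exact Or.inr ⟨_, hx⟩

instance D.const (p : Prop) : D (fun _ : ι → K => p) := by
  by_cases h : p
  · have : D (fun _ : ι → K => (0 : K) = 0) := inferInstance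
    exact this.congr fun _ => by simp [h]
  · have : D (fun _ : ι → K => (1 : K) = 0) := inferInstance
    exact this.congr fun _ => by simp [h]

theorem D.exists_finite {κ : Type*} [Finite κ] (P : κ → (ι → K) → Prop) (h : ∀ k, D (P k)) :
    D (fun a => ∃ k, P k a) := by
  classical
  have := Fintype.ofFinite κ
  have key : ∀ s : Finset κ, D (fun a => ∃ k ∈ s, P k a) := by
    intro s
    induction s using Finset.induction_on with
    | empty => exact (D.const False).congr fun a => by simp
    | insert k s hk ih =>
      have := h k
      exact (D.or (P k) (fun a => ∃ k ∈ s, P k a)).congr fun a => by simp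
  exact (key Finset.univ).congr fun a => by simp
end Dio

section Dnf
variable {K : Type*} [Field K] [NumberField K] {ι : Type*}

instance D.and (P Q : (ι → K) → Prop) [hP : D P] [hQ : D Q] : D (fun a => P a ∧ Q a) := by
  obtain ⟨m, f, hf⟩ := hP.out
  obtain ⟨n, g, hg⟩ := hQ.out
  obtain ⟨α, hα⟩ := exists_nonsq K
  have key : ∀ x y : K, x ^ 2 - α * y ^ 2 = 0 ↔ x = 0 ∧ y = 0 := by
    intro x y
    constructor
    · intro h
      have hy : y = 0 := by
        by_contra hy
        apply hα
        refine ⟨x / y, ?_⟩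
        field_simp
        linear_combination -h
      subst hy
      simpa using h
    · rintro ⟨rfl, rfl⟩; simp
  refine D.of_finite (κ := Fin m ⊕ Fin n) ((MvPolynomial.rename (Sum.map id Sum.inl) f) ^ 2 -
    MvPolynomial.C α * (MvPolynomial.rename (Sum.map id Sum.inr) g) ^ 2) fun a => ?_
  simp only [map_mul, map_sub, map_pow, MvPolynomial.eval_C, key, MvPolynomial.eval_rename, Sum.elim_comp_map, Function.comp_id]
  rw [hf, hg]
  constructor
  · rintro ⟨⟨x, hx⟩, ⟨y, hy⟩⟩
    exact ⟨Sum.elim x y, by simpa using hx, by simpa using hy⟩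
  · rintro ⟨x, hx, hy⟩
    exact ⟨⟨_, hx⟩, ⟨_, hy⟩⟩

theorem D.forall_finset {κ : Type*} (P : κ → (ι → K) → Prop) (h : ∀ k, D (P k)) (s : Finset κ) :
    D (fun a => ∀ k ∈ s, P k a) := by
  classical
  induction s using Finset.induction_on with
  | empty => exact (D.const True).congr fun a => by simp
  | insert k s hk ih =>
    have := h k
    exact (D.and (P k) (fun a => ∀ k ∈ s, P k a)).congr fun a => by simp

instance D.forall_finite {κ : Type*} [Finite κ] (P : κ → (ι → K) → Prop) [h : ∀ k, D (P k)] :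
    D (fun a => ∀ k, P k a) := by
  have := Fintype.ofFinite κ
  exact (D.forall_finset P h Finset.univ).congr fun a => by simp

/-- `f` is a nonsquare at all places ramified in `(a, b)` -/
def NS (a b f : K) : Prop := ∃ e, SlotRel a b f e

theorem NS_iff {K : Type u} [Field K] [NumberField K] {a b f : K} (ha : a ≠ 0) (hb : b ≠ 0) (hf : f ≠ 0) :
    NS a b f ↔ ∀ v, ¬ Nm v a b → ¬ Sq v f := by
  constructor
  · rintro ⟨e, he⟩ v hv hs
    obtain ⟨_, h⟩ := he.nm ha hb hf
    exact hv ((h v).2 (nm_of_sq_left hf hs))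
  · exact slot ha hb hf

instance D.slotRel (a b c e : (ι → K) → K) [PF a] [PF b] [PF c] [PF e] : D (fun t => SlotRel (a t) (b t) (c t) (e t)) := by
  unfold SlotRel; infer_instance

instance D.ns (a b f : (ι → K) → K) [PF a] [PF b] [PF f] : D (fun t => NS (a t) (b t) (f t)) := by
  unfold NS; infer_instance

/-- nonzero and NS -/
def NS0 (a b f : K) : Prop := f ≠ 0 ∧ NS a b f

instance D.ns0 (a b f : (ι → K) → K) [PF a] [PF b] [PF f] : D (fun t => NS0 (a t) (b t) (f t)) := by
  unfold NS0; infer_instance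

theorem NS0_iff {K : Type u} [Field K] [NumberField K] {a b f : K} (ha : a ≠ 0) (hb : b ≠ 0) :
    NS0 a b f ↔ f ≠ 0 ∧ ∀ v, ¬ Nm v a b → ¬ Sq v f :=
  and_congr_right fun hf => NS_iff ha hb hf

/-- squares at odd ramified places -/
def SqD (a b x : K) : Prop := ∃ g₁ g₂ : K, NS0 a b g₁ ∧ NS0 a b g₂ ∧ NS0 a b (g₁ * g₂) ∧ NS0 a b (g₁ * x) ∧
  NS0 a b (g₂ * x) ∧ NS0 a b (g₁ * g₂ * x)

instance D.sqD (a b f : (ι → K) → K) [PF a] [PF b] [PF f] : D (fun t => SqD (a t) (b t) (f t)) := by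
  unfold SqD; infer_instance
end Dnf

theorem SqD.sq {K : Type u} [Field K] [NumberField K] {a b x : K} (ha : a ≠ 0) (hb : b ≠ 0) (h : SqD a b x)
    {v : FP K} (hv : ord v (2 : K) = 0) (hr : ¬ Nm (Sum.inl v) a b) : Sq (Sum.inl v) x := by
  obtain ⟨g₁, g₂, h1, h2, h3, h4, h5, h6⟩ := h
  rw [NS0_iff ha hb] at h1 h2 h3 h4 h5 h6
  have hx : x ≠ 0 := right_ne_zero_of_mul h4.1
  rcases four_classes (index_odd hv) h1.1 h2.1 hx (h1.2 _ hr) (h2.2 _ hr) (h3.2 _ hr) with h | h | h | h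
  · exact h
  · exact absurd h (h4.2 _ hr)
  · exact absurd h (h5.2 _ hr)
  · exact absurd h (h6.2 _ hr)

end ADQ

namespace ADQ
open NumberField IsDedekindDomain WithZero

section
variable {K : Type u} [Field K] [NumberField K]

theorem exists_over (p : ℕ) (hp : p.Prime) : ∃ v : FP K, ((p : ℕ) : 𝓞 K) ∈ v.asIdeal := by
  have hmax : (Ideal.span {(p : ℤ)}).IsMaximal := by
    have : Prime (p : ℤ) := Nat.prime_iff_prime_int.1 hp
    exact PrincipalIdealRing.isMaximal_of_irreducible this.irreducible
  obtain ⟨Q, hQ, hl⟩ := Ideal.exists_maximal_ideal_liesOver_of_isIntegral (S := 𝓞 K) (Ideal.span {(p : ℤ)})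
  have hm : ((p : ℕ) : 𝓞 K) ∈ Q := by
    have h1 : (p : ℤ) ∈ Ideal.span {(p : ℤ)} := Ideal.mem_span_singleton_self _
    rw [hl.over] at h1
    simpa using h1
  refine ⟨⟨Q, hQ.isPrime, ?_⟩, hm⟩
  rintro rfl
  have : ((p : ℕ) : 𝓞 K) = 0 := by simpa using hm
  exact hp.ne_zero (by exact_mod_cast this)

theorem fp_ne {v : FP K} {p q : ℕ} (hpq : Nat.Coprime p q) (hp : ((p : ℕ) : 𝓞 K) ∈ v.asIdeal)
    (hq : ((q : ℕ) : 𝓞 K) ∈ v.asIdeal) : False := by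
  have h := Nat.isCoprime_iff_coprime.2 hpq
  obtain ⟨a, b, hab⟩ := h
  apply v.isPrime.ne_top
  rw [Ideal.eq_top_iff_one]
  have : (1 : 𝓞 K) = (a : 𝓞 K) * (p : 𝓞 K) + (b : 𝓞 K) * (q : 𝓞 K) := by exact_mod_cast hab.symm
  rw [this]
  exact v.asIdeal.add_mem (v.asIdeal.mul_mem_left _ hp) (v.asIdeal.mul_mem_left _ hq)

theorem exists_two_others (v : Place K) : ∃ w₁ w₂ : FP K, w₁ ≠ w₂ ∧ v ≠ Sum.inl w₁ ∧ v ≠ Sum.inl w₂ := by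
  obtain ⟨x, hx⟩ := exists_over (K := K) 2 (by norm_num)
  obtain ⟨y, hy⟩ := exists_over (K := K) 3 (by norm_num)
  obtain ⟨z, hz⟩ := exists_over (K := K) 5 (by norm_num)
  have hxy : x ≠ y := fun h => fp_ne (by norm_num) (h ▸ hx) hy
  have hxz : x ≠ z := fun h => fp_ne (by norm_num) (h ▸ hx) hz
  have hyz : y ≠ z := fun h => fp_ne (by norm_num) (h ▸ hy) hz
  by_cases h1 : v = Sum.inl x
  · refine ⟨y, z, hyz, ?_, ?_⟩
    · rw [h1]; simpa using hxy
    · rw [h1]; simpa using hxz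
  · by_cases h2 : v = Sum.inl y
    · refine ⟨x, z, hxz, h1, ?_⟩
      rw [h2]; simpa using hyz
    · exact ⟨x, y, hxy, h1, h2⟩

theorem exists_dyadic (K : Type u) [Field K] [NumberField K] : ∃ v : FP K, ord v (2 : K) ≠ 0 := by
  obtain ⟨x, hx⟩ := exists_over (K := K) 2 (by norm_num)
  refine ⟨x, ?_⟩
  have h := ge_int_mem.2 hx
  have h2 : (((2 : ℕ) : 𝓞 K) : K) = 2 := by
    have := map_natCast (algebraMap (𝓞 K) K) 2
    rw [Nat.cast_ofNat (R := K)] at this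
    exact this
  rw [h2, ge_iff two_ne_zero] at h
  omega

theorem nc_fin (v : FP K) : NC (Sum.inl v : Place K) := by
  by_contra h
  unfold NC at h
  push Not at h
  have h4 := index_fin_ge v
  have : sqS (Sum.inl v : Place K) = ⊤ := by
    rw [eq_top_iff]
    intro x _
    exact mem_sqS.2 (h x x.ne_zero)
  rw [this, Subgroup.index_top] at h4
  omega

theorem small_of_nonsq (v : Place K) {ε : ℝ} (hε : 0 < ε) : ∃ η > 0, ∀ c : K, av v c < η → ∀ t : K,
    ¬ Sq v (c + t ^ 2) → av v t < ε := by
  obtain ⟨δ, hδ, h⟩ := openSq v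
  refine ⟨δ * ε ^ 2, by positivity, fun c hc t ht => ?_⟩
  by_contra hlt
  push Not at hlt
  have ht0 : t ≠ 0 := by
    rintro rfl
    simp at hlt
    linarith
  apply ht
  have h1 : LSq (av v) (1 + c / t ^ 2) := by
    apply h
    rw [add_sub_cancel_left, map_div₀, map_pow, div_lt_iff₀ (pow_pos ((av v).pos ht0) 2)]
    have : ε ^ 2 ≤ av v t ^ 2 := by gcongr
    nlinarith
  have h2 := (LSq.mul_sq_iff ht0).2 h1
  have e : (1 + c / t ^ 2) * t ^ 2 = c + t ^ 2 := by field_simp; ring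
  rw [e] at h2
  exact h2

theorem keep_nonsq (u : Place K) {c : K} (hc : c ≠ 0) (hs : ¬ Sq u c) : ∃ κ > 0, ∀ t : K, av u t < κ →
    c + t ^ 2 ≠ 0 ∧ ¬ Sq u (c + t ^ 2) := by
  obtain ⟨ε, hε, h⟩ := (openSq u).near hc
  refine ⟨min ε 1, by positivity, fun t ht => ?_⟩
  have h1 := lt_of_lt_of_le ht (min_le_left _ _)
  have h2 := lt_of_lt_of_le ht (min_le_right _ _)
  have h0 := (av u).nonneg t
  obtain ⟨h3, h4⟩ := h (c + t ^ 2) (by rw [add_sub_cancel_left, map_pow]; nlinarith)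
  exact ⟨h3, fun h5 => hs (sq_congr h3 h4 h5)⟩

theorem exists_small_nonsq (v : Place K) {η : ℝ} (hη : 0 < η) (F : Finset (Place K)) (hF : ∀ u ∈ F, NC u) :
    ∃ c : K, c ≠ 0 ∧ av v c < η ∧ ∀ u ∈ F, ¬ Sq u c := by
  obtain ⟨x, hx, hxs⟩ := exists_nonsq_at hF
  obtain ⟨z, hz0, hz1⟩ : ∃ z : K, z ≠ 0 ∧ av v z < 1 := by
    obtain ⟨y, hy0, hy1⟩ := av_nontrivial v
    rcases lt_or_gt_of_ne hy1 with h | h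
    · exact ⟨y, hy0, h⟩
    · refine ⟨y⁻¹, inv_ne_zero hy0, ?_⟩
      rw [map_inv₀]
      exact inv_lt_one_of_one_lt₀ h
  have hx' := (av v).pos hx
  obtain ⟨n, hn⟩ := exists_pow_lt_of_lt_one (show 0 < min 1 (η / av v x) by positivity) hz1
  have h1 := lt_of_lt_of_le hn (min_le_left _ _)
  have h2 := lt_of_lt_of_le hn (min_le_right _ _)
  have h0 : 0 ≤ av v z ^ n := pow_nonneg ((av v).nonneg z) n
  have hzn : z ^ n ≠ 0 := pow_ne_zero _ hz0
  refine ⟨x * (z ^ n) ^ 2, mul_ne_zero hx (pow_ne_zero _ hzn), ?_, fun u hu h => hxs u hu ?_⟩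
  · rw [map_mul, map_pow, map_pow]
    rw [lt_div_iff₀ hx'] at h2
    have : (av v z ^ n) ^ 2 ≤ av v z ^ n := by nlinarith
    nlinarith
  · exact (LSq.mul_sq_iff hzn).1 h

/-- certificate for local squares at a fixed place -/
def RSq (a₁ b₁ a₂ b₂ c f : K) : Prop :=
  ∃ s t₁ t₂ : K, f * s ^ 2 = 1 + t₁ + t₂ ∧ NS0 a₁ b₁ (c + t₁ ^ 2) ∧ NS0 a₂ b₂ (c + t₂ ^ 2)

theorem exists_RSq {v : Place K} (hv : NC v) : ∃ a₁ b₁ a₂ b₂ c : K, ∀ f : K, f ≠ 0 →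
    (RSq a₁ b₁ a₂ b₂ c f ↔ Sq v f) := by
  classical
  obtain ⟨w₁, w₂, hww, h1, h2⟩ := exists_two_others v
  obtain ⟨a₁, b₁, ha₁, hb₁, hr₁⟩ := exists_ram_pair hv (nc_fin w₁) h1
  obtain ⟨a₂, b₂, ha₂, hb₂, hr₂⟩ := exists_ram_pair hv (nc_fin w₂) h2
  obtain ⟨ε, hε, hE⟩ := (openSq v).near (one_ne_zero (α := K))
  obtain ⟨η, hη, hs⟩ := small_of_nonsq v (half_pos hε)
  obtain ⟨c, hc, hcη, hcF⟩ := exists_small_nonsq v hη {v, Sum.inl w₁, Sum.inl w₂} (by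
    intro u hu
    simp only [Finset.mem_insert, Finset.mem_singleton] at hu
    rcases hu with rfl | rfl | rfl
    · exact hv
    · exact nc_fin w₁
    · exact nc_fin w₂)
  refine ⟨a₁, b₁, a₂, b₂, c, fun f hf => ?_⟩
  constructor
  · rintro ⟨s, t₁, t₂, he, hn₁, hn₂⟩
    rw [NS0_iff ha₁ hb₁] at hn₁
    rw [NS0_iff ha₂ hb₂] at hn₂
    have k₁ := hs c hcη t₁ (hn₁.2 v ((hr₁ v).2 (Or.inl rfl)))
    have k₂ := hs c hcη t₂ (hn₂.2 v ((hr₂ v).2 (Or.inl rfl)))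
    obtain ⟨k3, k4⟩ := hE (1 + t₁ + t₂) (by
      have e : 1 + t₁ + t₂ - 1 = t₁ + t₂ := by ring
      rw [e]
      have := (av v).add_le t₁ t₂
      linarith)
    rw [mul_one, ← he] at k4
    rw [← he] at k3
    have hs0 : s ≠ 0 := by rintro rfl; simp at k3
    exact (LSq.mul_sq_iff hs0).1 k4
  · intro hf2
    obtain ⟨κ, hκ, hK⟩ := keep_nonsq v hc (hcF v (by simp))
    obtain ⟨κ₁, hκ₁, hK₁⟩ := keep_nonsq (Sum.inl w₁) hc (hcF _ (by simp))
    obtain ⟨κ₂, hκ₂, hK₂⟩ := keep_nonsq (Sum.inl w₂) hc (hcF _ (by simp))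
    have hfp := (av v).pos hf
    obtain ⟨s, hs'⟩ := (LSq.inv hf2) (κ / 2 / av v f) (by positivity)
    set r := f * s ^ 2 - 1 with hr
    have hrs : av v r < κ / 2 := by
      have : r = f * (s ^ 2 - f⁻¹) := by rw [hr]; field_simp
      rw [this, map_mul]
      rw [lt_div_iff₀ hfp] at hs'
      linarith
    obtain ⟨t, ht⟩ := weak_approx {v, Sum.inl w₁, Sum.inl w₂}
      (fun u => if u = Sum.inl w₂ then r else 0) (fun _ => min (κ / 2) (min κ₁ κ₂)) (fun _ => by positivity)
    have q0 := ht v (by simp)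
    have q1 := ht (Sum.inl w₁) (by simp)
    have q2 := ht (Sum.inl w₂) (by simp)
    rw [if_neg h2, sub_zero] at q0
    rw [if_neg (by simpa using hww), sub_zero] at q1
    rw [if_pos rfl] at q2
    have q0' := lt_of_lt_of_le q0 (min_le_left _ _)
    have q1' := lt_of_lt_of_le q1 ((min_le_right _ _).trans (min_le_left _ _))
    have q2' := lt_of_lt_of_le q2 ((min_le_right _ _).trans (min_le_right _ _))
    rw [AbsoluteValue.map_sub] at q2'
    refine ⟨s, t, r - t, by rw [hr]; ring, ?_, ?_⟩
    · rw [NS0_iff ha₁ hb₁]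
      refine ⟨(hK t (by linarith)).1, fun u hu => ?_⟩
      rcases (hr₁ u).1 hu with rfl | rfl
      · exact (hK t (by linarith)).2
      · exact (hK₁ t q1').2
    · rw [NS0_iff ha₂ hb₂]
      have hk := hK₂ (r - t) q2'
      refine ⟨hk.1, fun u hu => ?_⟩
      rcases (hr₂ u).1 hu with rfl | rfl
      · refine (hK (r - t) ?_).2
        have := (av u).sub_le_add r t
        linarith
      · exact hk.2

/-- nonzero and locally a square -/
def SqN (v : Place K) (x : K) : Prop := x ≠ 0 ∧ Sq v x

instance D.sqN {ι : Type*} (v : Place K) (g : (ι → K) → K) [hg : PF g] : D (fun a => SqN v (g a)) := by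
  by_cases hv : NC v
  · obtain ⟨a₁, b₁, a₂, b₂, c, h⟩ := exists_RSq hv
    have : D (fun a => g a ≠ 0 ∧ RSq a₁ b₁ a₂ b₂ c (g a)) := by
      unfold RSq
      infer_instance
    refine this.congr fun a => ?_
    unfold SqN
    constructor
    · rintro ⟨h1, h2⟩; exact ⟨h1, (h _ h1).2 h2⟩
    · rintro ⟨h1, h2⟩; exact ⟨h1, (h _ h1).1 h2⟩
  · unfold NC at hv
    push Not at hv
    refine (D.ne_zero g).congr fun a => ?_
    exact ⟨fun h => h.1, fun h => ⟨h, hv _ h⟩⟩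

theorem D.class2 {ι : Type*} (v : Place K) (Q : K → K → Prop)
    (hQ : ∀ f g f' g' : K, f ≠ 0 → g ≠ 0 → f' ≠ 0 → g' ≠ 0 → Sq v (f * f') → Sq v (g * g') → Q f g → Q f' g')
    (f g : (ι → K) → K) [hf : PF f] [hg : PF g] : D (fun a => f a ≠ 0 ∧ g a ≠ 0 ∧ Q (f a) (g a)) := by
  have hfi : (sqS v).FiniteIndex := ⟨index_sqS_ne v⟩
  have : Finite (Kˣ ⧸ sqS v) := Subgroup.finite_quotient_of_finiteIndex
  have key := D.exists_finite (ι := ι) (κ := (Kˣ ⧸ sqS v) × (Kˣ ⧸ sqS v)) (fun k a => Q (k.1.out : Kˣ) (k.2.out : Kˣ) ∧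
    SqN v (f a * ((k.1.out : Kˣ) : K)) ∧ SqN v (g a * ((k.2.out : Kˣ) : K))) (fun k => inferInstance)
  refine key.congr fun a => ?_
  constructor
  · rintro ⟨h1, h2, h3⟩
    refine ⟨((Units.mk0 _ h1 : Kˣ), (Units.mk0 _ h2 : Kˣ)), ?_⟩
    have e1 : Sq v (f a * (((Units.mk0 _ h1 : Kˣ) : Kˣ ⧸ sqS v).out : Kˣ)) := by
      have := (mk_sqS_eq (v := v) (x := Units.mk0 _ h1) (y := ((Units.mk0 _ h1 : Kˣ) : Kˣ ⧸ sqS v).out)).1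
        (QuotientGroup.out_eq' _).symm
      simpa using this
    have e2 : Sq v (g a * (((Units.mk0 _ h2 : Kˣ) : Kˣ ⧸ sqS v).out : Kˣ)) := by
      have := (mk_sqS_eq (v := v) (x := Units.mk0 _ h2) (y := ((Units.mk0 _ h2 : Kˣ) : Kˣ ⧸ sqS v).out)).1
        (QuotientGroup.out_eq' _).symm
      simpa using this
    exact ⟨hQ _ _ _ _ h1 h2 (Units.ne_zero _) (Units.ne_zero _) e1 e2 h3,
      ⟨mul_ne_zero h1 (Units.ne_zero _), e1⟩, ⟨mul_ne_zero h2 (Units.ne_zero _), e2⟩⟩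
  · rintro ⟨k, h1, ⟨h2, h3⟩, ⟨h4, h5⟩⟩
    have n1 := left_ne_zero_of_mul h2
    have n2 := left_ne_zero_of_mul h4
    exact ⟨n1, n2, hQ _ _ _ _ (Units.ne_zero _) (Units.ne_zero _) n1 n2 (by rw [mul_comm]; exact h3)
      (by rw [mul_comm]; exact h5) h1⟩

theorem nm_class {v : Place K} {f g f' g' : K} (hf : f ≠ 0) (hg : g ≠ 0) (hf' : f' ≠ 0) (hg' : g' ≠ 0)
    (h1 : Sq v (f * f')) (h2 : Sq v (g * g')) (h : Nm v f g) : Nm v f' g' := by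
  have := nm_congr_left hf' hf hg (by rw [mul_comm]; exact h1) h
  exact nm_congr_right hg (by rw [mul_comm]; exact h2) this

/-- nonzero with trivial symbol -/
def NmN (v : Place K) (x y : K) : Prop := x ≠ 0 ∧ y ≠ 0 ∧ Nm v x y
/-- nonzero with nontrivial symbol -/
def RmN (v : Place K) (x y : K) : Prop := x ≠ 0 ∧ y ≠ 0 ∧ ¬ Nm v x y

instance D.nmN {ι : Type*} (v : Place K) (f g : (ι → K) → K) [hf : PF f] [hg : PF g] : D (fun a => NmN v (f a) (g a)) :=
  D.class2 v (Nm v) (fun _ _ _ _ h1 h2 h3 h4 h5 h6 h7 => nm_class h1 h2 h3 h4 h5 h6 h7) f g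

instance D.rmN {ι : Type*} (v : Place K) (f g : (ι → K) → K) [hf : PF f] [hg : PF g] : D (fun a => RmN v (f a) (g a)) :=
  D.class2 v (fun x y => ¬ Nm v x y) (fun _ _ _ _ h1 h2 h3 h4 h5 h6 h7 h8 => h7 (nm_class h3 h4 h1 h2
    (by rw [mul_comm]; exact h5) (by rw [mul_comm]; exact h6) h8)) f g

end
end ADQ

namespace ADQ
open NumberField IsDedekindDomain WithZero

section
variable {K : Type u} [Field K] [NumberField K]

theorem avoid (v : Place K) {n : ℕ} (hn : n < (sqS v).index) (y : Fin n → K) (hy : ∀ i, y i ≠ 0) :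
    ∃ g : K, g ≠ 0 ∧ ∀ i, ¬ Sq v (g * y i) := by
  by_contra h
  push Not at h
  choose φ hφ using fun x : Kˣ => h (x : K) x.ne_zero
  have := (index_le_of_inj (sqS v) φ (fun x z hxz => by
    have h1 := hφ x
    have h2 := hφ z
    rw [← hxz, mul_comm] at h2
    exact QuotientGroup.eq.1 (mk_sqS_eq.2 (sq_mul3 (hy _) h1 h2)))).2
  rw [Nat.card_fin] at this
  omega

/-- the local requirement for `SqD` -/
def LP (u : Place K) (x g₁ g₂ : K) : Prop := g₁ ≠ 0 ∧ g₂ ≠ 0 ∧ ¬ Sq u g₁ ∧ ¬ Sq u g₂ ∧ ¬ Sq u (g₁ * g₂) ∧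
  ¬ Sq u (g₁ * x) ∧ ¬ Sq u (g₂ * x) ∧ ¬ Sq u (g₁ * g₂ * x)

theorem lp_of_sq (p : FP K) {x : K} (hx : x ≠ 0) (hs : Sq (Sum.inl p) x) : ∃ g₁ g₂, LP (Sum.inl p) x g₁ g₂ := by
  have h4 := index_fin_ge p
  obtain ⟨g₁, h1, h1'⟩ := avoid (Sum.inl p) (n := 1) (by omega) ![1] (by simp)
  obtain ⟨g₂, h2, h2'⟩ := avoid (Sum.inl p) (n := 2) (by omega) ![1, g₁] (by
    intro i; fin_cases i <;> simp [h1])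
  have a1 : ¬ Sq (Sum.inl p) g₁ := by simpa using h1' 0
  have a2 : ¬ Sq (Sum.inl p) g₂ := by simpa using h2' 0
  have a3 : ¬ Sq (Sum.inl p) (g₁ * g₂) := by
    rw [mul_comm]
    simpa using h2' 1
  refine ⟨g₁, g₂, h1, h2, a1, a2, a3, fun h => a1 (LSq.of_mul_right hx hs h), fun h => a2 (LSq.of_mul_right hx hs h),
    fun h => a3 (LSq.of_mul_right hx hs h)⟩

theorem lp_dyadic {p : FP K} (hp : ord p (2 : K) ≠ 0) {x : K} (hx : x ≠ 0) : ∃ g₁ g₂, LP (Sum.inl p) x g₁ g₂ := by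
  have h4 := index_dyadic hp
  obtain ⟨g₁, h1, h1'⟩ := avoid (Sum.inl p) (n := 2) (by omega) ![1, x] (by
    intro i; fin_cases i <;> simp [hx])
  obtain ⟨g₂, h2, h2'⟩ := avoid (Sum.inl p) (n := 4) (by omega) ![1, x, g₁, g₁ * x] (by
    intro i; fin_cases i <;> simp [h1, hx])
  have a1 : ¬ Sq (Sum.inl p) g₁ := by simpa using h1' 0
  have a1x : ¬ Sq (Sum.inl p) (g₁ * x) := by simpa using h1' 1
  have a2 : ¬ Sq (Sum.inl p) g₂ := by simpa using h2' 0
  have a2x : ¬ Sq (Sum.inl p) (g₂ * x) := by simpa using h2' 1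
  have a3 : ¬ Sq (Sum.inl p) (g₁ * g₂) := by
    rw [mul_comm]
    simpa using h2' 2
  have a3x : ¬ Sq (Sum.inl p) (g₁ * g₂ * x) := by
    have e : g₁ * g₂ * x = g₂ * (g₁ * x) := by ring
    rw [e]
    simpa using h2' 3
  exact ⟨g₁, g₂, h1, h2, a1, a2, a3, a1x, a2x, a3x⟩

theorem lp_transfer {u : Place K} {x g₁ g₂ G₁ G₂ : K} (hG₁ : G₁ ≠ 0) (hG₂ : G₂ ≠ 0) (hx : x ≠ 0)
    (h₁ : Sq u (G₁ * g₁)) (h₂ : Sq u (G₂ * g₂)) (h : LP u x g₁ g₂) : LP u x G₁ G₂ := by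
  obtain ⟨_, _, h1, h2, h3, h4, h5, h6⟩ := h
  have tr : ∀ X y : K, X ≠ 0 → Sq u (X * y) → ¬ Sq u y → ¬ Sq u X :=
    fun X y hX hXy hy h => hy (sq_congr hX hXy h)
  have h12 : Sq u (G₁ * G₂ * (g₁ * g₂)) := by
    have := LSq.mul h₁ h₂
    have e : G₁ * G₂ * (g₁ * g₂) = G₁ * g₁ * (G₂ * g₂) := by ring
    unfold Sq
    rw [e]; exact this
  have hmx : ∀ X y : K, Sq u (X * y) → Sq u (X * x * (y * x)) := by
    intro X y hXy
    have e : X * x * (y * x) = X * y * x ^ 2 := by ring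
    unfold Sq
    rw [e]; exact (LSq.mul_sq_iff hx).2 hXy
  have hG := mul_ne_zero hG₁ hG₂
  exact ⟨hG₁, hG₂, tr _ _ hG₁ h₁ h1, tr _ _ hG₂ h₂ h2, tr _ _ hG h12 h3, tr _ _ (mul_ne_zero hG₁ hx) (hmx _ _ h₁) h4,
    tr _ _ (mul_ne_zero hG₂ hx) (hmx _ _ h₂) h5, tr _ _ (mul_ne_zero hG hx) (hmx _ _ h12) h6⟩

theorem sqD_of {v₀ p : FP K} (h₀ : ord v₀ (2 : K) ≠ 0) (hp : p ≠ v₀) {c b x : K} (hc : c ≠ 0) (hb : b ≠ 0) (hx : x ≠ 0)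
    (hr : ∀ u : Place K, ¬ Nm u c b → u = Sum.inl v₀ ∨ u = Sum.inl p) (hs : Sq (Sum.inl p) x) : SqD c b x := by
  classical
  obtain ⟨g₁, g₂, hg⟩ := lp_dyadic h₀ hx
  obtain ⟨k₁, k₂, hk⟩ := lp_of_sq p hx hs
  have hpv : (Sum.inl p : Place K) ≠ Sum.inl v₀ := by simpa using hp
  have key : ∀ y z : K, y ≠ 0 → z ≠ 0 → ∃ X : K, X ≠ 0 ∧ Sq (Sum.inl v₀) (X * y) ∧ Sq (Sum.inl p) (X * z) := by
    intro y z hy hz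
    obtain ⟨X, hX, hXs⟩ := weak_class {Sum.inl v₀, Sum.inl p} (fun u : Place K => if u = Sum.inl v₀ then y else z) (by
      intro u _
      show (if u = Sum.inl v₀ then y else z) ≠ 0
      split_ifs <;> assumption)
    refine ⟨X, hX, ?_, ?_⟩
    · have := hXs (Sum.inl v₀) (by simp)
      rwa [if_pos rfl] at this
    · have := hXs (Sum.inl p) (by simp)
      rwa [if_neg hpv] at this
  obtain ⟨G₁, hG₁, i1, i2⟩ := key g₁ k₁ hg.1 hk.1
  obtain ⟨G₂, hG₂, j1, j2⟩ := key g₂ k₂ hg.2.1 hk.2.1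
  have L₀ := lp_transfer hG₁ hG₂ hx i1 j1 hg
  have L₁ := lp_transfer hG₁ hG₂ hx i2 j2 hk
  have fin : ∀ X : K, X ≠ 0 → ¬ Sq (Sum.inl v₀) X → ¬ Sq (Sum.inl p) X → NS0 c b X := by
    intro X hX h1 h2
    rw [NS0_iff hc hb]
    refine ⟨hX, fun u hu => ?_⟩
    rcases hr u hu with rfl | rfl
    · exact h1
    · exact h2
  obtain ⟨_, _, a1, a2, a3, a4, a5, a6⟩ := L₀
  obtain ⟨_, _, b1, b2, b3, b4, b5, b6⟩ := L₁
  have hG := mul_ne_zero hG₁ hG₂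
  exact ⟨G₁, G₂, fin _ hG₁ a1 b1, fin _ hG₂ a2 b2, fin _ hG a3 b3, fin _ (mul_ne_zero hG₁ hx) a4 b4,
    fin _ (mul_ne_zero hG₂ hx) a5 b5, fin _ (mul_ne_zero hG hx) a6 b6⟩

/-- certificate at non-exceptional places -/
def Cert (v₀ : FP K) (B : Finset (Place K)) (a b d : K) : Prop :=
  ∃ c b' s : K, RmN (Sum.inl v₀) c b' ∧ (∀ v ∈ B, v ≠ Sum.inl v₀ → NmN v c b') ∧ s ≠ 0 ∧ SqD c b' s ∧ SqD c b' d ∧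
    ∃ e, SlotRel a b c e ∧ ∃ u w : K, e * b' * s = u ^ 2 - c * w ^ 2

theorem cert_sound {v₀ : FP K} {a b d : K} (ha : a ≠ 0) (hb : b ≠ 0)
    (h : Cert v₀ (Pl (supp (2 : K))) a b d) : ∃ v : Place K, ¬ Nm v a b ∧ Sq v d := by
  obtain ⟨c, b', s, ⟨hc, hb', hr⟩, hB, hs, hS, hD, e, hsl, u, w, he⟩ := h
  obtain ⟨p, hp, hpr⟩ := exists_other_ram hc hb' hr
  have hpB : p ∉ Pl (supp (2 : K)) := fun h => hpr (hB p h hp).2.2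
  rcases p with p | p
  swap
  · exact absurd mem_Pl_inr hpB
  rw [mem_Pl_inl] at hpB
  have h2 := ord_of_supp hpB
  have s1 := hS.sq hc hb' h2 hpr
  have s2 := hD.sq hc hb' h2 hpr
  obtain ⟨he0, hnm⟩ := hsl.nm ha hb hc
  refine ⟨Sum.inl p, fun h => ?_, s2⟩
  rw [hnm] at h
  have hn : Nm (Sum.inl p) c (e * b' * s) := by
    rw [he]
    exact nm_norm
  rw [nm_xor hc (mul_ne_zero he0 hb') hs, nm_xor hc he0 hb'] at hn
  have hns : Nm (Sum.inl p) c s := nm_of_sq s1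
  tauto

theorem ram_mem {a b : K} (ha : a ≠ 0) (hb : b ≠ 0) {u : Place K} (hu : ¬ Nm u a b) [DecidableEq (FP K)] :
    u ∈ Pl (supp (2 : K) ∪ supp a ∪ supp b) := by
  rcases u with u | u
  · rw [mem_Pl_inl]
    by_contra h
    simp only [Finset.mem_union, not_or] at h
    exact hu (odd_unit_nm (ord_of_supp h.1.1) ha hb (ord_of_supp h.1.2) (ord_of_supp h.2))
  · exact mem_Pl_inr

theorem cert_complete {v₀ : FP K} (h₀ : ord v₀ (2 : K) ≠ 0) {a b d : K} (ha : a ≠ 0) (hb : b ≠ 0) (hd : d ≠ 0) {p : FP K}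
    (hp : Sum.inl p ∉ Pl (supp (2 : K))) (hr : ¬ Nm (Sum.inl p) a b) (hs : Sq (Sum.inl p) d) :
    Cert v₀ (Pl (supp (2 : K))) a b d := by
  classical
  have hpv : p ≠ v₀ := by
    rintro rfl
    rw [mem_Pl_inl] at hp
    exact h₀ (ord_of_supp hp)
  have hpv' : (Sum.inl p : Place K) ≠ Sum.inl v₀ := by simpa using hpv
  obtain ⟨c, hc, hcs⟩ := exists_nonsq_at (δ := (Pl (supp (2 : K) ∪ supp a ∪ supp b)).filter (fun u => ¬ Nm u a b) ∪
      {Sum.inl v₀, Sum.inl p}) (by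
    intro u hu
    simp only [Finset.mem_union, Finset.mem_filter, Finset.mem_insert, Finset.mem_singleton] at hu
    rcases hu with ⟨_, hu⟩ | rfl | rfl
    · exact ⟨a, ha, fun h => hu (nm_of_sq_left ha h)⟩
    · exact nc_fin _
    · exact nc_fin _)
  have hc1 : ∀ u, ¬ Nm u a b → ¬ Sq u c := fun u hu => hcs u (by
    rw [Finset.mem_union, Finset.mem_filter]
    exact Or.inl ⟨ram_mem ha hb hu, hu⟩)
  have hreal : RealSet ({Sum.inl v₀, Sum.inl p} : Finset (Place K)) := by
    obtain ⟨x, y, hx, hy, hxy⟩ := exists_ram_pair (nc_fin v₀) (nc_fin p) hpv'.symm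
    exact ⟨x, y, hx, hy, fun v => by rw [hxy]; simp⟩
  obtain ⟨b', hb', hrm⟩ := slotSet hreal hc (fun v hv => hcs v (Finset.mem_union_right _ hv))
  have hrm' : ∀ u, ¬ Nm u c b' ↔ u = Sum.inl v₀ ∨ u = Sum.inl p := fun u => by rw [hrm]; simp
  obtain ⟨e, he⟩ := slot ha hb hc hc1
  obtain ⟨he0, hnm⟩ := he.nm ha hb hc
  have hn : Nm (Sum.inl p) c (e * b') := by
    rw [nm_xor hc he0 hb']
    have h1 := (hrm' (Sum.inl p)).2 (Or.inr rfl)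
    rw [hnm] at hr
    tauto
  obtain ⟨X, Y, hXY, hsq⟩ := hn
  have hs0 : e * b' * (X ^ 2 - c * Y ^ 2) ≠ 0 := mul_ne_zero (mul_ne_zero he0 hb') hXY
  refine ⟨c, b', e * b' * (X ^ 2 - c * Y ^ 2), ⟨hc, hb', (hrm' _).2 (Or.inl rfl)⟩, ?_, hs0, ?_, ?_, e, he,
    e * b' * X, e * b' * Y, by ring⟩
  · intro v hv hv0
    refine ⟨hc, hb', ?_⟩
    by_contra h
    rcases (hrm' v).1 h with rfl | rfl
    · exact hv0 rfl
    · exact hp hv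
  · exact sqD_of h₀ hpv hc hb' hs0 (fun u hu => (hrm' u).1 hu) hsq
  · exact sqD_of h₀ hpv hc hb' hd (fun u hu => (hrm' u).1 hu) hs

/-- local anisotropy of `⟨1, -a, -b, abd⟩` somewhere -/
def AN (a b d : K) : Prop := (a ≠ 0 ∧ b ≠ 0 ∧ d ≠ 0) ∧ ∃ v : Place K, ¬ Nm v a b ∧ Sq v d

instance D.isAN {ι : Type*} (a b d : (ι → K) → K) [PF a] [PF b] [PF d] : D (fun t => AN (a t) (b t) (d t)) := by
  obtain ⟨v₀, h₀⟩ := exists_dyadic K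
  have h1 : D (fun t : ι → K => ∃ v : Pl (supp (2 : K)), RmN v.1 (a t) (b t) ∧ SqN v.1 (d t)) :=
    D.exists_finite _ (fun v => inferInstance)
  have h2 : D (fun t : ι → K => Cert v₀ (Pl (supp (2 : K))) (a t) (b t) (d t)) := by
    unfold Cert
    have : ∀ c b' : (((ι ⊕ Unit) ⊕ Unit) ⊕ Unit → K) → K, PF c → PF b' →
        D (fun t => ∀ v ∈ Pl (supp (2 : K)), v ≠ Sum.inl v₀ → NmN v (c t) (b' t)) := by
      intro c b' _ _
      refine D.forall_finset _ (fun v => ?_) _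
      by_cases hv : v = Sum.inl v₀
      · exact (D.const True).congr fun t => by simp [hv]
      · exact (D.nmN v c b').congr fun t => by simp [hv]
    have := this (fun t => t (Sum.inl (Sum.inl (Sum.inr ())))) (fun t => t (Sum.inl (Sum.inr ()))) inferInstance inferInstance
    infer_instance
  have h3 : D (fun t : ι → K => (a t ≠ 0 ∧ b t ≠ 0 ∧ d t ≠ 0) ∧ ((∃ v : Pl (supp (2 : K)), RmN v.1 (a t) (b t) ∧ SqN v.1 (d t)) ∨
    Cert v₀ (Pl (supp (2 : K))) (a t) (b t) (d t))) := inferInstance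
  refine h3.congr fun t => and_congr_right fun ⟨ha, hb, hd⟩ => ?_
  constructor
  · rintro ⟨v, hv, hs⟩
    by_cases hB : v ∈ Pl (supp (2 : K))
    · exact Or.inl ⟨⟨v, hB⟩, ⟨ha, hb, hv⟩, ⟨hd, hs⟩⟩
    · rcases v with v | v
      · exact Or.inr (cert_complete h₀ ha hb hd hB hv hs)
      · exact absurd mem_Pl_inr hB
  · rintro (⟨v, h1, h2⟩ | h)
    · exact ⟨v, h1.2.2, h2.2⟩
    · exact cert_sound ha hb h

end
end ADQ

namespace ADQ
open NumberField IsDedekindDomain WithZero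

section
variable {K : Type u} [Field K] [NumberField K]

/-- nondegenerate anisotropic diagonal form -/
def DA {n : ℕ} (c : Fin n → K) : Prop := (∀ i, c i ≠ 0) ∧ ¬ Iso c

theorem da0 (c : Fin 0 → K) : DA c := by
  refine ⟨fun i => i.elim0, ?_⟩
  rintro ⟨x, hx, _⟩
  exact hx (Subsingleton.elim _ _)

theorem da1 (c : Fin 1 → K) : DA c ↔ c 0 ≠ 0 := by
  constructor
  · intro h; exact h.1 0
  · intro h
    refine ⟨fun i => by rw [Subsingleton.elim i 0]; exact h, ?_⟩
    rintro ⟨x, hx, hs⟩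
    apply hx
    ext i
    rw [Subsingleton.elim i 0]
    simpa [h] using hs

theorem sq_of_isSquare {v : Place K} {x : K} (h : IsSquare x) : Sq v x := by
  obtain ⟨r, rfl⟩ := h
  rw [← pow_two]
  exact LSq.sq _

theorem da2 (c : Fin 2 → K) : DA c ↔ ∃ b, AN (-(c 0 * c 1)) b 1 := by
  constructor
  · rintro ⟨h0, hi⟩
    have hf : -(c 0 * c 1) ≠ 0 := neg_ne_zero.2 (mul_ne_zero (h0 0) (h0 1))
    have hns : ¬ IsSquare (-(c 0 * c 1)) := by
      rintro ⟨r, hr⟩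
      apply hi
      refine ⟨![r, c 0], fun h => h0 0 (by simpa using congrFun h 1), ?_⟩
      simp only [Fin.sum_univ_two, Matrix.cons_val_zero, Matrix.cons_val_one]
      linear_combination (-c 0) * hr
    obtain ⟨w, hw, _⟩ := real_R2 hns
    obtain ⟨b, hb, hbn⟩ := exists_nonnorm w hf hw
    exact ⟨b, ⟨hf, hb, one_ne_zero⟩, w, hbn, LSq.one⟩
  · rintro ⟨b, ⟨hf, hb, _⟩, v, hv, _⟩
    have h01 := mul_ne_zero_iff.1 (neg_ne_zero.1 hf)
    refine ⟨fun i => by fin_cases i; exacts [h01.1, h01.2], ?_⟩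
    rintro ⟨x, hx, hs⟩
    rw [Fin.sum_univ_two] at hs
    by_cases h1 : x 1 = 0
    · apply hx
      have h00 : x 0 = 0 := by
        rw [h1] at hs
        simpa [h01.1] using hs
      ext i
      fin_cases i
      exacts [h00, h1]
    · apply hv
      apply nm_of_sq_left hf
      apply sq_of_isSquare
      refine ⟨c 0 * x 0 / x 1, ?_⟩
      field_simp
      linear_combination (-c 0) * hs

theorem da3 (c : Fin 3 → K) : DA c ↔ AN (-(c 0 * c 1)) (-(c 0 * c 2)) 1 := by
  constructor
  · rintro ⟨h0, hi⟩
    have hf : -(c 0 * c 1) ≠ 0 := neg_ne_zero.2 (mul_ne_zero (h0 0) (h0 1))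
    have hg : -(c 0 * c 2) ≠ 0 := neg_ne_zero.2 (mul_ne_zero (h0 0) (h0 2))
    refine ⟨⟨hf, hg, one_ne_zero⟩, ?_⟩
    by_contra hcon
    push Not at hcon
    obtain ⟨p, q, hpq⟩ := hasse_norm hf hg (fun v => by
      by_contra h
      exact hcon v h (LSq.one))
    apply hi
    refine ⟨![p, c 0 * q, c 0], fun h => h0 0 (by simpa using congrFun h 2), ?_⟩
    rw [Fin.sum_univ_three]
    show c 0 * p ^ 2 + c 1 * (c 0 * q) ^ 2 + c 2 * c 0 ^ 2 = 0
    linear_combination (-c 0) * hpq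
  · rintro ⟨⟨hf, hg, _⟩, v, hv, _⟩
    have h01 := mul_ne_zero_iff.1 (neg_ne_zero.1 hf)
    have h02 := mul_ne_zero_iff.1 (neg_ne_zero.1 hg)
    refine ⟨fun i => by fin_cases i; exacts [h01.1, h01.2, h02.2], ?_⟩
    rintro ⟨x, hx, hs⟩
    rw [Fin.sum_univ_three] at hs
    apply hv
    refine hm4_conv hf hg one_ne_zero (x := c 0 * x 0) (y := x 1) (z := x 2) (t := 0) ?_ ?_ v (LSq.one)
    · rintro ⟨h1, h2, h3, _⟩
      apply hx
      have h1' : x 0 = 0 := by simpa [h01.1] using h1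
      ext i
      fin_cases i
      exacts [h1', h2, h3]
    · linear_combination c 0 * hs

theorem da4 (c : Fin 4 → K) : DA c ↔ AN (-(c 1 * c 2)) (-(c 1 * c 3)) (c 0 * c 1 * c 2 * c 3) := by
  constructor
  · rintro ⟨h0, hi⟩
    refine ⟨⟨neg_ne_zero.2 (mul_ne_zero (h0 1) (h0 2)), neg_ne_zero.2 (mul_ne_zero (h0 1) (h0 3)),
      mul_ne_zero (mul_ne_zero (mul_ne_zero (h0 0) (h0 1)) (h0 2)) (h0 3)⟩, ?_⟩
    rw [iso4_iff h0] at hi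
    push Not at hi
    obtain ⟨v, h1, h2⟩ := hi
    exact ⟨v, h2, h1⟩
  · rintro ⟨⟨_, _, h⟩, v, h1, h2⟩
    have h3 := mul_ne_zero_iff.1 h
    have h4 := mul_ne_zero_iff.1 h3.1
    have h5 := mul_ne_zero_iff.1 h4.1
    have h0 : ∀ i, c i ≠ 0 := fun i => by fin_cases i; exacts [h5.1, h5.2, h4.2, h3.2]
    refine ⟨h0, fun hi => ?_⟩
    rw [iso4_iff h0] at hi
    exact h1 (hi v h2)

theorem da5 (n : ℕ) (c : Fin (n + 5) → K) : DA c ↔ ∃ w : {w : InfinitePlace K // w.IsReal},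
    ∀ i j, SqN (Sum.inr w.1 : Place K) (c i * c j) := by
  constructor
  · rintro ⟨h0, hi⟩
    by_contra hcon
    push Not at hcon
    apply hi
    apply iso_ge5 n c h0
    intro w hw
    obtain ⟨i, j, hij⟩ := hcon ⟨w, hw⟩
    exact ⟨i, j, fun h => hij ⟨mul_ne_zero (h0 i) (h0 j), h⟩⟩
  · rintro ⟨⟨w, hw⟩, h⟩
    have h0 : ∀ i, c i ≠ 0 := fun i => left_ne_zero_of_mul (h i i).1
    refine ⟨h0, not_iso_of_def h0 hw ?_⟩
    rintro ⟨i, j, hij⟩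
    exact hij (h i j).2

instance D.da {ι : Type*} {n : ℕ} (c : Fin n → (ι → K) → K) [h : ∀ i, PF (c i)] : D (fun a => DA (fun i => c i a)) := by
  match n, c, h with
  | 0, c, h => exact (D.const True).congr fun a => by simp [da0]
  | 1, c, h => exact (D.ne_zero (c 0)).congr fun a => da1 _
  | 2, c, h =>
    have : D (fun a => ∃ b, AN (-(c 0 a * c 1 a)) b 1) := inferInstance
    exact this.congr fun a => da2 _
  | 3, c, h =>
    have : D (fun a => AN (-(c 0 a * c 1 a)) (-(c 0 a * c 2 a)) 1) := inferInstance
    exact this.congr fun a => da3 _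
  | 4, c, h =>
    have : D (fun a => AN (-(c 1 a * c 2 a)) (-(c 1 a * c 3 a)) (c 0 a * c 1 a * c 2 a * c 3 a)) := inferInstance
    exact this.congr fun a => da4 _
  | n + 5, c, h =>
    have : D (fun a => ∃ w : {w : InfinitePlace K // w.IsReal}, ∀ i j, SqN (Sum.inr w.1 : Place K) (c i a * c j a)) :=
      D.exists_finite _ (fun w => inferInstance)
    exact this.congr fun a => da5 n _

/-- matrix of the symmetrised form -/
def symM {m : ℕ} (A : Fin m × Fin m → K) : Matrix (Fin m) (Fin m) K := Matrix.of fun i j => A (i, j) + A (j, i)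

theorem quad_symM {m : ℕ} (A : Fin m × Fin m → K) (x : Fin m → K) :
    dotProduct x (Matrix.mulVec (symM A) x) = 2 * ∑ p : Fin m × Fin m, A p * x p.1 * x p.2 := by
  have h1 : dotProduct x (Matrix.mulVec (symM A) x) = (∑ i, ∑ j, A (i, j) * x i * x j) + ∑ i, ∑ j, A (j, i) * x i * x j := by
    simp only [dotProduct, Matrix.mulVec, symM, Matrix.of_apply, Finset.mul_sum]
    rw [← Finset.sum_add_distrib]
    refine Finset.sum_congr rfl fun i _ => ?_
    rw [← Finset.sum_add_distrib]
    exact Finset.sum_congr rfl fun j _ => by ring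
  have h2 : ∑ i, ∑ j, A (j, i) * x i * x j = ∑ i, ∑ j, A (i, j) * x i * x j := by
    rw [Finset.sum_comm]
    exact Finset.sum_congr rfl fun i _ => Finset.sum_congr rfl fun j _ => by ring
  rw [h1, h2, Fintype.sum_prod_type, two_mul]

/-- anisotropy -/
def Anis {m : ℕ} (A : Fin m × Fin m → K) : Prop := ∀ x : Fin m → K, (∑ p : Fin m × Fin m, A p * x p.1 * x p.2) = 0 → x = 0

theorem quad_diag {m : ℕ} {S P : Matrix (Fin m) (Fin m) K} {c : Fin m → K} (h : P.transpose * S * P = Matrix.diagonal c)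
    (y : Fin m → K) : dotProduct (P.mulVec y) (S.mulVec (P.mulVec y)) = ∑ i, c i * y i ^ 2 := by
  have : dotProduct (P.mulVec y) (S.mulVec (P.mulVec y)) = dotProduct y ((P.transpose * S * P).mulVec y) := by
    rw [← Matrix.mulVec_mulVec, ← Matrix.mulVec_mulVec, Matrix.dotProduct_mulVec y, Matrix.vecMul_transpose]
  rw [this, h]
  simp only [dotProduct, Matrix.mulVec_diagonal]
  exact Finset.sum_congr rfl fun i _ => by ring

theorem anis_of_diag {m : ℕ} {A : Fin m × Fin m → K} {P Q : Matrix (Fin m) (Fin m) K} {c : Fin m → K} (hPQ : P * Q = 1)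
    (h : P.transpose * symM A * P = Matrix.diagonal c) : Anis A ↔ ¬ Iso c := by
  have hQP : Q * P = 1 := mul_eq_one_comm.1 hPQ
  constructor
  · rintro hA ⟨y, hy, hs⟩
    rw [← quad_diag h, quad_symM] at hs
    have := hA (P.mulVec y) (by simpa using hs)
    apply hy
    have h2 : Q.mulVec (P.mulVec y) = y := by rw [Matrix.mulVec_mulVec, hQP, Matrix.one_mulVec]
    rw [← h2, this, Matrix.mulVec_zero]
  · intro hI x hx
    by_contra hx0
    have h2 : P.mulVec (Q.mulVec x) = x := by rw [Matrix.mulVec_mulVec, hPQ, Matrix.one_mulVec]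
    apply hI
    refine ⟨Q.mulVec x, ?_, ?_⟩
    · intro h0
      rw [h0, Matrix.mulVec_zero] at h2
      exact hx0 h2.symm
    · rw [← quad_diag h, h2, quad_symM, hx, mul_zero]

theorem exists_diag {m : ℕ} (A : Fin m × Fin m → K) : ∃ (P Q : Matrix (Fin m) (Fin m) K) (c : Fin m → K), P * Q = 1 ∧
    P.transpose * symM A * P = Matrix.diagonal c := by
  classical
  have hsym : (Matrix.toBilin' (symM A)).IsSymm := by
    refine ⟨fun x y => ?_⟩
    simp only [Matrix.toBilin'_apply, symM, Matrix.of_apply, RingHom.id_apply]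
    rw [Finset.sum_comm]
    exact Finset.sum_congr rfl fun i _ => Finset.sum_congr rfl fun j _ => by ring
  have : Invertible (2 : K) := invertibleOfNonzero two_ne_zero
  obtain ⟨v, hv⟩ := LinearMap.BilinForm.exists_orthogonal_basis (LinearMap.BilinForm.isSymm_iff.1 hsym)
  have hfr : Module.finrank K (Fin m → K) = m := by simp
  set w := v.reindex (finCongr hfr) with hw
  refine ⟨(Pi.basisFun K (Fin m)).toMatrix w, w.toMatrix (Pi.basisFun K (Fin m)),
    fun i => Matrix.toBilin' (symM A) (w i) (w i), Module.Basis.toMatrix_mul_toMatrix_flip _ _, ?_⟩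
  ext i j
  have e : (((Pi.basisFun K (Fin m)).toMatrix w).transpose * symM A * (Pi.basisFun K (Fin m)).toMatrix w) i j =
      Matrix.toBilin' (symM A) (w i) (w j) := by
    rw [Matrix.toBilin'_apply']
    simp only [Matrix.mul_apply, dotProduct, Matrix.mulVec, Matrix.transpose_apply, Module.Basis.toMatrix_apply, Pi.basisFun_repr,
      Finset.sum_mul, Finset.mul_sum]
    rw [Finset.sum_comm]
    exact Finset.sum_congr rfl fun i _ => Finset.sum_congr rfl fun j _ => by ring
  rw [e]
  by_cases hij : i = j
  · subst hij; simp
  · rw [Matrix.diagonal_apply_ne _ hij]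
    simp only [hw, Module.Basis.reindex_apply]
    exact hv (by simpa using hij)

theorem anis_diag_ne {m : ℕ} {A : Fin m × Fin m → K} {c : Fin m → K} (h : ¬ Iso c) (i : Fin m) : c i ≠ 0 := by
  intro hi
  apply h
  refine ⟨Pi.single i 1, fun h0 => one_ne_zero (α := K) (by simpa using congrFun h0 i), ?_⟩
  refine Finset.sum_eq_zero fun j _ => ?_
  by_cases hj : j = i
  · rw [hj, hi, zero_mul]
  · simp [Pi.single_eq_of_ne hj]

theorem anis_iff {m : ℕ} (A : Fin m × Fin m → K) : Anis A ↔ ∃ P Q : Fin m × Fin m → K, ∃ c : Fin m → K,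
    (∀ i j, ∑ k, P (i, k) * Q (k, j) = if i = j then (1 : K) else 0) ∧
    (∀ i j, ∑ k, (∑ l, P (l, i) * (A (l, k) + A (k, l))) * P (k, j) = (if i = j then (1 : K) else 0) * c i) ∧ DA c := by
  constructor
  · intro hA
    obtain ⟨P, Q, c, h1, h2⟩ := exists_diag A
    have hI := (anis_of_diag h1 h2).1 hA
    refine ⟨fun p => P p.1 p.2, fun p => Q p.1 p.2, c, fun i j => ?_, fun i j => ?_, fun i => anis_diag_ne (A := A) hI i, hI⟩
    · have := congrFun (congrFun h1 i) j
      rw [Matrix.mul_apply, Matrix.one_apply] at this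
      exact this
    · have := congrFun (congrFun h2 i) j
      simp only [Matrix.mul_apply, Matrix.diagonal_apply, Matrix.transpose_apply, symM, Matrix.of_apply] at this
      rw [ite_mul, one_mul, zero_mul]
      exact this
  · rintro ⟨P, Q, c, h1, h2, _, hI⟩
    refine (anis_of_diag (P := Matrix.of fun i j => P (i, j)) (Q := Matrix.of fun i j => Q (i, j)) (c := c) ?_ ?_).2 hI
    · ext i j
      rw [Matrix.mul_apply, Matrix.one_apply]
      exact h1 i j
    · ext i j
      have := h2 i j
      rw [ite_mul, one_mul, zero_mul] at this
      simp only [Matrix.mul_apply, Matrix.diagonal_apply, Matrix.transpose_apply, symM, Matrix.of_apply]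
      exact this

theorem D.anis (m : ℕ) : D (fun A : Fin m × Fin m → K => Anis A) := by
  have : D (fun A : Fin m × Fin m → K => ∃ P Q : Fin m × Fin m → K, ∃ c : Fin m → K,
    (∀ i j, ∑ k, P (i, k) * Q (k, j) = if i = j then (1 : K) else 0) ∧
    (∀ i j, ∑ k, (∑ l, P (l, i) * (A (l, k) + A (k, l))) * P (k, j) = (if i = j then (1 : K) else 0) * c i) ∧ DA c) := by
    infer_instance
  exact this.congr anis_iff

end
end ADQ

/-- Over a number field `K`, the set of coefficient matrices `(a_ij) ∈ K^(m²)` whose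
associated quadratic form `∑ a_ij x_i x_j` has no nontrivial zero is diophantine over `K`. -/
theorem anisotropic_general_diophantine_numberField
    (K : Type*) [Field K] [NumberField K] (m : ℕ) (hm : 1 ≤ m) :
    IsDiophantine {a : Fin m × Fin m → K |
      ∀ x : Fin m → K, (∑ p : Fin m × Fin m, a p * x p.1 * x p.2) = 0 → x = 0} := by
  exact (ADQ.D.anis (K := K) m).out
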